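/- For every odd p ≥ 3, every quasisymmetric self-homeomorphism f of S_p preserves the middle and outer squares as a pair: either f(O) = O and f(M) = M, or f(O) = M and f(M) = O (images taken as sets). -/

import Mathlib

open Set Metric

noncomputable section

/-- Level-`n` approximation `Q_n` of the standard `1/p`-Sierpiński carpet in `ℂ ≅ ℝ²`:
`Q_0` is the closed unit square, and `Q_{n+1}` is the union of the images of `Q_n` under
the `p² - 1` contractions `z ↦ (z + i + j·√-1)/p` with `(i,j)` ranging over all non-middle
positions; this is the usual subdivide-and-remove-middle-squares construction. -/
def carpetApprox (p : ℕ) : ℕ → Set ℂ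
  | 0 => {z : ℂ | z.re ∈ Set.Icc (0:ℝ) 1 ∧ z.im ∈ Set.Icc (0:ℝ) 1}
  | n + 1 =>
      ⋃ (i : ℕ) (j : ℕ) (_ : i < p) (_ : j < p)
        (_ : ¬(i = (p - 1) / 2 ∧ j = (p - 1) / 2)),
        (fun z : ℂ => (z + (i : ℂ) + (j : ℂ) * Complex.I) / (p : ℂ)) '' carpetApprox p n

/-- The standard `1/p`-Sierpiński carpet `S_p ⊆ ℝ² ≅ ℂ`. -/
def sierpinskiCarpet (p : ℕ) : Set ℂ := ⋂ n, carpetApprox p n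

/-- `η : [0,∞) → [0,∞)` is a (self-)homeomorphism of `[0,∞)`: it is continuous, strictly
increasing on `[0,∞)`, fixes `0` and maps `[0,∞)` onto `[0,∞)`. -/
def IsQSControl (η : ℝ → ℝ) : Prop :=
  ContinuousOn η (Set.Ici 0) ∧ StrictMonoOn η (Set.Ici 0) ∧ η 0 = 0 ∧
    Set.SurjOn η (Set.Ici 0) (Set.Ici 0)

/-- A map `f` between metric spaces is quasisymmetric: for some homeomorphism
`η : [0,∞) → [0,∞)` one has `d(f u, f v) ≤ η(d(u,v)/d(u,w)) · d(f u, f w)` for all `u,v,w`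
with `u ≠ w`. -/
def IsQSMap {X Y : Type*} [MetricSpace X] [MetricSpace Y] (f : X → Y) : Prop :=
  ∃ η : ℝ → ℝ, IsQSControl η ∧
    ∀ u v w : X, u ≠ w → dist (f u) (f v) ≤ η (dist u v / dist u w) * dist (f u) (f w)

/-- The boundary of the axis-parallel closed square with lower-left corner `c` and
side length `l`. -/
def squareBoundary (c : ℂ) (l : ℝ) : Set ℂ :=
  {z : ℂ | max |z.re - (c.re + l / 2)| |z.im - (c.im + l / 2)| = l / 2}

/-- The outer square `O = ∂([0,1]×[0,1])`. -/
def outerSquare : Set ℂ := squareBoundary 0 1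

/-- The middle square `M = ∂([(p-1)/(2p),(p+1)/(2p)]²)`. -/
def middleSquare (p : ℕ) : Set ℂ :=
  squareBoundary ((((p : ℝ) - 1) / (2 * p) : ℝ) * (1 + Complex.I)) (1 / p)

end

namespace Carpet

noncomputable section

/-- The standing assumption on the base: `p ≥ 3` is odd. -/
class OddBase (p : ℕ) : Prop where
  three_le : 3 ≤ p
  odd : Odd p

variable {p : ℕ}

/-- The index of the middle row and column. -/
def mid (p : ℕ) : ℕ := (p - 1) / 2

/-- The positions of the subsquares kept in each subdivision step. -/
abbrev Digit (p : ℕ) : Type :=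
  {d : Fin p × Fin p // ¬((d.1 : ℕ) = mid p ∧ (d.2 : ℕ) = mid p)}

/-- The contraction of the unit square onto the subsquare at position `d`. -/
def sub (d : Digit p) (z : ℂ) : ℂ :=
  (z + ((d.1.1 : ℕ) : ℂ) + ((d.1.2 : ℕ) : ℂ) * Complex.I) / (p : ℂ)

/-- The composition of the contractions along a word. -/
def wordMap : List (Digit p) → ℂ → ℂ
  | [], z => z
  | d :: w, z => sub d (wordMap w z)

/-- The closed unit square. -/
def unitSq : Set ℂ := {z : ℂ | z.re ∈ Icc (0 : ℝ) 1 ∧ z.im ∈ Icc (0 : ℝ) 1}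

/-- The open unit square. -/
def openSq : Set ℂ := {z : ℂ | z.re ∈ Ioo (0 : ℝ) 1 ∧ z.im ∈ Ioo (0 : ℝ) 1}

/-- The open middle square. -/
def openMid (p : ℕ) : Set ℂ :=
  {z : ℂ | z.re ∈ Ioo ((mid p : ℝ) / p) (((mid p : ℝ) + 1) / p) ∧
    z.im ∈ Ioo ((mid p : ℝ) / p) (((mid p : ℝ) + 1) / p)}

lemma two_mid_add_one [h : OddBase p] : 2 * mid p + 1 = p := by
  obtain ⟨k, hk⟩ := h.odd
  unfold mid; omega

lemma one_le_mid [h : OddBase p] : 1 ≤ mid p := by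
  have := h.three_le
  unfold mid; omega

lemma base_eq [OddBase p] : (p : ℝ) = 2 * mid p + 1 := by
  exact_mod_cast (two_mid_add_one (p := p)).symm

lemma base_pos [h : OddBase p] : (0 : ℝ) < p := by
  have := h.three_le
  exact_mod_cast (by omega : 0 < p)

lemma three_le_base [h : OddBase p] : (3 : ℝ) ≤ p := by
  exact_mod_cast h.three_le

lemma one_le_mid_real [OddBase p] : (1 : ℝ) ≤ mid p := by
  exact_mod_cast one_le_mid (p := p)

/-! ### The contractions -/

lemma sub_eq (d : Digit p) (z : ℂ) :
    sub d z = ((p : ℝ)⁻¹ : ℝ) * (z + (((d.1.1 : ℕ) : ℝ) : ℂ)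
      + (((d.1.2 : ℕ) : ℝ) : ℂ) * Complex.I) := by
  simp [sub, div_eq_inv_mul]

@[simp] lemma sub_re (d : Digit p) (z : ℂ) : (sub d z).re = (z.re + (d.1.1 : ℕ)) / p := by
  rw [sub_eq, Complex.re_ofReal_mul]; simp [div_eq_inv_mul]

@[simp] lemma sub_im (d : Digit p) (z : ℂ) : (sub d z).im = (z.im + (d.1.2 : ℕ)) / p := by
  rw [sub_eq, Complex.im_ofReal_mul]; simp [div_eq_inv_mul]

lemma continuous_sub (d : Digit p) : Continuous (sub d) := by
  unfold sub; fun_prop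

lemma continuous_wordMap (w : List (Digit p)) : Continuous (wordMap w) := by
  induction w with
  | nil => exact continuous_id
  | cons d w ih => exact (continuous_sub d).comp ih

lemma wordMap_append (w v : List (Digit p)) (z : ℂ) :
    wordMap (w ++ v) z = wordMap w (wordMap v z) := by
  induction w with
  | nil => rfl
  | cons d w ih => simp [wordMap, ih]

/-- The lower left corner of the cell of a word. -/
def corner (w : List (Digit p)) : ℂ := wordMap w 0

lemma wordMap_eq (w : List (Digit p)) (z : ℂ) :
    wordMap w z = corner w + z / (p : ℂ) ^ w.length := by
  unfold corner
  induction w with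
  | nil => simp [wordMap]
  | cons d w ih =>
    simp only [wordMap, List.length_cons]
    rw [ih]; unfold sub; rw [pow_succ, ← div_div]; ring

lemma wordMap_re (w : List (Digit p)) (z : ℂ) :
    (wordMap w z).re = (corner w).re + z.re / (p : ℝ) ^ w.length := by
  rw [wordMap_eq, Complex.add_re]
  congr 1
  rw [show (p : ℂ) ^ w.length = (((p : ℝ) ^ w.length : ℝ) : ℂ) by push_cast; rfl,
    Complex.div_ofReal_re]

lemma wordMap_im (w : List (Digit p)) (z : ℂ) :
    (wordMap w z).im = (corner w).im + z.im / (p : ℝ) ^ w.length := by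
  rw [wordMap_eq, Complex.add_im]
  congr 1
  rw [show (p : ℂ) ^ w.length = (((p : ℝ) ^ w.length : ℝ) : ℂ) by push_cast; rfl,
    Complex.div_ofReal_im]

lemma dist_wordMap (w : List (Digit p)) (z z' : ℂ) :
    dist (wordMap w z) (wordMap w z') = dist z z' / (p : ℝ) ^ w.length := by
  rw [wordMap_eq, wordMap_eq, dist_add_left, dist_eq_norm, dist_eq_norm, ← sub_div, norm_div,
    norm_pow, Complex.norm_natCast]

lemma wordMap_injective [OddBase p] (w : List (Digit p)) : Function.Injective (wordMap w) := by
  intro z z' h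
  have h1 := dist_wordMap w z z'
  rw [h, dist_self] at h1
  have : (0 : ℝ) < (p : ℝ) ^ w.length := pow_pos base_pos _
  have : dist z z' = 0 := by
    rcases div_eq_zero_iff.1 h1.symm with h | h
    · exact h
    · exact absurd h this.ne'
  exact dist_eq_zero.1 this

lemma sub_injective [OddBase p] (d : Digit p) : Function.Injective (sub d) :=
  wordMap_injective [d]

/-! ### The boundary squares -/

lemma mem_squareBoundary {c z : ℂ} {l : ℝ} :
    z ∈ squareBoundary c l ↔ (c.re ≤ z.re ∧ z.re ≤ c.re + l) ∧ (c.im ≤ z.im ∧ z.im ≤ c.im + l) ∧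
      (z.re = c.re ∨ z.re = c.re + l ∨ z.im = c.im ∨ z.im = c.im + l) := by
  simp only [squareBoundary, mem_ofPred_eq]
  constructor
  · intro h
    have h1 : |z.re - (c.re + l / 2)| ≤ l / 2 := (le_max_left _ _).trans_eq h
    have h2 : |z.im - (c.im + l / 2)| ≤ l / 2 := (le_max_right _ _).trans_eq h
    rw [abs_le] at h1 h2
    refine ⟨⟨by linarith, by linarith⟩, ⟨by linarith, by linarith⟩, ?_⟩
    rcases max_choice |z.re - (c.re + l / 2)| |z.im - (c.im + l / 2)| with h3 | h3
    · rw [h3] at h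
      rcases abs_choice (z.re - (c.re + l / 2)) with h4 | h4
      · right; left; linarith
      · left; linarith
    · rw [h3] at h
      rcases abs_choice (z.im - (c.im + l / 2)) with h4 | h4
      · right; right; right; linarith
      · right; right; left; linarith
  · rintro ⟨⟨h1, h2⟩, ⟨h3, h4⟩, h⟩
    have h5 : |z.re - (c.re + l / 2)| ≤ l / 2 := by rw [abs_le]; constructor <;> linarith
    have h6 : |z.im - (c.im + l / 2)| ≤ l / 2 := by rw [abs_le]; constructor <;> linarith
    apply le_antisymm (max_le h5 h6)
    rcases h with h | h | h | h
    · exact le_max_of_le_left (by rw [h, abs_sub_comm]; exact le_trans (by linarith) (le_abs_self _))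
    · exact le_max_of_le_left (by rw [h]; exact le_trans (by linarith) (le_abs_self _))
    · exact le_max_of_le_right (by rw [h, abs_sub_comm]; exact le_trans (by linarith) (le_abs_self _))
    · exact le_max_of_le_right (by rw [h]; exact le_trans (by linarith) (le_abs_self _))

lemma mem_outerSquare {z : ℂ} :
    z ∈ outerSquare ↔ z ∈ unitSq ∧ (z.re = 0 ∨ z.re = 1 ∨ z.im = 0 ∨ z.im = 1) := by
  rw [outerSquare, mem_squareBoundary]
  simp [unitSq, and_assoc]

lemma mid_div_eq [OddBase p] : ((p : ℝ) - 1) / (2 * p) = mid p / p := by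
  have := base_pos (p := p)
  rw [base_eq] at *
  field_simp; ring

lemma mem_middleSquare [OddBase p] {z : ℂ} :
    z ∈ middleSquare p ↔ ((mid p : ℝ) / p ≤ z.re ∧ z.re ≤ (mid p + 1 : ℝ) / p) ∧
      ((mid p : ℝ) / p ≤ z.im ∧ z.im ≤ (mid p + 1 : ℝ) / p) ∧
      (z.re = (mid p : ℝ) / p ∨ z.re = (mid p + 1 : ℝ) / p ∨
        z.im = (mid p : ℝ) / p ∨ z.im = (mid p + 1 : ℝ) / p) := by
  rw [middleSquare, mem_squareBoundary, mid_div_eq, Complex.re_ofReal_mul, Complex.im_ofReal_mul]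
  simp [add_div]

/-! ### Self-similarity -/

lemma mem_carpetApprox_succ {n : ℕ} {z : ℂ} :
    z ∈ carpetApprox p (n + 1) ↔ ∃ d : Digit p, ∃ y ∈ carpetApprox p n, sub d y = z := by
  simp only [carpetApprox, mem_iUnion, mem_image]
  constructor
  · rintro ⟨i, j, hi, hj, hd, y, hy, rfl⟩
    exact ⟨⟨(⟨i, hi⟩, ⟨j, hj⟩), hd⟩, y, hy, rfl⟩
  · rintro ⟨⟨⟨i, j⟩, hd⟩, y, hy, rfl⟩
    exact ⟨i, j, i.2, j.2, hd, y, hy, rfl⟩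

lemma digit_fst_le (d : Digit p) : ((d.1.1 : ℕ) : ℝ) + 1 ≤ p := by exact_mod_cast d.1.1.2
lemma digit_snd_le (d : Digit p) : ((d.1.2 : ℕ) : ℝ) + 1 ≤ p := by exact_mod_cast d.1.2.2

lemma sub_mem_unitSq [OddBase p] (d : Digit p) {z : ℂ} (hz : z ∈ unitSq) : sub d z ∈ unitSq := by
  have hp := base_pos (p := p)
  obtain ⟨⟨h1, h2⟩, h3, h4⟩ := hz
  refine ⟨⟨?_, ?_⟩, ?_, ?_⟩ <;> simp only [sub_re, sub_im]
  · positivity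
  · rw [div_le_one hp]; linarith [digit_fst_le d]
  · positivity
  · rw [div_le_one hp]; linarith [digit_snd_le d]

lemma carpetApprox_succ_subset [OddBase p] (n : ℕ) :
    carpetApprox p (n + 1) ⊆ carpetApprox p n := by
  induction n with
  | zero =>
    intro z hz
    obtain ⟨d, y, hy, rfl⟩ := mem_carpetApprox_succ.1 hz
    exact sub_mem_unitSq d hy
  | succ n ih =>
    intro z hz
    obtain ⟨d, y, hy, rfl⟩ := mem_carpetApprox_succ.1 hz
    exact mem_carpetApprox_succ.2 ⟨d, y, ih hy, rfl⟩

lemma carpetApprox_antitone [OddBase p] : Antitone (carpetApprox p) :=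
  antitone_nat_of_succ_le carpetApprox_succ_subset

lemma mem_carpet {z : ℂ} : z ∈ sierpinskiCarpet p ↔ ∀ n, z ∈ carpetApprox p n := by
  simp [sierpinskiCarpet]

lemma carpet_subset_unitSq : sierpinskiCarpet p ⊆ unitSq := fun _ hz => mem_carpet.1 hz 0

lemma sub_mem_carpet [OddBase p] (d : Digit p) {z : ℂ} (hz : z ∈ sierpinskiCarpet p) :
    sub d z ∈ sierpinskiCarpet p :=
  mem_carpet.2 fun n => carpetApprox_succ_subset n
    (mem_carpetApprox_succ.2 ⟨d, z, mem_carpet.1 hz n, rfl⟩)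

lemma wordMap_mem_carpet [OddBase p] (w : List (Digit p)) {z : ℂ}
    (hz : z ∈ sierpinskiCarpet p) : wordMap w z ∈ sierpinskiCarpet p := by
  induction w with
  | nil => exact hz
  | cons d w ih => exact sub_mem_carpet d ih

lemma wordMap_mem_unitSq [OddBase p] (w : List (Digit p)) {z : ℂ}
    (hz : z ∈ unitSq) : wordMap w z ∈ unitSq := by
  induction w with
  | nil => exact hz
  | cons d w ih => exact sub_mem_unitSq d ih

lemma exists_sub_eq [OddBase p] {z : ℂ} (hz : z ∈ sierpinskiCarpet p) :
    ∃ d : Digit p, ∃ y ∈ sierpinskiCarpet p, sub d y = z := by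
  have h : ∀ n, ∃ d : Digit p, ∃ y ∈ carpetApprox p n, sub d y = z := fun n =>
    mem_carpetApprox_succ.1 (mem_carpet.1 hz (n + 1))
  choose d y hy hyz using h
  obtain ⟨e, he⟩ := Finite.exists_infinite_fiber d
  rw [Set.infinite_coe_iff] at he
  obtain ⟨n₀, hn₀⟩ := he.nonempty
  refine ⟨e, y n₀, mem_carpet.2 fun n => ?_, by rw [← hyz n₀]; rw [hn₀]⟩
  obtain ⟨k, hk, hnk⟩ := he.exists_gt n
  have : y k = y n₀ := sub_injective e (by
    have h1 := hyz k
    have h2 := hyz n₀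
    rw [show d k = e from hk] at h1
    rw [show d n₀ = e from hn₀] at h2
    rw [h1, h2])
  exact this ▸ carpetApprox_antitone hnk.le (hy k)

lemma exists_wordMap_eq [OddBase p] (n : ℕ) {z : ℂ} (hz : z ∈ sierpinskiCarpet p) :
    ∃ w : List (Digit p), w.length = n ∧ ∃ y ∈ sierpinskiCarpet p, wordMap w y = z := by
  induction n generalizing z with
  | zero => exact ⟨[], rfl, z, hz, rfl⟩
  | succ n ih =>
    obtain ⟨d, y, hy, rfl⟩ := exists_sub_eq hz
    obtain ⟨w, hw, x, hx, rfl⟩ := ih hy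
    exact ⟨d :: w, by simp [hw], x, hx, rfl⟩

/-- Each coordinate in the unit interval lies in one of the `p` closed subintervals. -/
lemma exists_fin_coord [OddBase p] {s : ℝ} (hs : s ∈ Icc (0 : ℝ) 1) :
    ∃ i : Fin p, p * s - (i : ℕ) ∈ Icc (0 : ℝ) 1 := by
  have hp := base_pos (p := p)
  have hp' : 0 < p := by exact_mod_cast hp
  rcases hs.2.lt_or_eq with h | h
  · refine ⟨⟨⌊p * s⌋₊, (Nat.floor_lt (by have := hs.1; positivity)).2 (by nlinarith)⟩, ?_, ?_⟩
    · have := Nat.floor_le (show 0 ≤ p * s by have := hs.1; positivity)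
      simp only; linarith
    · have := (Nat.lt_floor_add_one (p * s)).le
      simp only; linarith
  · refine ⟨⟨p - 1, by omega⟩, ?_⟩
    have : ((p - 1 : ℕ) : ℝ) = p - 1 := by rw [Nat.cast_sub hp']; simp
    simp [h, this]

/-- The inverse of a contraction, in coordinates. -/
lemma sub_mk [OddBase p] (d : Digit p) (z : ℂ) :
    sub d ⟨p * z.re - (d.1.1 : ℕ), p * z.im - (d.1.2 : ℕ)⟩ = z := by
  have hp := base_pos (p := p)
  apply Complex.ext
  · rw [sub_re]; field_simp; ring
  · rw [sub_im]; field_simp; ring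

lemma exists_fin_gridCoord [OddBase p] {s : ℝ} (hs : s ∈ Icc (0 : ℝ) 1) {k : ℕ}
    (hk : p * s = k) : ∃ i : Fin p, (i : ℕ) ≠ mid p ∧
      (p * s - (i : ℕ) = 0 ∨ p * s - (i : ℕ) = 1) := by
  have hp := base_pos (p := p)
  have h1 := two_mid_add_one (p := p)
  have h2 := one_le_mid (p := p)
  have hkp : k ≤ p := by
    have : (k : ℝ) ≤ p := by rw [← hk]; nlinarith [hs.2]
    exact_mod_cast this
  by_cases h : k < p ∧ k ≠ mid p
  · exact ⟨⟨k, h.1⟩, h.2, Or.inl (by simp [hk])⟩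
  · refine ⟨⟨k - 1, by omega⟩, by simp only; omega, Or.inr ?_⟩
    have : 1 ≤ k := by omega
    simp only [hk]
    rw [Nat.cast_sub this]; simp

/-- The union of the closed grid lines of the first subdivision. -/
def gridLines (p : ℕ) : Set ℂ :=
  {z : ℂ | z ∈ unitSq ∧ ((∃ k : ℕ, p * z.re = k) ∨ ∃ k : ℕ, p * z.im = k)}

lemma gridLines_subset_carpet [OddBase p] : gridLines p ⊆ sierpinskiCarpet p := by
  have key : ∀ n, gridLines p ⊆ carpetApprox p n := by
    intro n
    induction n with
    | zero => exact fun z hz => hz.1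
    | succ n ih =>
      rintro z ⟨hz, h | h⟩
      · obtain ⟨k, hk⟩ := h
        obtain ⟨i, hi, hi'⟩ := exists_fin_gridCoord hz.1 hk
        obtain ⟨j, hj⟩ := exists_fin_coord (p := p) hz.2
        refine mem_carpetApprox_succ.2 ⟨⟨(i, j), fun h => hi h.1⟩, _, ih ⟨⟨?_, hj⟩, ?_⟩, sub_mk _ z⟩
        · rcases hi' with h | h <;> simp [h]
        · left
          rcases hi' with h | h
          · exact ⟨0, by simp [h]⟩
          · exact ⟨p, by simp [h]⟩
      · obtain ⟨k, hk⟩ := h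
        obtain ⟨j, hj, hj'⟩ := exists_fin_gridCoord hz.2 hk
        obtain ⟨i, hi⟩ := exists_fin_coord (p := p) hz.1
        refine mem_carpetApprox_succ.2 ⟨⟨(i, j), fun h => hj h.2⟩, _, ih ⟨⟨hi, ?_⟩, ?_⟩, sub_mk _ z⟩
        · rcases hj' with h | h <;> simp [h]
        · right
          rcases hj' with h | h
          · exact ⟨0, by simp [h]⟩
          · exact ⟨p, by simp [h]⟩
  exact fun z hz => mem_carpet.2 fun n => key n hz

lemma outerSquare_subset_gridLines : outerSquare ⊆ gridLines p := by
  intro z hz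
  obtain ⟨hz, h⟩ := mem_outerSquare.1 hz
  refine ⟨hz, ?_⟩
  rcases h with h | h | h | h
  · exact Or.inl ⟨0, by simp [h]⟩
  · exact Or.inl ⟨p, by simp [h]⟩
  · exact Or.inr ⟨0, by simp [h]⟩
  · exact Or.inr ⟨p, by simp [h]⟩

lemma outerSquare_subset_carpet [OddBase p] : outerSquare ⊆ sierpinskiCarpet p :=
  outerSquare_subset_gridLines.trans gridLines_subset_carpet

lemma mid_div_pos [OddBase p] : (0 : ℝ) < mid p / p :=
  div_pos (by linarith [one_le_mid_real (p := p)]) base_pos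

lemma mid_add_one_div_lt [OddBase p] : (mid p + 1 : ℝ) / p < 1 := by
  rw [div_lt_one base_pos]
  linarith [one_le_mid_real (p := p), base_eq (p := p)]

lemma middleSquare_subset_openSq [OddBase p] : middleSquare p ⊆ openSq := by
  intro z hz
  obtain ⟨h1, h2, -⟩ := mem_middleSquare.1 hz
  have := mid_div_pos (p := p)
  have := mid_add_one_div_lt (p := p)
  exact ⟨⟨by linarith, by linarith⟩, by linarith, by linarith⟩

lemma openSq_subset_unitSq : openSq ⊆ unitSq :=
  fun _ hz => ⟨Ioo_subset_Icc_self hz.1, Ioo_subset_Icc_self hz.2⟩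

lemma middleSquare_subset_gridLines [OddBase p] : middleSquare p ⊆ gridLines p := by
  intro z hz
  have hp := base_pos (p := p)
  refine ⟨openSq_subset_unitSq (middleSquare_subset_openSq hz), ?_⟩
  obtain ⟨-, -, h⟩ := mem_middleSquare.1 hz
  rcases h with h | h | h | h
  · exact Or.inl ⟨mid p, by rw [h]; field_simp⟩
  · exact Or.inl ⟨mid p + 1, by rw [h]; field_simp; push_cast; ring⟩
  · exact Or.inr ⟨mid p, by rw [h]; field_simp⟩
  · exact Or.inr ⟨mid p + 1, by rw [h]; field_simp; push_cast; ring⟩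

lemma middleSquare_subset_carpet [OddBase p] : middleSquare p ⊆ sierpinskiCarpet p :=
  middleSquare_subset_gridLines.trans gridLines_subset_carpet

lemma mem_openSq_or_outerSquare {z : ℂ} (hz : z ∈ unitSq) : z ∈ openSq ∨ z ∈ outerSquare := by
  by_cases h : z ∈ outerSquare
  · exact Or.inr h
  · left
    have h' : ¬(z.re = 0 ∨ z.re = 1 ∨ z.im = 0 ∨ z.im = 1) :=
      fun h1 => h (mem_outerSquare.2 ⟨hz, h1⟩)
    push Not at h'
    exact ⟨⟨lt_of_le_of_ne hz.1.1 h'.1.symm, lt_of_le_of_ne hz.1.2 h'.2.1⟩,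
      lt_of_le_of_ne hz.2.1 h'.2.2.1.symm, lt_of_le_of_ne hz.2.2 h'.2.2.2⟩

lemma notMem_outerSquare {z : ℂ} (hz : z ∈ openSq) : z ∉ outerSquare := by
  intro h
  obtain ⟨-, h⟩ := mem_outerSquare.1 h
  obtain ⟨⟨h1, h2⟩, h3, h4⟩ := hz
  rcases h with h | h | h | h <;> linarith

/-! ### Complementary squares -/

lemma exists_sub_eq_or_mem_openMid [OddBase p] {z : ℂ} (hz : z ∈ unitSq) :
    (∃ d : Digit p, ∃ y ∈ unitSq, sub d y = z) ∨ z ∈ openMid p := by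
  have hp := base_pos (p := p)
  by_cases h : z ∈ gridLines p
  · left
    obtain ⟨d, y, hy, h⟩ := exists_sub_eq (gridLines_subset_carpet h)
    exact ⟨d, y, carpet_subset_unitSq hy, h⟩
  · obtain ⟨i, hi⟩ := exists_fin_coord (p := p) hz.1
    obtain ⟨j, hj⟩ := exists_fin_coord (p := p) hz.2
    by_cases hd : (i : ℕ) = mid p ∧ (j : ℕ) = mid p
    · right
      have h' : ∀ k : ℕ, p * z.re ≠ k ∧ p * z.im ≠ k := fun k =>
        ⟨fun hk => h ⟨hz, Or.inl ⟨k, hk⟩⟩, fun hk => h ⟨hz, Or.inr ⟨k, hk⟩⟩⟩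
      rw [hd.1] at hi
      rw [hd.2] at hj
      have h1 := h' (mid p)
      have h2 := h' (mid p + 1)
      push_cast at h2
      refine ⟨⟨?_, ?_⟩, ?_, ?_⟩
      · rw [div_lt_iff₀ hp]
        exact lt_of_le_of_ne (by linarith [hi.1]) (by rw [mul_comm]; exact h1.1.symm)
      · rw [lt_div_iff₀ hp]
        exact lt_of_le_of_ne (by linarith [hi.2]) (by rw [mul_comm]; exact h2.1)
      · rw [div_lt_iff₀ hp]
        exact lt_of_le_of_ne (by linarith [hj.1]) (by rw [mul_comm]; exact h1.2.symm)
      · rw [lt_div_iff₀ hp]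
        exact lt_of_le_of_ne (by linarith [hj.2]) (by rw [mul_comm]; exact h2.2)
    · left
      exact ⟨⟨(i, j), hd⟩, _, ⟨hi, hj⟩, sub_mk _ z⟩

lemma exists_mem_hole [OddBase p] {z : ℂ} (hz : z ∈ unitSq) (hzS : z ∉ sierpinskiCarpet p) :
    ∃ w : List (Digit p), z ∈ wordMap w '' openMid p := by
  have key : ∀ n, ∀ z ∈ unitSq, z ∉ carpetApprox p n →
      ∃ w : List (Digit p), z ∈ wordMap w '' openMid p := by
    intro n
    induction n with
    | zero => exact fun z hz h => absurd hz h
    | succ n ih =>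
      intro z hz h
      rcases exists_sub_eq_or_mem_openMid (p := p) hz with ⟨d, y, hy, rfl⟩ | hz
      · obtain ⟨w, x, hx, rfl⟩ := ih y hy fun hy' => h (mem_carpetApprox_succ.2 ⟨d, y, hy', rfl⟩)
        exact ⟨d :: w, x, hx, rfl⟩
      · exact ⟨[], z, hz, rfl⟩
  rw [mem_carpet] at hzS
  push Not at hzS
  obtain ⟨n, hn⟩ := hzS
  exact key n z hz hn

/-- A cell and a subset of the unit square are separated by an axis-parallel line. -/
def Separated (A B : Set ℂ) : Prop :=
  (∃ c : ℝ, (∀ z ∈ A, z.re ≤ c) ∧ ∀ z ∈ B, c ≤ z.re) ∨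
  (∃ c : ℝ, (∀ z ∈ A, c ≤ z.re) ∧ ∀ z ∈ B, z.re ≤ c) ∨
  (∃ c : ℝ, (∀ z ∈ A, z.im ≤ c) ∧ ∀ z ∈ B, c ≤ z.im) ∨
  (∃ c : ℝ, (∀ z ∈ A, c ≤ z.im) ∧ ∀ z ∈ B, z.im ≤ c)

lemma Separated.image_sub {A B : Set ℂ} (h : Separated A B) (d : Digit p) :
    Separated (sub d '' A) (sub d '' B) := by
  have hp : (0 : ℝ) ≤ p := by positivity
  rcases h with ⟨c, h1, h2⟩ | ⟨c, h1, h2⟩ | ⟨c, h1, h2⟩ | ⟨c, h1, h2⟩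
  · refine Or.inl ⟨(c + (d.1.1 : ℕ)) / p, ?_, ?_⟩
    · rintro _ ⟨z, hz, rfl⟩; have := h1 z hz; simp only [sub_re]; gcongr
    · rintro _ ⟨z, hz, rfl⟩; have := h2 z hz; simp only [sub_re]; gcongr
  · refine Or.inr (Or.inl ⟨(c + (d.1.1 : ℕ)) / p, ?_, ?_⟩)
    · rintro _ ⟨z, hz, rfl⟩; have := h1 z hz; simp only [sub_re]; gcongr
    · rintro _ ⟨z, hz, rfl⟩; have := h2 z hz; simp only [sub_re]; gcongr
  · refine Or.inr (Or.inr (Or.inl ⟨(c + (d.1.2 : ℕ)) / p, ?_, ?_⟩))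
    · rintro _ ⟨z, hz, rfl⟩; have := h1 z hz; simp only [sub_im]; gcongr
    · rintro _ ⟨z, hz, rfl⟩; have := h2 z hz; simp only [sub_im]; gcongr
  · refine Or.inr (Or.inr (Or.inr ⟨(c + (d.1.2 : ℕ)) / p, ?_, ?_⟩))
    · rintro _ ⟨z, hz, rfl⟩; have := h1 z hz; simp only [sub_im]; gcongr
    · rintro _ ⟨z, hz, rfl⟩; have := h2 z hz; simp only [sub_im]; gcongr

/-- Two closed grid squares of the first subdivision at different positions are separated. -/
lemma separated_of_ne [OddBase p] {i j i' j' : ℕ} (h : ¬(i = i' ∧ j = j')) {A B : Set ℂ}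
    (hA : ∀ z ∈ A, (p * z.re - i ∈ Icc (0 : ℝ) 1) ∧ p * z.im - j ∈ Icc (0 : ℝ) 1)
    (hB : ∀ z ∈ B, (p * z.re - i' ∈ Icc (0 : ℝ) 1) ∧ p * z.im - j' ∈ Icc (0 : ℝ) 1) :
    Separated A B := by
  have hp := base_pos (p := p)
  have cast : ∀ {a b : ℕ}, a < b → (a : ℝ) + 1 ≤ b := fun h => by exact_mod_cast h
  by_cases hi : i = i'
  · rcases lt_or_gt_of_ne (fun hj => h ⟨hi, hj⟩ : j ≠ j') with hj | hj
    · refine Or.inr (Or.inr (Or.inl ⟨j' / p, fun z hz => ?_, fun z hz => ?_⟩))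
      · rw [le_div_iff₀ hp]; linarith [(hA z hz).2.2, cast hj]
      · rw [div_le_iff₀ hp]; linarith [(hB z hz).2.1]
    · refine Or.inr (Or.inr (Or.inr ⟨j / p, fun z hz => ?_, fun z hz => ?_⟩))
      · rw [div_le_iff₀ hp]; linarith [(hA z hz).2.1]
      · rw [le_div_iff₀ hp]; linarith [(hB z hz).2.2, cast hj]
  · rcases lt_or_gt_of_ne hi with hj | hj
    · refine Or.inl ⟨i' / p, fun z hz => ?_, fun z hz => ?_⟩
      · rw [le_div_iff₀ hp]; linarith [(hA z hz).1.2, cast hj]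
      · rw [div_le_iff₀ hp]; linarith [(hB z hz).1.1]
    · refine Or.inr (Or.inl ⟨i / p, fun z hz => ?_, fun z hz => ?_⟩)
      · rw [div_le_iff₀ hp]; linarith [(hA z hz).1.1]
      · rw [le_div_iff₀ hp]; linarith [(hB z hz).1.2, cast hj]

lemma sub_coord_mem [OddBase p] (d : Digit p) {A : Set ℂ} (hA : A ⊆ unitSq) :
    ∀ z ∈ sub d '' A, (p * z.re - (d.1.1 : ℕ) ∈ Icc (0 : ℝ) 1) ∧
      p * z.im - (d.1.2 : ℕ) ∈ Icc (0 : ℝ) 1 := by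
  have hp := base_pos (p := p)
  rintro _ ⟨z, hz, rfl⟩
  rw [sub_re, sub_im, mul_div_cancel₀ _ hp.ne', mul_div_cancel₀ _ hp.ne']
  obtain ⟨h1, h2⟩ := hA hz
  simpa using ⟨h1, h2⟩

lemma middleSquare_coord_mem [OddBase p] :
    ∀ z ∈ middleSquare p, (p * z.re - mid p ∈ Icc (0 : ℝ) 1) ∧
      p * z.im - mid p ∈ Icc (0 : ℝ) 1 := by
  have hp := base_pos (p := p)
  intro z hz
  obtain ⟨⟨h1, h2⟩, ⟨h3, h4⟩, -⟩ := mem_middleSquare.1 hz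
  rw [div_le_iff₀ hp] at h1 h3
  rw [le_div_iff₀ hp] at h2 h4
  exact ⟨⟨by linarith, by linarith⟩, by linarith, by linarith⟩

lemma wordMap_cons_image (d : Digit p) (w : List (Digit p)) (A : Set ℂ) :
    wordMap (d :: w) '' A = sub d '' (wordMap w '' A) := by
  rw [image_image]; rfl

lemma wordMap_image_subset_unitSq [OddBase p] (w : List (Digit p)) {A : Set ℂ}
    (hA : A ⊆ unitSq) : wordMap w '' A ⊆ unitSq := by
  rintro _ ⟨z, hz, rfl⟩
  exact wordMap_mem_unitSq w (hA hz)

lemma middleSquare_subset_unitSq [OddBase p] : middleSquare p ⊆ unitSq :=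
  middleSquare_subset_openSq.trans openSq_subset_unitSq

/-- The cell of `w` is separated from every complementary square that it does not contain. -/
lemma separated_cell_hole [OddBase p] {w v : List (Digit p)} (h : ¬w <+: v) :
    Separated (wordMap w '' unitSq) (wordMap v '' middleSquare p) := by
  induction w generalizing v with
  | nil => exact absurd (by simp) h
  | cons d w ih =>
    cases v with
    | nil =>
      rw [wordMap_cons_image]
      have : wordMap ([] : List (Digit p)) '' middleSquare p = middleSquare p := by
        simp [wordMap]
      rw [this]
      exact separated_of_ne d.2 (sub_coord_mem d (wordMap_image_subset_unitSq w subset_rfl))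
        middleSquare_coord_mem
    | cons e v =>
      rw [wordMap_cons_image, wordMap_cons_image]
      by_cases hde : d = e
      · subst hde
        exact (ih fun h' => h (List.cons_prefix_cons.2 ⟨rfl, h'⟩)).image_sub d
      · refine separated_of_ne (fun h' => hde ?_)
          (sub_coord_mem d (wordMap_image_subset_unitSq w subset_rfl))
          (sub_coord_mem e (wordMap_image_subset_unitSq v middleSquare_subset_unitSq))
        exact Subtype.ext (Prod.ext (Fin.ext h'.1) (Fin.ext h'.2))

/-- Cells of different words of the same length are separated. -/
lemma separated_cells [OddBase p] {w v : List (Digit p)} (hl : w.length = v.length)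
    (h : w ≠ v) : Separated (wordMap w '' unitSq) (wordMap v '' unitSq) := by
  induction w generalizing v with
  | nil => exact absurd (List.length_eq_zero_iff.1 hl.symm).symm h
  | cons d w ih =>
    cases v with
    | nil => simp at hl
    | cons e v =>
      rw [wordMap_cons_image, wordMap_cons_image]
      by_cases hde : d = e
      · subst hde
        exact (ih (by simpa using hl) fun h' => h (by rw [h'])).image_sub d
      · refine separated_of_ne (fun h' => hde ?_)
          (sub_coord_mem d (wordMap_image_subset_unitSq w subset_rfl))
          (sub_coord_mem e (wordMap_image_subset_unitSq v subset_rfl))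
        exact Subtype.ext (Prod.ext (Fin.ext h'.1) (Fin.ext h'.2))

/-- A set separated from a cell misses the interior of the cell. -/
lemma Separated.notMem_openSq [OddBase p] {w : List (Digit p)} {B : Set ℂ}
    (h : Separated (wordMap w '' unitSq) B) {y : ℂ} (hy : y ∈ openSq) : wordMap w y ∉ B := by
  intro hB
  have hq : (0 : ℝ) < (p : ℝ) ^ w.length := pow_pos base_pos _
  have h0 : corner w ∈ wordMap w '' unitSq := ⟨0, by simp [unitSq], rfl⟩
  have h1 : wordMap w ⟨1, 1⟩ ∈ wordMap w '' unitSq := ⟨_, by simp [unitSq], rfl⟩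
  obtain ⟨⟨y1, y2⟩, y3, y4⟩ := hy
  have k1 : 0 < y.re / (p : ℝ) ^ w.length := by positivity
  have k2 : 0 < y.im / (p : ℝ) ^ w.length := by positivity
  have k3 : y.re / (p : ℝ) ^ w.length < 1 / (p : ℝ) ^ w.length := by gcongr
  have k4 : y.im / (p : ℝ) ^ w.length < 1 / (p : ℝ) ^ w.length := by gcongr
  rcases h with ⟨c, h2, h3⟩ | ⟨c, h2, h3⟩ | ⟨c, h2, h3⟩ | ⟨c, h2, h3⟩
  · have a := h2 _ h1; have b := h3 _ hB
    rw [wordMap_re] at a b; linarith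
  · have a := h2 _ h0; have b := h3 _ hB
    rw [wordMap_re] at b; linarith
  · have a := h2 _ h1; have b := h3 _ hB
    rw [wordMap_im] at a b; linarith
  · have a := h2 _ h0; have b := h3 _ hB
    rw [wordMap_im] at b; linarith

/-! ### Continuous logarithms on planar sets -/

/-- The function `g` has a continuous logarithm on `K`. -/
def HasLog (g : ℂ → ℂ) (K : Set ℂ) : Prop :=
  ∃ h : ℂ → ℂ, ContinuousOn h K ∧ ∀ z ∈ K, Complex.exp (h z) = g z

lemma HasLog.mono {g : ℂ → ℂ} {K K' : Set ℂ} (h : HasLog g K) (hK : K' ⊆ K) : HasLog g K' := by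
  obtain ⟨h, h1, h2⟩ := h
  exact ⟨h, h1.mono hK, fun z hz => h2 z (hK hz)⟩

lemma eq_of_exp_eq_one {a b : ℂ} (ha : Complex.exp a = 1) (hb : Complex.exp b = 1)
    (hab : ‖a - b‖ < 1) : a = b := by
  have h : Complex.exp (a - b) = 1 := by rw [Complex.exp_sub, ha, hb, div_one]
  obtain ⟨n, hn⟩ := Complex.exp_eq_one_iff.1 h
  have hn0 : n = 0 := by
    by_contra hn0
    rw [hn, norm_mul, Complex.norm_intCast] at hab
    have h1 : (1 : ℝ) ≤ |(n : ℝ)| := by exact_mod_cast Int.one_le_abs hn0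
    have h2 : ‖(2 * Real.pi * Complex.I : ℂ)‖ = 2 * Real.pi := by
      simp [abs_of_pos Real.pi_pos]
    rw [h2] at hab
    nlinarith [Real.pi_gt_three]
  rw [hn0] at hn
  simpa [sub_eq_zero] using hn

/-- A function that is uniformly close to one of its values has a logarithm. -/
lemma hasLog_of_close {g : ℂ → ℂ} {K : Set ℂ} (hg : ContinuousOn g K) {b : ℂ} (hb : b ≠ 0)
    (h : ∀ z ∈ K, ‖g z - b‖ < ‖b‖) : HasLog g K := by
  have key : ∀ z ∈ K, g z / b ∈ Complex.slitPlane := by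
    intro z hz
    have h1 : ‖(g z - b) / b‖ < 1 := by
      rw [norm_div, div_lt_one (norm_pos_iff.2 hb)]; exact h z hz
    have h2 := Complex.mem_slitPlane_of_norm_lt_one h1
    rwa [sub_div, div_self hb, add_sub_cancel] at h2
  refine ⟨fun z => Complex.log (g z / b) + Complex.log b,
    ((hg.div_const b).clog key).add continuousOn_const, fun z hz => ?_⟩
  rw [Complex.exp_add, Complex.exp_log (Complex.slitPlane_ne_zero (key z hz)), Complex.exp_log hb,
    div_mul_cancel₀ _ hb]

/-- The logarithm of `z - a` on the half-plane `0 ≤ re (u (z - a))`. -/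
def halfLog (u a z : ℂ) : ℂ := Complex.log (u * (z - a)) - Complex.log u

lemma halfLog_spec {u a : ℂ} (hu : u ≠ 0) {K : Set ℂ} (ha : a ∉ K)
    (hK : ∀ z ∈ K, 0 ≤ (u * (z - a)).re) :
    ContinuousOn (halfLog u a) K ∧ ∀ z ∈ K, Complex.exp (halfLog u a z) = z - a := by
  have hne : ∀ z ∈ K, u * (z - a) ≠ 0 := fun z hz =>
    mul_ne_zero hu (sub_ne_zero.2 fun h => ha (h ▸ hz))
  have key : ∀ z ∈ K, u * (z - a) ∈ Complex.slitPlane := by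
    intro z hz
    rcases (hK z hz).lt_or_eq with h | h
    · exact Or.inl h
    · exact Or.inr fun him => hne z hz (Complex.ext h.symm him)
  refine ⟨ContinuousOn.sub (ContinuousOn.clog (by fun_prop) key) continuousOn_const,
    fun z hz => ?_⟩
  rw [halfLog, Complex.exp_sub, Complex.exp_log (hne z hz), Complex.exp_log hu,
    mul_div_cancel_left₀ _ hu]

lemma hasLog_halfPlane {u a : ℂ} (hu : u ≠ 0) {K : Set ℂ} (ha : a ∉ K)
    (hK : ∀ z ∈ K, 0 ≤ (u * (z - a)).re) : HasLog (fun z => z - a) K :=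
  ⟨_, halfLog_spec hu ha hK⟩

/-- The set `K` does not wind around any point of its complement. -/
def NoWinding (K : Set ℂ) : Prop := ∀ a ∉ K, HasLog (fun z => z - a) K

lemma NoWinding.inter_halfPlane {K : Set ℂ} (hK : NoWinding K) {u : ℂ} (hu : u ≠ 0) (c : ℝ) :
    NoWinding (K ∩ {z | (u * z).re ≤ c}) := by
  intro a ha
  by_cases haK : a ∈ K
  · have hac : c < (u * a).re := not_le.1 fun h => ha ⟨haK, h⟩
    refine hasLog_halfPlane (neg_ne_zero.2 hu) ha fun z hz => ?_
    have h1 : (u * z).re ≤ c := hz.2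
    rw [neg_mul, mul_sub, Complex.neg_re, Complex.sub_re]
    linarith
  · exact (hK a haK).mono inter_subset_left

/-- On the line separating two half-planes, the half-plane logarithms differ by a step. -/
lemma halfLog_sub {u a z : ℂ} (h : (u * (z - a)).re = 0) :
    ((u * (z - a)).im < 0 → halfLog (-u) a z - halfLog u a z
      = Real.pi * Complex.I + (Complex.log u - Complex.log (-u))) ∧
    (0 < (u * (z - a)).im → halfLog (-u) a z - halfLog u a z
      = -(Real.pi * Complex.I) + (Complex.log u - Complex.log (-u))) := by
  have hv : u * (z - a) = ((u * (z - a)).im : ℂ) * Complex.I := by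
    apply Complex.ext <;> simp only [Complex.mul_re, Complex.mul_im, Complex.ofReal_re,
      Complex.ofReal_im, Complex.I_re, Complex.I_im] at * <;> linarith
  set y := (u * (z - a)).im with hy
  unfold halfLog
  rw [neg_mul, hv]
  constructor
  · intro hy0
    rw [show (y : ℂ) * Complex.I = ((-y : ℝ) : ℂ) * -Complex.I by push_cast; ring, ← mul_neg,
      neg_neg, Complex.log_ofReal_mul (by linarith) Complex.I_ne_zero,
      Complex.log_ofReal_mul (by linarith) (neg_ne_zero.2 Complex.I_ne_zero), Complex.log_I,
      Complex.log_neg_I]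
    ring
  · intro hy0
    rw [← mul_neg, Complex.log_ofReal_mul hy0 Complex.I_ne_zero,
      Complex.log_ofReal_mul hy0 (neg_ne_zero.2 Complex.I_ne_zero), Complex.log_I,
      Complex.log_neg_I]
    ring

/-- Differences of period-valued functions on the two parts of `K` cut by a line. -/
def PeriodSplit (K : Set ℂ) (u : ℂ) (c : ℝ) (m : ℂ → ℂ) : Prop :=
  ∃ x y : ℂ → ℂ, ContinuousOn x (K ∩ {z | (u * z).re ≤ c}) ∧
    ContinuousOn y (K ∩ {z | (-u * z).re ≤ -c}) ∧
    (∀ z ∈ K, (u * z).re ≤ c → Complex.exp (x z) = 1) ∧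
    (∀ z ∈ K, (-u * z).re ≤ -c → Complex.exp (y z) = 1) ∧
    ∀ z ∈ K, (u * z).re = c → m z = x z - y z

lemma PeriodSplit.add_int_mul {K : Set ℂ} {u : ℂ} {c : ℝ} {m m' : ℂ → ℂ}
    (h : PeriodSplit K u c m) (h' : PeriodSplit K u c m') (n : ℤ) :
    PeriodSplit K u c fun z => m z + n * m' z := by
  obtain ⟨x, y, hx, hy, hx1, hy1, h⟩ := h
  obtain ⟨x', y', hx', hy', hx1', hy1', h'⟩ := h'
  refine ⟨fun z => x z + n * x' z, fun z => y z + n * y' z, by fun_prop, by fun_prop, ?_, ?_, ?_⟩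
  · intro z hz hzc
    rw [Complex.exp_add, Complex.exp_int_mul, hx1 z hz hzc, hx1' z hz hzc]; simp
  · intro z hz hzc
    rw [Complex.exp_add, Complex.exp_int_mul, hy1 z hz hzc, hy1' z hz hzc]; simp
  · intro z hz hzc
    simp only [h z hz hzc, h' z hz hzc]; ring

lemma NoWinding.periodSplit_step {K : Set ℂ} (hK : NoWinding K) {u a : ℂ} (hu : u ≠ 0)
    (ha : a ∉ K) : ∃ m : ℂ → ℂ, PeriodSplit K u (u * a).re m ∧
      ∀ z ∈ K, (u * z).re = (u * a).re →
        ((u * z).im < (u * a).im → m z = 0) ∧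
        ((u * a).im < (u * z).im → m z = 2 * Real.pi * Complex.I) := by
  obtain ⟨l, hl, hl'⟩ := hK a ha
  have e : ∀ z, (u * (z - a)).re = (u * z).re - (u * a).re := fun z => by
    rw [mul_sub, Complex.sub_re]
  have e' : ∀ z, (u * (z - a)).im = (u * z).im - (u * a).im := fun z => by
    rw [mul_sub, Complex.sub_im]
  have hX := halfLog_spec (neg_ne_zero.2 hu) (K := K ∩ {z | (u * z).re ≤ (u * a).re})
    (fun h => ha h.1) fun z hz => by
      have : (u * z).re ≤ (u * a).re := hz.2
      rw [neg_mul, Complex.neg_re, e]; linarith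
  have hY := halfLog_spec hu (K := K ∩ {z | (-u * z).re ≤ -(u * a).re})
    (fun h => ha h.1) fun z hz => by
      have : (-u * z).re ≤ -(u * a).re := hz.2
      rw [neg_mul, Complex.neg_re] at this
      rw [e]; linarith
  set k : ℂ := Real.pi * Complex.I + (Complex.log u - Complex.log (-u)) with hk
  have hk1 : Complex.exp k = 1 := by
    rw [hk, Complex.exp_add, Complex.exp_sub, Complex.exp_log hu,
      Complex.exp_log (neg_ne_zero.2 hu), Complex.exp_pi_mul_I]
    field_simp
  have hne : ∀ z ∈ K, z - a ≠ 0 := fun z hz => sub_ne_zero.2 fun h => ha (h ▸ hz)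
  refine ⟨fun z => (l z - halfLog (-u) a z + k) - (l z - halfLog u a z),
    ⟨fun z => l z - halfLog (-u) a z + k, fun z => l z - halfLog u a z,
      ((hl.mono inter_subset_left).sub hX.1).add continuousOn_const,
      (hl.mono inter_subset_left).sub hY.1, ?_, ?_, fun z _ _ => rfl⟩, ?_⟩
  · intro z hz hzc
    rw [Complex.exp_add, Complex.exp_sub, hl' z hz, hX.2 z ⟨hz, hzc⟩, hk1, div_self (hne z hz),
      one_mul]
  · intro z hz hzc
    rw [Complex.exp_sub, hl' z hz, hY.2 z ⟨hz, hzc⟩, div_self (hne z hz)]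
  · intro z hz hzc
    obtain ⟨h1, h2⟩ := halfLog_sub (u := u) (a := a) (z := z) (by rw [e, hzc, sub_self])
    constructor
    · intro hlt
      have := h1 (by rw [e']; linarith)
      linear_combination -this
    · intro hlt
      have := h2 (by rw [e']; linarith)
      linear_combination -this

/-- Logarithms on the two parts of a set cut by a line can be glued. -/
lemma NoWinding.hasLog_glue {K : Set ℂ} (hK : NoWinding K) (hKc : IsCompact K) {u : ℂ}
    (hu : u ≠ 0) (c : ℝ) {g : ℂ → ℂ} (hX : HasLog g (K ∩ {z | (u * z).re ≤ c}))
    (hY : HasLog g (K ∩ {z | (-u * z).re ≤ -c})) : HasLog g K := by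
  obtain ⟨x, hx, hx'⟩ := hX
  obtain ⟨y, hy, hy'⟩ := hY
  have hcl1 : IsClosed {z : ℂ | (u * z).re ≤ c} := isClosed_le (by fun_prop) continuous_const
  have hcl2 : IsClosed {z : ℂ | (-u * z).re ≤ -c} := isClosed_le (by fun_prop) continuous_const
  set Z : Set ℂ := K ∩ {z | (u * z).re = c} with hZ
  have hZX : Z ⊆ K ∩ {z | (u * z).re ≤ c} := fun z hz => ⟨hz.1, le_of_eq hz.2⟩
  have hZY : Z ⊆ K ∩ {z | (-u * z).re ≤ -c} := fun z hz => ⟨hz.1, by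
    have : (u * z).re = c := hz.2
    show (-u * z).re ≤ -c
    rw [neg_mul, Complex.neg_re, this]⟩
  have hZc : IsCompact Z := hKc.inter_right (isClosed_eq (by fun_prop) continuous_const)
  set n : ℂ → ℂ := fun z => x z - y z with hn
  have hn1 : ∀ z ∈ Z, Complex.exp (n z) = 1 := by
    intro z hz
    have h1 := hx' z (hZX hz)
    rw [hn, Complex.exp_sub, h1, hy' z (hZY hz), div_self]
    rw [← h1]; exact Complex.exp_ne_zero _
  have hnc : ContinuousOn n Z := (hx.mono hZX).sub (hy.mono hZY)
  obtain ⟨δ, hδ, hnδ⟩ := Metric.uniformContinuousOn_iff.1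
    (hZc.uniformContinuousOn_of_continuous hnc) 1 one_pos
  -- on the cutting line, distances are read off from `im (u z)`
  have hdist : ∀ z ∈ Z, ∀ z' ∈ Z, ‖u‖ * dist z z' = |(u * z).im - (u * z').im| := by
    intro z hz z' hz'
    have h1 : (u * z).re = c := hz.2
    have h2 : (u * z').re = c := hz'.2
    rw [dist_eq_norm, ← norm_mul, mul_sub, ← Complex.sub_im]
    exact (Complex.abs_im_eq_norm.2 (by rw [Complex.sub_re, h1, h2, sub_self])).symm
  have hu' : 0 < ‖u‖ := norm_pos_iff.2 hu
  have hnconst : ∀ z ∈ Z, ∀ z' ∈ Z, |(u * z).im - (u * z').im| < ‖u‖ * δ → n z = n z' := by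
    intro z hz z' hz' h
    rw [← hdist z hz z' hz'] at h
    have := hnδ z hz z' hz' (lt_of_mul_lt_mul_left h hu'.le)
    rw [dist_eq_norm] at this
    exact eq_of_exp_eq_one (hn1 z hz) (hn1 z' hz') this
  obtain ⟨R, hR⟩ : ∃ R, ∀ z ∈ Z, |(u * z).im| ≤ R := by
    obtain ⟨R, hR⟩ := hZc.exists_bound_of_continuousOn (f := fun z => u * z) (by fun_prop)
    exact ⟨R, fun z hz => (Complex.abs_im_le_norm _).trans (hR z hz)⟩
  set s : ℝ := ‖u‖ * δ / 2 with hs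
  have hs0 : 0 < s := by positivity
  -- sweep along the cutting line in steps of length `s`
  have sweep : ∀ k : ℕ, ∃ m, PeriodSplit K u c m ∧
      (∀ z ∈ Z, (u * z).im ≤ -R - 1 + k * s → m z = n z) ∧
      ∃ v, ∀ z ∈ Z, -R - 1 + k * s ≤ (u * z).im → m z = v := by
    intro k
    induction k with
    | zero =>
      refine ⟨fun _ => 0, ⟨fun _ => 0, fun _ => 0, continuousOn_const, continuousOn_const,
        by simp, by simp, by simp⟩, fun z hz h => ?_, 0, fun _ _ _ => rfl⟩
      have := neg_le_of_abs_le (hR z hz)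
      simp only [Nat.cast_zero, zero_mul] at h
      linarith
    | succ k ih =>
      obtain ⟨m, hm, hmn, v, hv⟩ := ih
      set b : ℝ := -R - 1 + k * s with hb
      have hb' : -R - 1 + ((k + 1 : ℕ) : ℝ) * s = b + s := by push_cast; rw [hb]; ring
      rw [hb']
      by_cases hex : ∃ z₀ ∈ Z, b ≤ (u * z₀).im ∧ (u * z₀).im ≤ b + s
      · obtain ⟨z₀, hz₀, hz₀1, hz₀2⟩ := hex
        have hsame : ∀ z ∈ Z, b ≤ (u * z).im → (u * z).im ≤ b + s → n z = n z₀ := by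
          intro z hz h1 h2
          refine hnconst z hz z₀ hz₀ (lt_of_le_of_lt (b := s) ?_ (by rw [hs]; linarith))
          rw [abs_le]; constructor <;> linarith
        set a : ℂ := ((c : ℂ) + b * Complex.I) / u with ha
        have hua : u * a = (c : ℂ) + b * Complex.I := by rw [ha]; field_simp
        have huar : (u * a).re = c := by rw [hua]; simp
        have huai : (u * a).im = b := by rw [hua]; simp
        by_cases haK : a ∈ K
        · have haZ : a ∈ Z := ⟨haK, huar⟩
          have hv' : v = n z₀ := by
            rw [← hv a haZ huai.ge, hmn a haZ huai.le]
            exact hsame a haZ huai.ge (by rw [huai]; linarith)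
          refine ⟨m, hm, fun z hz h => ?_, v, fun z hz h => hv z hz (by linarith)⟩
          rcases le_total (u * z).im b with h1 | h1
          · exact hmn z hz h1
          · rw [hv z hz h1, hv', hsame z hz h1 h]
        · obtain ⟨t, ht, ht'⟩ := hK.periodSplit_step hu haK
          rw [huar] at ht
          have hv1 : Complex.exp v = 1 := by
            obtain ⟨x', y', -, -, h1, h2, h3⟩ := hm
            rw [← hv z₀ hz₀ hz₀1, h3 z₀ hz₀.1 hz₀.2, Complex.exp_sub,
              h1 z₀ hz₀.1 (hZX hz₀).2, h2 z₀ hz₀.1 (hZY hz₀).2, div_one]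
          have h1 : Complex.exp (n z₀ - v) = 1 := by
            rw [Complex.exp_sub, hn1 z₀ hz₀, hv1, div_one]
          obtain ⟨N, hN⟩ := Complex.exp_eq_one_iff.1 h1
          have hlow : ∀ z ∈ Z, (u * z).im < b → t z = 0 := fun z hz h =>
            (ht' z hz.1 (by rw [huar]; exact hz.2)).1 (by rw [huai]; exact h)
          have hhigh : ∀ z ∈ Z, b < (u * z).im → t z = 2 * Real.pi * Complex.I := fun z hz h =>
            (ht' z hz.1 (by rw [huar]; exact hz.2)).2 (by rw [huai]; exact h)
          have hneb : ∀ z ∈ Z, (u * z).im ≠ b := by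
            intro z hz h
            refine haK ?_
            have : u * z = u * a := by
              apply Complex.ext
              · rw [huar]; exact hz.2
              · rw [h, huai]
            rw [← mul_left_cancel₀ hu this]; exact hz.1
          refine ⟨_, hm.add_int_mul ht N, fun z hz h => ?_, n z₀, fun z hz h => ?_⟩
          · rcases lt_or_gt_of_ne (hneb z hz) with h1 | h1
            · rw [hlow z hz h1, hmn z hz h1.le]; simp
            · rw [hhigh z hz h1, hv z hz h1.le, ← hN, hsame z hz h1.le h]; ring
          · rw [hhigh z hz (by linarith), hv z hz (by linarith), ← hN]; ring
      · push Not at hex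
        refine ⟨m, hm, fun z hz h => ?_, v, fun z hz h => hv z hz (by linarith)⟩
        rcases le_total b (u * z).im with h1 | h1
        · exact absurd h (not_le.2 (hex z hz h1))
        · exact hmn z hz h1
  obtain ⟨k, hk⟩ := exists_nat_ge ((2 * R + 1) / s)
  rw [div_le_iff₀ hs0] at hk
  obtain ⟨m, ⟨x', y', hx1, hy1, hx2, hy2, hm⟩, hmn, -⟩ := sweep k
  have hmn' : ∀ z ∈ Z, x z - x' z = y z - y' z := by
    intro z hz
    have h1 := hmn z hz (by linarith [(abs_le.1 (hR z hz)).2])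
    rw [hm z hz.1 hz.2, hn] at h1
    linear_combination -h1
  have hK' : K = (K ∩ {z | (u * z).re ≤ c}) ∪ (K ∩ {z | (-u * z).re ≤ -c}) := by
    ext z
    have : (-u * z).re = -(u * z).re := by rw [neg_mul, Complex.neg_re]
    simp only [mem_union, mem_inter_iff, mem_ofPred_eq, this, neg_le_neg_iff]
    rcases le_total (u * z).re c with h | h <;> tauto
  classical
  set h : ℂ → ℂ := fun z => if (u * z).re ≤ c then x z - x' z else y z - y' z with hh
  have hhX : ∀ z ∈ K ∩ {z | (u * z).re ≤ c}, h z = x z - x' z := fun z hz => if_pos hz.2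
  have hhY : ∀ z ∈ K ∩ {z | (-u * z).re ≤ -c}, h z = y z - y' z := by
    intro z hz
    have h1 : (-u * z).re ≤ -c := hz.2
    rw [neg_mul, Complex.neg_re, neg_le_neg_iff] at h1
    by_cases h2 : (u * z).re ≤ c
    · rw [hhX z ⟨hz.1, h2⟩, hmn' z ⟨hz.1, le_antisymm h2 h1⟩]
    · exact if_neg h2
  refine ⟨h, ?_, fun z hz => ?_⟩
  · rw [hK']
    exact ContinuousOn.union_of_isClosed ((hx.sub hx1).congr hhX) ((hy.sub hy1).congr hhY)
      (hKc.isClosed.inter hcl1) (hKc.isClosed.inter hcl2)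
  · rw [hK'] at hz
    rcases hz with hz | hz
    · rw [hhX z hz, Complex.exp_sub, hx' z hz, hx2 z hz.1 hz.2, div_one]
    · rw [hhY z hz, Complex.exp_sub, hy' z hz, hy2 z hz.1 hz.2, div_one]

lemma NoWinding.hasLog_of_strips {K : Set ℂ} (hK : NoWinding K) (hKc : IsCompact K) {u : ℂ}
    (hu : u ≠ 0) {δ : ℝ} (hδ : 0 < δ) {g : ℂ → ℂ}
    (hbase : ∀ K' ⊆ K, IsCompact K' → NoWinding K' →
      (∃ s, ∀ z ∈ K', s ≤ (u * z).re ∧ (u * z).re ≤ s + δ) → HasLog g K') : HasLog g K := by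
  obtain ⟨R, hR⟩ : ∃ R, ∀ z ∈ K, |(u * z).re| ≤ R := by
    obtain ⟨R, hR⟩ := hKc.exists_bound_of_continuousOn (f := fun z => u * z) (by fun_prop)
    exact ⟨R, fun z hz => (Complex.abs_re_le_norm _).trans (hR z hz)⟩
  have key : ∀ k : ℕ, ∀ K' ⊆ K, IsCompact K' → NoWinding K' →
      (∀ z ∈ K', (u * z).re ≤ -R + k * δ) → HasLog g K' := by
    intro k
    induction k with
    | zero =>
      intro K' hK' hc hw h
      refine hbase K' hK' hc hw ⟨-R, fun z hz => ⟨(abs_le.1 (hR z (hK' hz))).1, ?_⟩⟩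
      have := h z hz
      simp only [Nat.cast_zero, zero_mul] at this
      linarith
    | succ k ih =>
      intro K' hK' hc hw h
      refine hw.hasLog_glue hc hu (-R + k * δ) ?_ ?_
      · exact ih _ (inter_subset_left.trans hK')
          (hc.inter_right (isClosed_le (by fun_prop) continuous_const))
          (hw.inter_halfPlane hu _) fun z hz => hz.2
      · refine hbase _ (inter_subset_left.trans hK')
          (hc.inter_right (isClosed_le (by fun_prop) continuous_const))
          (hw.inter_halfPlane (neg_ne_zero.2 hu) _) ⟨-R + k * δ, fun z hz => ⟨?_, ?_⟩⟩
        · have : (-u * z).re ≤ -(-R + k * δ) := hz.2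
          rw [neg_mul, Complex.neg_re] at this
          linarith
        · have := h z hz.1
          push_cast at this
          linarith
  obtain ⟨k, hk⟩ := exists_nat_ge (2 * R / δ)
  rw [div_le_iff₀ hδ] at hk
  exact key k K subset_rfl hKc hK fun z hz => by linarith [(abs_le.1 (hR z hz)).2]

/-- A compact planar set that does not wind around any point of its complement carries a
logarithm of each nowhere vanishing continuous function. -/
lemma NoWinding.hasLog {K : Set ℂ} (hK : NoWinding K) (hKc : IsCompact K) {g : ℂ → ℂ}
    (hg : ContinuousOn g K) (hg0 : ∀ z ∈ K, g z ≠ 0) : HasLog g K := by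
  rcases K.eq_empty_or_nonempty with rfl | hne
  · exact ⟨0, continuousOn_empty _, by simp⟩
  obtain ⟨z₁, hz₁, hmin⟩ := hKc.exists_isMinOn hne hg.norm
  have hpos : 0 < ‖g z₁‖ := norm_pos_iff.2 (hg0 z₁ hz₁)
  obtain ⟨δ, hδ, hgδ⟩ := Metric.uniformContinuousOn_iff.1
    (hKc.uniformContinuousOn_of_continuous hg) _ hpos
  refine hK.hasLog_of_strips hKc one_ne_zero (δ := δ / 3) (by positivity) ?_
  rintro K' hK' hc' hw' ⟨s, hs⟩
  refine hw'.hasLog_of_strips hc' Complex.I_ne_zero (δ := δ / 3) (by positivity) ?_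
  rintro K'' hK'' hc'' - ⟨t, ht⟩
  rcases K''.eq_empty_or_nonempty with rfl | ⟨z₀, hz₀⟩
  · exact ⟨0, continuousOn_empty _, by simp⟩
  have hz₀K := hK' (hK'' hz₀)
  refine hasLog_of_close (hg.mono (hK''.trans hK')) (hg0 z₀ hz₀K) fun z hz => ?_
  have hd : dist z z₀ < δ := by
    have h1 := hs z (hK'' hz)
    have h2 := hs z₀ (hK'' hz₀)
    have h3 := ht z hz
    have h4 := ht z₀ hz₀
    rw [one_mul] at h1 h2
    simp only [Complex.I_mul_re] at h3 h4
    rw [dist_eq_norm]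
    refine (Complex.norm_le_abs_re_add_abs_im _).trans_lt ?_
    rw [Complex.sub_re, Complex.sub_im]
    have h5 : |z.re - z₀.re| ≤ δ / 3 := by rw [abs_le]; constructor <;> linarith
    have h6 : |z.im - z₀.im| ≤ δ / 3 := by rw [abs_le]; constructor <;> linarith
    linarith
  have h1 := hgδ z (hK' (hK'' hz)) z₀ hz₀K hd
  rw [dist_eq_norm] at h1
  exact h1.trans_le (hmin hz₀K)

lemma hasLog_sub_of_close {J : Set ℂ} {a b : ℂ} (hab : ∀ z ∈ J, ‖a - b‖ < ‖z - a‖)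
    (h : HasLog (fun z => z - a) J) : HasLog (fun z => z - b) J := by
  obtain ⟨h, hc, he⟩ := h
  have hne : ∀ z ∈ J, z - a ≠ 0 := fun z hz => norm_pos_iff.1 ((norm_nonneg _).trans_lt (hab z hz))
  obtain ⟨k, hkc, hke⟩ : HasLog (fun z => (z - b) / (z - a)) J := by
    refine hasLog_of_close (b := 1) (ContinuousOn.div (by fun_prop) (by fun_prop) hne)
      one_ne_zero fun z hz => ?_
    rw [div_sub_one (hne z hz), norm_div, norm_one, div_lt_one (norm_pos_iff.2 (hne z hz))]
    rw [show z - b - (z - a) = a - b by ring]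
    exact hab z hz
  refine ⟨fun z => k z + h z, hkc.add hc, fun z hz => ?_⟩
  rw [Complex.exp_add, hke z hz, he z hz, div_mul_cancel₀ _ (hne z hz)]

/-- Winding around a point is invariant along connected sets in the complement. -/
lemma hasLog_sub_of_isPreconnected {J C : Set ℂ} (hJ : IsCompact J) (hC : IsPreconnected C)
    (hCJ : Disjoint C J) {a b : ℂ} (ha : a ∈ C) (hb : b ∈ C)
    (h : HasLog (fun z => z - a) J) : HasLog (fun z => z - b) J := by
  have hdist : ∀ a ∉ J, ∃ r > 0, ∀ z ∈ J, 2 * r ≤ ‖z - a‖ := by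
    intro a ha
    obtain ⟨r, hr, hr'⟩ := Metric.isOpen_iff.1 hJ.isClosed.isOpen_compl a ha
    refine ⟨r / 2, by positivity, fun z hz => ?_⟩
    by_contra hlt
    refine hr' (mem_ball.2 ?_) hz
    rw [dist_eq_norm]; linarith
  have hopen : ∀ a ∉ J, ∃ r > 0, ∀ b ∈ ball a r,
      b ∉ J ∧ (HasLog (fun z => z - a) J ↔ HasLog (fun z => z - b) J) := by
    intro a ha
    obtain ⟨r, hr, hr'⟩ := hdist a ha
    refine ⟨r, hr, fun b hb => ?_⟩
    rw [mem_ball, dist_eq_norm] at hb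
    have key : ∀ z ∈ J, r < ‖z - b‖ := by
      intro z hz
      have h1 := hr' z hz
      have h2 := norm_sub_le_norm_sub_add_norm_sub z b a
      linarith
    refine ⟨fun hbJ => ?_, hasLog_sub_of_close fun z hz => ?_,
      hasLog_sub_of_close fun z hz => hb.trans (key z hz)⟩
    · have := key b hbJ
      simp at this; linarith
    · rw [norm_sub_rev]; linarith [hr' z hz]
  have hL : IsOpen {a : ℂ | a ∉ J ∧ HasLog (fun z => z - a) J} := by
    rw [Metric.isOpen_iff]
    rintro a ⟨haJ, ha⟩
    obtain ⟨r, hr, hr'⟩ := hopen a haJ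
    exact ⟨r, hr, fun b hb => ⟨(hr' b hb).1, (hr' b hb).2.1 ha⟩⟩
  have hN : IsOpen {a : ℂ | a ∉ J ∧ ¬HasLog (fun z => z - a) J} := by
    rw [Metric.isOpen_iff]
    rintro a ⟨haJ, ha⟩
    obtain ⟨r, hr, hr'⟩ := hopen a haJ
    exact ⟨r, hr, fun b hb => ⟨(hr' b hb).1, fun hb' => ha ((hr' b hb).2.2 hb')⟩⟩
  have hCJ' : ∀ x ∈ C, x ∉ J := fun x hx => disjoint_left.1 hCJ hx
  refine (hC.subset_left_of_subset_union hL hN ?_ ?_ ⟨a, ha, hCJ' a ha, h⟩ hb).2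
  · exact disjoint_left.2 fun x hx hx' => hx'.2 hx.2
  · intro x hx
    by_cases hx' : HasLog (fun z => z - x) J
    · exact Or.inl ⟨hCJ' x hx, hx'⟩
    · exact Or.inr ⟨hCJ' x hx, hx'⟩

/-- A square winds around its centre. -/
lemma not_hasLog_squareBoundary (c : ℂ) {l : ℝ} (hl : 0 < l) :
    ¬HasLog (fun z => z - (c + (l / 2 : ℝ) * (1 + Complex.I))) (squareBoundary c l) := by
  rintro ⟨h, hc, he⟩
  set b : ℂ := c + (l / 2 : ℝ) * (1 + Complex.I) with hb
  have hbre : b.re = c.re + l / 2 := by rw [hb, Complex.add_re, Complex.re_ofReal_mul]; simp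
  have hbim : b.im = c.im + l / 2 := by rw [hb, Complex.add_im, Complex.im_ofReal_mul]; simp
  set μ : ℝ → ℝ := fun θ => max |Real.cos θ| |Real.sin θ| with hμ
  have hμpos : ∀ θ, 0 < μ θ := by
    intro θ
    rcases eq_or_ne (Real.cos θ) 0 with h0 | h0
    · refine lt_max_of_lt_right (abs_pos.2 fun h1 => ?_)
      have := Real.sin_sq_add_cos_sq θ
      rw [h0, h1] at this; norm_num at this
    · exact lt_max_of_lt_left (abs_pos.2 h0)
  have hμc : Continuous μ := by fun_prop
  set ρ : ℝ → ℝ := fun θ => l / 2 / μ θ with hρ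
  have hρpos : ∀ θ, 0 < ρ θ := fun θ => div_pos (by positivity) (hμpos θ)
  have hρc : Continuous ρ := continuous_const.div hμc fun θ => (hμpos θ).ne'
  set γ : ℝ → ℂ := fun θ => b + ρ θ * Complex.exp (θ * Complex.I) with hγ
  have hγc : Continuous γ := by fun_prop
  have hγre : ∀ θ, (γ θ).re = b.re + ρ θ * Real.cos θ := fun θ => by
    rw [hγ]; simp only [Complex.add_re, Complex.re_ofReal_mul, Complex.exp_ofReal_mul_I_re]
  have hγim : ∀ θ, (γ θ).im = b.im + ρ θ * Real.sin θ := fun θ => by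
    rw [hγ]; simp only [Complex.add_im, Complex.im_ofReal_mul, Complex.exp_ofReal_mul_I_im]
  have hγmem : ∀ θ, γ θ ∈ squareBoundary c l := by
    intro θ
    show max |(γ θ).re - (c.re + l / 2)| |(γ θ).im - (c.im + l / 2)| = l / 2
    rw [hγre, hγim, ← hbre, ← hbim, add_sub_cancel_left, add_sub_cancel_left, abs_mul, abs_mul,
      abs_of_pos (hρpos θ), ← mul_max_of_nonneg _ _ (hρpos θ).le]
    exact div_mul_cancel₀ _ (hμpos θ).ne'
  set φ : ℝ → ℂ := fun θ => h (γ θ) - Real.log (ρ θ) - θ * Complex.I with hφ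
  have hφ1 : ∀ θ, Complex.exp (φ θ) = 1 := by
    intro θ
    rw [hφ]
    simp only
    rw [Complex.exp_sub, Complex.exp_sub, he _ (hγmem θ), ← Complex.ofReal_exp,
      Real.exp_log (hρpos θ)]
    have h1 : (ρ θ : ℂ) ≠ 0 := by exact_mod_cast (hρpos θ).ne'
    have h2 := Complex.exp_ne_zero (θ * Complex.I)
    rw [hγ]; simp only [add_sub_cancel_left]
    field_simp
  have hφc : Continuous φ := by
    have h1 : Continuous fun θ => h (γ θ) := hc.comp_continuous hγc hγmem
    have h2 : Continuous fun θ => Real.log (ρ θ) := hρc.log fun θ => (hρpos θ).ne'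
    exact (h1.sub (Complex.continuous_ofReal.comp h2)).sub (by fun_prop)
  have hper : γ (2 * Real.pi) = γ 0 := by
    rw [hγ]; simp [hρ, hμ, Complex.exp_two_pi_mul_I]
  have hρper : ρ (2 * Real.pi) = ρ 0 := by simp [hρ, hμ]
  have hend : (φ (2 * Real.pi)).im = (φ 0).im - 2 * Real.pi := by
    rw [hφ]; simp only [hper, hρper]; simp
  obtain ⟨θ, -, hθ⟩ := intermediate_value_Icc' (f := fun θ => (φ θ).im) Real.two_pi_pos.le
    (Complex.continuous_im.comp hφc).continuousOn (show (φ 0).im - Real.pi ∈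
      Icc (φ (2 * Real.pi)).im (φ 0).im by
        rw [hend]; constructor <;> linarith [Real.pi_pos])
  obtain ⟨n, hn⟩ := Complex.exp_eq_one_iff.1 (hφ1 θ)
  obtain ⟨k, hk⟩ := Complex.exp_eq_one_iff.1 (hφ1 0)
  simp only [hn, hk] at hθ
  have h1 : (n : ℝ) * (2 * Real.pi) = k * (2 * Real.pi) - Real.pi := by simpa using hθ
  have h2 : (2 * n : ℝ) = 2 * k - 1 := by
    have := Real.pi_pos
    field_simp at h1; linarith
  have h3 : 2 * n = 2 * k - 1 := by exact_mod_cast h2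
  omega

/-! ### Peripheral circles -/

/-- The peripheral circles of the carpet: the outer square and the boundaries of the
complementary squares. -/
def circ : Option (List (Digit p)) → Set ℂ
  | none => outerSquare
  | some v => wordMap v '' middleSquare p

lemma sub_mem_openSq [OddBase p] (d : Digit p) {z : ℂ} (hz : z ∈ openSq) : sub d z ∈ openSq := by
  have hp := base_pos (p := p)
  obtain ⟨⟨h1, h2⟩, h3, h4⟩ := hz
  refine ⟨⟨?_, ?_⟩, ?_, ?_⟩ <;> simp only [sub_re, sub_im]
  · positivity
  · rw [div_lt_one hp]; linarith [digit_fst_le d]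
  · positivity
  · rw [div_lt_one hp]; linarith [digit_snd_le d]

lemma wordMap_mem_openSq [OddBase p] (w : List (Digit p)) {z : ℂ}
    (hz : z ∈ openSq) : wordMap w z ∈ openSq := by
  induction w with
  | nil => exact hz
  | cons d w ih => exact sub_mem_openSq d ih

lemma unitSq_eq : unitSq = Icc (0 : ℝ) 1 ×ℂ Icc (0 : ℝ) 1 := rfl

lemma openSq_eq : openSq = Ioo (0 : ℝ) 1 ×ℂ Ioo (0 : ℝ) 1 := rfl

lemma isCompact_unitSq : IsCompact unitSq := isCompact_Icc.reProdIm isCompact_Icc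

lemma isCompact_carpetApprox (n : ℕ) : IsCompact (carpetApprox p n) := by
  induction n with
  | zero => exact isCompact_unitSq
  | succ n ih =>
    have : carpetApprox p (n + 1) = ⋃ d : Digit p, sub d '' carpetApprox p n := by
      ext z; rw [mem_carpetApprox_succ]; simp
    rw [this]
    exact isCompact_iUnion fun d => ih.image (continuous_sub d)

lemma isCompact_carpet : IsCompact (sierpinskiCarpet p) :=
  (isCompact_carpetApprox 0).of_isClosed_subset
    (isClosed_iInter fun n => (isCompact_carpetApprox n).isClosed) (iInter_subset _ 0)

lemma isClosed_squareBoundary (c : ℂ) (l : ℝ) : IsClosed (squareBoundary c l) :=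
  isClosed_eq (by fun_prop) continuous_const

lemma circ_subset_carpet [OddBase p] (i : Option (List (Digit p))) :
    circ i ⊆ sierpinskiCarpet p := by
  cases i with
  | none => exact outerSquare_subset_carpet
  | some v =>
    rintro _ ⟨z, hz, rfl⟩
    exact wordMap_mem_carpet v (middleSquare_subset_carpet hz)

lemma isCompact_middleSquare [OddBase p] : IsCompact (middleSquare p) :=
  isCompact_carpet.of_isClosed_subset (isClosed_squareBoundary _ _) middleSquare_subset_carpet

lemma isCompact_outerSquare : IsCompact outerSquare :=
  isCompact_unitSq.of_isClosed_subset (isClosed_squareBoundary _ _)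
    fun _ hz => (mem_outerSquare.1 hz).1

lemma isCompact_circ [OddBase p] (i : Option (List (Digit p))) : IsCompact (circ i) := by
  cases i with
  | none => exact isCompact_outerSquare
  | some v => exact isCompact_middleSquare.image (continuous_wordMap v)

/-- The lower left corner of the middle square. -/
def midCorner (p : ℕ) : ℂ := ⟨mid p / p, mid p / p⟩

lemma midCorner_mem [OddBase p] : midCorner p ∈ middleSquare p := by
  have h : (mid p : ℝ) / p ≤ (mid p + 1 : ℝ) / p := by
    have := base_pos (p := p); gcongr; linarith
  exact mem_middleSquare.2 ⟨⟨le_rfl, h⟩, ⟨le_rfl, h⟩, Or.inl rfl⟩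

lemma circ_nonempty [OddBase p] (i : Option (List (Digit p))) : (circ i).Nonempty := by
  cases i with
  | none => exact ⟨0, mem_outerSquare.2 ⟨by simp [unitSq], by simp⟩⟩
  | some v => exact ⟨_, midCorner p, midCorner_mem, rfl⟩

lemma circ_some_subset_openSq [OddBase p] (v : List (Digit p)) : circ (some v) ⊆ openSq := by
  rintro _ ⟨z, hz, rfl⟩
  exact wordMap_mem_openSq v (middleSquare_subset_openSq hz)

lemma circ_disjoint [OddBase p] {i j : Option (List (Digit p))} (h : i ≠ j) :
    Disjoint (circ i) (circ j) := by
  have key : ∀ {w v : List (Digit p)}, ¬w <+: v → Disjoint (circ (some w)) (circ (some v)) := by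
    intro w v hwv
    rw [disjoint_left]
    rintro _ ⟨y, hy, rfl⟩
    exact (separated_cell_hole hwv).notMem_openSq (middleSquare_subset_openSq hy)
  cases i with
  | none =>
    cases j with
    | none => exact absurd rfl h
    | some v =>
      exact disjoint_left.2 fun z hz hz' => notMem_outerSquare (circ_some_subset_openSq v hz') hz
  | some w =>
    cases j with
    | none =>
      exact disjoint_left.2 fun z hz hz' => notMem_outerSquare (circ_some_subset_openSq w hz) hz'
    | some v =>
      by_cases hwv : w <+: v
      · refine (key fun hvw => h ?_).symm
        rw [hwv.eq_of_length (le_antisymm hwv.length_le hvw.length_le)]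
      · exact key hwv

lemma eq_of_circ_subset [OddBase p] {i j : Option (List (Digit p))} (h : circ i ⊆ circ j) :
    i = j := by
  by_contra hij
  obtain ⟨z, hz⟩ := circ_nonempty i
  exact disjoint_left.1 (circ_disjoint hij) hz (h hz)

lemma exists_not_hasLog_circ [OddBase p] (i : Option (List (Digit p))) :
    ∃ b ∉ circ i, ¬HasLog (fun z => z - b) (circ i) := by
  have center : ∀ (c : ℂ) {l : ℝ}, 0 < l →
      c + (l / 2 : ℝ) * (1 + Complex.I) ∉ squareBoundary c l := by
    intro c l hl h
    have h' : max |(c + (l / 2 : ℝ) * (1 + Complex.I)).re - (c.re + l / 2)|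
      |(c + (l / 2 : ℝ) * (1 + Complex.I)).im - (c.im + l / 2)| = l / 2 := h
    rw [Complex.add_re, Complex.add_im, Complex.re_ofReal_mul, Complex.im_ofReal_mul] at h'
    simp at h'
    linarith
  cases i with
  | none => exact ⟨_, center 0 one_pos, not_hasLog_squareBoundary 0 one_pos⟩
  | some v =>
    have hl : (0 : ℝ) < 1 / p := one_div_pos.2 base_pos
    set c : ℂ := (((p : ℝ) - 1) / (2 * p) : ℝ) * (1 + Complex.I)
    set b : ℂ := c + ((1 / p : ℝ) / 2 : ℝ) * (1 + Complex.I)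
    refine ⟨wordMap v b, ?_, ?_⟩
    · rintro ⟨z, hz, h⟩
      rw [wordMap_injective v h] at hz
      exact center c hl hz
    · rintro ⟨h, hc, he⟩
      have hp0 : ((p : ℂ) ^ v.length) ≠ 0 := pow_ne_zero _ (by
        exact_mod_cast (base_pos (p := p)).ne')
      refine not_hasLog_squareBoundary c hl
        ⟨fun z => h (wordMap v z) + Complex.log ((p : ℂ) ^ v.length), ?_, fun z hz => ?_⟩
      · exact (hc.comp (continuous_wordMap v).continuousOn (mapsTo_image _ _)).add
          continuousOn_const
      · rw [Complex.exp_add, he _ ⟨z, hz, rfl⟩, Complex.exp_log hp0]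
        change (wordMap v z - wordMap v b) * _ = z - b
        rw [wordMap_eq, wordMap_eq]
        clear_value b
        field_simp
        ring

/-! ### Connectivity of complements of peripheral circles -/

/-- The points of the square `I × I` one of whose coordinates satisfies `P`. -/
def cross (I : Set ℝ) (P : ℝ → Prop) : Set ℂ :=
  {z : ℂ | (z.re ∈ I ∧ z.im ∈ I) ∧ (P z.re ∨ P z.im)}

lemma isPreconnected_cross {I : Set ℝ} (hI : I.OrdConnected) {P : ℝ → Prop} {a : ℝ}
    (haI : a ∈ I) (ha : P a) : IsPreconnected (cross I P) := by
  have hV : ∀ b, IsPreconnected ((fun t : ℝ => (⟨b, t⟩ : ℂ)) '' I) := fun b =>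
    hI.isPreconnected.image _ (Continuous.continuousOn (by
      have : (fun t : ℝ => (⟨b, t⟩ : ℂ)) = fun t : ℝ => (b : ℂ) + t * Complex.I := by
        funext t; apply Complex.ext <;> simp
      rw [this]; fun_prop))
  have hH : ∀ b, IsPreconnected ((fun t : ℝ => (⟨t, b⟩ : ℂ)) '' I) := fun b =>
    hI.isPreconnected.image _ (Continuous.continuousOn (by
      have : (fun t : ℝ => (⟨t, b⟩ : ℂ)) = fun t : ℝ => (t : ℂ) + b * Complex.I := by
        funext t; apply Complex.ext <;> simp
      rw [this]; fun_prop))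
  refine isPreconnected_of_forall ⟨a, a⟩ ?_
  rintro y ⟨⟨h1, h2⟩, h | h⟩
  · refine ⟨(fun t : ℝ => (⟨y.re, t⟩ : ℂ)) '' I ∪ (fun t : ℝ => (⟨t, a⟩ : ℂ)) '' I, ?_,
      Or.inr ⟨a, haI, rfl⟩, Or.inl ⟨y.im, h2, rfl⟩,
      (hV y.re).union ⟨y.re, a⟩ ⟨a, haI, rfl⟩ ⟨y.re, h1, rfl⟩ (hH a)⟩
    rintro _ (⟨t, ht, rfl⟩ | ⟨t, ht, rfl⟩)
    · exact ⟨⟨h1, ht⟩, Or.inl h⟩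
    · exact ⟨⟨ht, haI⟩, Or.inr ha⟩
  · refine ⟨(fun t : ℝ => (⟨t, y.im⟩ : ℂ)) '' I ∪ (fun t : ℝ => (⟨a, t⟩ : ℂ)) '' I, ?_,
      Or.inr ⟨a, haI, rfl⟩, Or.inl ⟨y.re, h1, rfl⟩,
      (hH y.im).union ⟨a, y.im⟩ ⟨a, haI, rfl⟩ ⟨y.im, h2, rfl⟩ (hV a)⟩
    rintro _ (⟨t, ht, rfl⟩ | ⟨t, ht, rfl⟩)
    · exact ⟨⟨ht, h2⟩, Or.inr h⟩
    · exact ⟨⟨haI, ht⟩, Or.inl ha⟩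

/-- The open grid lines of the first subdivision. -/
def openGrid (p : ℕ) : Set ℂ := cross (Ioo 0 1) fun x => ∃ k : ℕ, p * x = k

lemma inv_base_mem [OddBase p] : (1 : ℝ) / p ∈ Ioo (0 : ℝ) 1 :=
  ⟨one_div_pos.2 base_pos, by
    rw [div_lt_one base_pos]; linarith [three_le_base (p := p)]⟩

lemma base_mul_inv [OddBase p] : ∃ k : ℕ, (p : ℝ) * (1 / p) = k :=
  ⟨1, by rw [mul_one_div_cancel base_pos.ne']; simp⟩

lemma isPreconnected_openGrid [OddBase p] : IsPreconnected (openGrid p) :=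
  isPreconnected_cross ordConnected_Ioo inv_base_mem base_mul_inv

lemma openGrid_subset_openSq : openGrid p ⊆ openSq := fun _ hz => hz.1

lemma openGrid_subset_carpet [OddBase p] : openGrid p ⊆ sierpinskiCarpet p := fun _ hz =>
  gridLines_subset_carpet ⟨openSq_subset_unitSq hz.1, hz.2⟩

/-- A base point of the open grid. -/
def gridPoint (p : ℕ) : ℂ := ⟨1 / p, 1 / p⟩

lemma gridPoint_mem [OddBase p] : gridPoint p ∈ openGrid p :=
  ⟨⟨inv_base_mem, inv_base_mem⟩, Or.inl base_mul_inv⟩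

lemma isPreconnected_openGrid_union_sub [OddBase p] (d : Digit p) :
    IsPreconnected (openGrid p ∪ sub d '' openGrid p) := by
  have hp := base_pos (p := p)
  have h3 := three_le_base (p := p)
  obtain ⟨e, he, he'⟩ : ∃ e : ℂ, e ∈ closure (openGrid p) ∧ sub d e ∈ openGrid p := by
    have hcl : ∀ x ∈ Icc (0 : ℝ) 1, (⟨x, 1 / p⟩ : ℂ) ∈ closure (openGrid p) := by
      intro x hx
      rw [← closure_Ioo (zero_ne_one' ℝ)] at hx
      refine map_mem_closure (f := fun t : ℝ => (⟨t, 1 / p⟩ : ℂ)) ?_ hx fun t ht => ?_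
      · have : (fun t : ℝ => (⟨t, 1 / p⟩ : ℂ)) = fun t : ℝ => (t : ℂ) + (1 / p : ℝ) * Complex.I := by
          funext t; apply Complex.ext <;> simp
        rw [this]; fun_prop
      · exact ⟨⟨ht, inv_base_mem⟩, Or.inr base_mul_inv⟩
    have him : (1 / p + (d.1.2 : ℕ) : ℝ) / p ∈ Ioo (0 : ℝ) 1 := by
      refine ⟨by positivity, ?_⟩
      rw [div_lt_one hp]
      have := (inv_base_mem (p := p)).2
      linarith [digit_snd_le d]
    by_cases hi : (d.1.1 : ℕ) = 0
    · refine ⟨⟨1, 1 / p⟩, hcl 1 (by simp), ⟨⟨?_, ?_⟩, Or.inl ⟨1, ?_⟩⟩⟩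
      · rw [sub_re, hi]; simpa using inv_base_mem (p := p)
      · rw [sub_im]; exact him
      · rw [sub_re, hi]; simp [hp.ne']
    · refine ⟨⟨0, 1 / p⟩, hcl 0 (by simp), ⟨⟨⟨?_, ?_⟩, ?_⟩, Or.inl ⟨d.1.1, ?_⟩⟩⟩
      · rw [sub_re]; have : 0 < (d.1.1 : ℕ) := by omega
        have : (0 : ℝ) < (d.1.1 : ℕ) := by exact_mod_cast this
        simp only [zero_add]; positivity
      · rw [sub_re, div_lt_one hp]; linarith [digit_fst_le d]
      · rw [sub_im]; exact him
      · rw [sub_re]; field_simp; ring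
  have h1 : IsPreconnected (sub d '' openGrid p) :=
    isPreconnected_openGrid.image _ (continuous_sub d).continuousOn
  have h2 : IsPreconnected (insert (sub d e) (sub d '' openGrid p)) :=
    h1.subset_closure (subset_insert _ _) (insert_subset
      (image_closure_subset_closure_image (continuous_sub d) ⟨e, he, rfl⟩) subset_closure)
  have h3 := isPreconnected_openGrid.union (sub d e) he' (mem_insert _ _) h2
  rwa [union_insert, insert_eq_of_mem (mem_union_left _ he')] at h3

/-- The union of all open grids of all cells. -/
def skeleton (p : ℕ) : Set ℂ := ⋃ w : List (Digit p), wordMap w '' openGrid p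

lemma isPreconnected_skeleton [OddBase p] : IsPreconnected (skeleton p) := by
  have key : ∀ w : List (Digit p), ∃ t ⊆ skeleton p, gridPoint p ∈ t ∧
      wordMap w '' openGrid p ⊆ t ∧ IsPreconnected t := by
    intro w
    induction w using List.reverseRecOn with
    | nil =>
      refine ⟨wordMap [] '' openGrid p, subset_iUnion (fun w => wordMap w '' openGrid p) [], ⟨_, gridPoint_mem, rfl⟩, subset_rfl, ?_⟩
      exact isPreconnected_openGrid.image _ (continuous_wordMap _).continuousOn
    | append_singleton w d ih =>
      obtain ⟨t, h1, h2, h3, h4⟩ := ih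
      have e : wordMap (w ++ [d]) '' openGrid p = wordMap w '' (sub d '' openGrid p) := by
        rw [image_image]
        exact image_congr fun z _ => wordMap_append w [d] z
      refine ⟨t ∪ wordMap w '' (openGrid p ∪ sub d '' openGrid p), ?_, Or.inl h2, ?_, ?_⟩
      · rw [image_union, ← e]
        exact union_subset h1 (union_subset (subset_iUnion (fun w => wordMap w '' openGrid p) w)
          (subset_iUnion (fun w => wordMap w '' openGrid p) (w ++ [d])))
      · rw [image_union, ← e]
        exact subset_union_right.trans subset_union_right
      · exact h4.union (wordMap w (gridPoint p)) (h3 ⟨_, gridPoint_mem, rfl⟩)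
          ⟨_, Or.inl gridPoint_mem, rfl⟩
          ((isPreconnected_openGrid_union_sub d).image _ (continuous_wordMap w).continuousOn)
  refine isPreconnected_of_forall (gridPoint p) fun y hy => ?_
  obtain ⟨w, hw⟩ := mem_iUnion.1 hy
  obtain ⟨t, h1, h2, h3, h4⟩ := key w
  exact ⟨t, h1, h2, h3 hw, h4⟩

lemma dist_le_two {z z' : ℂ} (hz : z ∈ unitSq) (hz' : z' ∈ unitSq) : dist z z' ≤ 2 := by
  obtain ⟨⟨h1, h2⟩, h3, h4⟩ := hz
  obtain ⟨⟨h5, h6⟩, h7, h8⟩ := hz'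
  rw [dist_eq_norm]
  refine (Complex.norm_le_abs_re_add_abs_im _).trans ?_
  rw [Complex.sub_re, Complex.sub_im]
  have a : |z.re - z'.re| ≤ 1 := by rw [abs_le]; constructor <;> linarith
  have b : |z.im - z'.im| ≤ 1 := by rw [abs_le]; constructor <;> linarith
  linarith

lemma carpet_subset_closure_skeleton [OddBase p] :
    sierpinskiCarpet p ⊆ closure (skeleton p) := by
  intro z hz
  rw [Metric.mem_closure_iff]
  intro ε hε
  have h1 : (1 : ℝ) < p := by linarith [three_le_base (p := p)]
  obtain ⟨n, hn⟩ := pow_unbounded_of_one_lt (2 / ε) h1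
  obtain ⟨w, hw, y, hy, rfl⟩ := exists_wordMap_eq n hz
  refine ⟨wordMap w (gridPoint p), mem_iUnion.2 ⟨w, _, gridPoint_mem, rfl⟩, ?_⟩
  rw [dist_wordMap, hw]
  have hpn : (0 : ℝ) < (p : ℝ) ^ n := pow_pos base_pos _
  rw [div_lt_iff₀ hε] at hn
  rw [div_lt_iff₀ hpn]
  have := dist_le_two (carpet_subset_unitSq hy)
    (carpet_subset_unitSq (openGrid_subset_carpet (gridPoint_mem (p := p))))
  nlinarith

lemma skeleton_subset [OddBase p] : skeleton p ⊆ sierpinskiCarpet p \ outerSquare := by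
  intro z hz
  obtain ⟨w, y, hy, rfl⟩ := mem_iUnion.1 hz
  exact ⟨wordMap_mem_carpet w (openGrid_subset_carpet hy),
    notMem_outerSquare (wordMap_mem_openSq w (openGrid_subset_openSq hy))⟩

lemma isPreconnected_carpet [OddBase p] : IsPreconnected (sierpinskiCarpet p) :=
  isPreconnected_skeleton.subset_closure (skeleton_subset.trans sdiff_subset)
    carpet_subset_closure_skeleton

lemma isPreconnected_diff_outerSquare [OddBase p] :
    IsPreconnected (sierpinskiCarpet p \ outerSquare) :=
  isPreconnected_skeleton.subset_closure skeleton_subset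
    (sdiff_subset.trans carpet_subset_closure_skeleton)

lemma isPreconnected_diff_middleSquare [OddBase p] :
    IsPreconnected (sierpinskiCarpet p \ middleSquare p) := by
  have hp := base_pos (p := p)
  set P : ℝ → Prop := fun x => ∃ k : ℕ, p * x = k ∧ (k < mid p ∨ mid p + 1 < k) with hP
  have hmid := one_le_mid (p := p)
  have hP0 : P 0 := ⟨0, by simp, Or.inl (by omega)⟩
  have hL : IsPreconnected (cross (Icc 0 1) P) :=
    isPreconnected_cross ordConnected_Icc (by simp) hP0
  have hPM : ∀ x, P x → ¬((mid p : ℝ) / p ≤ x ∧ x ≤ (mid p + 1 : ℝ) / p) := by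
    rintro x ⟨k, hk, hk'⟩ ⟨h1, h2⟩
    rw [div_le_iff₀ hp, mul_comm, hk] at h1
    rw [le_div_iff₀ hp, mul_comm, hk] at h2
    have h1' : mid p ≤ k := by exact_mod_cast h1
    have h2' : k ≤ mid p + 1 := by exact_mod_cast h2
    omega
  have hLM : cross (Icc 0 1) P ⊆ sierpinskiCarpet p \ middleSquare p := by
    rintro z ⟨hz, h⟩
    refine ⟨gridLines_subset_carpet ⟨hz, h.imp (fun ⟨k, hk, _⟩ => ⟨k, hk⟩)
      fun ⟨k, hk, _⟩ => ⟨k, hk⟩⟩, fun hM => ?_⟩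
    obtain ⟨h1, h2, -⟩ := mem_middleSquare.1 hM
    rcases h with h | h
    · exact hPM _ h h1
    · exact hPM _ h h2
  have hcell : ∀ d : Digit p, IsPreconnected (sub d '' sierpinskiCarpet p \ middleSquare p) := by
    intro d
    refine ((isPreconnected_diff_outerSquare (p := p)).image _
      (continuous_sub d).continuousOn).subset_closure ?_ ?_
    · rintro _ ⟨z, ⟨hz, hzO⟩, rfl⟩
      refine ⟨⟨z, hz, rfl⟩, ?_⟩
      have hsep := separated_cell_hole (p := p) (w := [d]) (v := []) (by simp)
      have := hsep.notMem_openSq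
        ((mem_openSq_or_outerSquare (carpet_subset_unitSq hz)).resolve_right hzO)
      exact fun hM => this ⟨_, hM, rfl⟩
    · rintro _ ⟨⟨z, hz, rfl⟩, -⟩
      exact image_closure_subset_closure_image (continuous_sub d)
        ⟨z, closure_mono (skeleton_subset (p := p)) (carpet_subset_closure_skeleton hz), rfl⟩
  have hcorner : ∀ d : Digit p, ∃ e ∈ outerSquare, sub d e ∈ cross (Icc 0 1) P := by
    intro d
    have h0 : (0 : ℂ) ∈ outerSquare := mem_outerSquare.2 ⟨by simp [unitSq], by simp⟩
    have h1 : (⟨1, 1⟩ : ℂ) ∈ outerSquare := mem_outerSquare.2 ⟨by simp [unitSq], by simp⟩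
    have hd : (d.1.1 : ℕ) < mid p ∨ mid p < (d.1.1 : ℕ) ∨
      (d.1.2 : ℕ) < mid p ∨ mid p < (d.1.2 : ℕ) := by have := d.2; omega
    have hmem : ∀ e ∈ outerSquare, sub d e ∈ unitSq := fun e he =>
      sub_mem_unitSq d (mem_outerSquare.1 he).1
    rcases hd with hd | hd | hd | hd
    · exact ⟨0, h0, hmem 0 h0, Or.inl ⟨d.1.1, by rw [sub_re]; field_simp; simp, Or.inl hd⟩⟩
    · exact ⟨⟨1, 1⟩, h1, hmem _ h1, Or.inl ⟨d.1.1 + 1, by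
        rw [sub_re]; field_simp; push_cast; ring, Or.inr (by omega)⟩⟩
    · exact ⟨0, h0, hmem 0 h0, Or.inr ⟨d.1.2, by rw [sub_im]; field_simp; simp, Or.inl hd⟩⟩
    · exact ⟨⟨1, 1⟩, h1, hmem _ h1, Or.inr ⟨d.1.2 + 1, by
        rw [sub_im]; field_simp; push_cast; ring, Or.inr (by omega)⟩⟩
  refine isPreconnected_of_forall 0 fun y hy => ?_
  obtain ⟨d, x, hx, rfl⟩ := exists_sub_eq hy.1
  obtain ⟨e, heO, he⟩ := hcorner d
  refine ⟨cross (Icc 0 1) P ∪ (sub d '' sierpinskiCarpet p \ middleSquare p), ?_, Or.inl ?_,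
    Or.inr ⟨⟨x, hx, rfl⟩, hy.2⟩, ?_⟩
  · refine union_subset hLM (sdiff_subset_sdiff_left ?_)
    rintro _ ⟨z, hz, rfl⟩
    exact sub_mem_carpet d hz
  · exact ⟨by simp, Or.inl hP0⟩
  · exact hL.union (sub d e) he ⟨⟨e, outerSquare_subset_carpet heO, rfl⟩, (hLM he).2⟩ (hcell d)

lemma isPreconnected_gridLines [OddBase p] : IsPreconnected (gridLines p) :=
  isPreconnected_cross (I := Icc 0 1) (P := fun x => ∃ k : ℕ, p * x = k) (a := 0)
    ordConnected_Icc (by simp) ⟨0, by simp⟩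

lemma notMem_gridLines_of_sub [OddBase p] (d : Digit p) {y : ℂ} (hy : y ∈ openSq) :
    sub d y ∉ gridLines p := by
  have hp := base_pos (p := p)
  have key : ∀ (i k : ℕ) (x : ℝ), x ∈ Ioo (0 : ℝ) 1 → p * ((x + i) / p) ≠ k := by
    intro i k x hx h
    rw [mul_div_cancel₀ _ hp.ne'] at h
    have h1 : (i : ℝ) < k := by linarith [hx.1]
    have h2 : (k : ℝ) < i + 1 := by linarith [hx.2]
    have h1' : i < k := by exact_mod_cast h1
    have h2' : k < i + 1 := by exact_mod_cast h2
    omega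
  rintro ⟨-, ⟨k, hk⟩ | ⟨k, hk⟩⟩
  · rw [sub_re] at hk; exact key _ _ _ hy.1 hk
  · rw [sub_im] at hk; exact key _ _ _ hy.2 hk

lemma isPreconnected_diff_circ_some [OddBase p] (w : List (Digit p)) :
    IsPreconnected (sierpinskiCarpet p \ circ (some w)) := by
  induction w with
  | nil =>
    have : circ (some ([] : List (Digit p))) = middleSquare p := by simp [circ, wordMap]
    rw [this]; exact isPreconnected_diff_middleSquare
  | cons d w ih =>
    have e : circ (some (d :: w)) = sub d '' circ (some w) := wordMap_cons_image d w _
    have h0 : (0 : ℂ) ∈ outerSquare := mem_outerSquare.2 ⟨by simp [unitSq], by simp⟩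
    have h0g : ∀ d' : Digit p, sub d' 0 ∈ gridLines p := fun d' =>
      ⟨sub_mem_unitSq d' (by simp [unitSq]), Or.inl ⟨d'.1.1, by
        rw [sub_re]; have := base_pos (p := p); field_simp; simp⟩⟩
    have hgrid : gridLines p ⊆ sierpinskiCarpet p \ circ (some (d :: w)) := by
      intro z hz
      refine ⟨gridLines_subset_carpet hz, ?_⟩
      rw [e]
      rintro ⟨y, hy, rfl⟩
      exact notMem_gridLines_of_sub d (circ_some_subset_openSq w hy) hz
    refine isPreconnected_of_forall 0 fun y hy => ?_
    have h0' : (0 : ℂ) ∈ gridLines p := outerSquare_subset_gridLines h0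
    obtain ⟨d', x, hx, rfl⟩ := exists_sub_eq hy.1
    by_cases hd : d' = d
    · subst hd
      refine ⟨gridLines p ∪ sub d' '' (sierpinskiCarpet p \ circ (some w)), union_subset hgrid ?_,
        Or.inl h0', Or.inr ⟨x, ⟨hx, fun h => hy.2 ?_⟩, rfl⟩, ?_⟩
      · rintro _ ⟨z, hz, rfl⟩
        refine ⟨sub_mem_carpet _ hz.1, ?_⟩
        rw [e]
        rintro ⟨z', hz', h⟩
        exact hz.2 (sub_injective _ h ▸ hz')
      · rw [e]; exact ⟨x, h, rfl⟩
      · refine isPreconnected_gridLines.union (sub d' 0) (h0g d')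
          ⟨0, ⟨outerSquare_subset_carpet h0, fun h => ?_⟩, rfl⟩
          (ih.image _ (continuous_sub d').continuousOn)
        exact notMem_outerSquare (circ_some_subset_openSq w h) h0
    · refine ⟨gridLines p ∪ sub d' '' sierpinskiCarpet p, union_subset hgrid ?_,
        Or.inl h0', Or.inr ⟨x, hx, rfl⟩, ?_⟩
      · rintro _ ⟨z, hz, rfl⟩
        refine ⟨sub_mem_carpet _ hz, ?_⟩
        rw [e]
        rintro ⟨z', hz', h⟩
        have hsep := separated_cells (w := [d]) (v := [d']) rfl (by simpa using Ne.symm hd)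
        exact hsep.notMem_openSq (circ_some_subset_openSq w hz')
          ⟨z, carpet_subset_unitSq hz, h.symm⟩
      · exact isPreconnected_gridLines.union (sub d' 0) (h0g d')
          ⟨0, outerSquare_subset_carpet h0, rfl⟩
          (isPreconnected_carpet.image _ (continuous_sub d').continuousOn)

lemma isPreconnected_diff_circ [OddBase p] (i : Option (List (Digit p))) :
    IsPreconnected (sierpinskiCarpet p \ circ i) := by
  cases i with
  | none => exact isPreconnected_diff_outerSquare
  | some w => exact isPreconnected_diff_circ_some w

/-! ### Homeomorphisms permute the peripheral circles -/

lemma mem_carpet_of_wordMap_mem [OddBase p] (w : List (Digit p)) {y : ℂ} (hy : y ∈ openSq)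
    (h : wordMap w y ∈ sierpinskiCarpet p) : y ∈ sierpinskiCarpet p := by
  obtain ⟨v, hv, x, hx, hxy⟩ := exists_wordMap_eq w.length h
  by_cases hwv : w = v
  · subst hwv
    rwa [← wordMap_injective w hxy]
  · exact absurd ⟨x, carpet_subset_unitSq hx, hxy⟩
      ((separated_cells hv.symm hwv).notMem_openSq hy)

lemma notMem_carpet_of_mem_openMid [OddBase p] {y : ℂ} (hy : y ∈ openMid p) :
    y ∉ sierpinskiCarpet p := by
  have hp := base_pos (p := p)
  intro h
  obtain ⟨d, x, hx, rfl⟩ := exists_sub_eq h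
  have key : ∀ (i : ℕ) (x : ℝ), x ∈ Icc (0 : ℝ) 1 →
      (x + i) / p ∈ Ioo ((mid p : ℝ) / p) ((mid p + 1 : ℝ) / p) → i = mid p := by
    intro i x hx h
    have h1 := (div_lt_div_iff_of_pos_right hp).1 h.1
    have h2 := (div_lt_div_iff_of_pos_right hp).1 h.2
    have h3 : (mid p : ℝ) < i + 1 := by linarith [hx.2]
    have h4 : (i : ℝ) < mid p + 1 := by linarith [hx.1]
    have h3' : mid p < i + 1 := by exact_mod_cast h3
    have h4' : i < mid p + 1 := by exact_mod_cast h4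
    omega
  have hx' := carpet_subset_unitSq hx
  refine d.2 ⟨key _ x.re hx'.1 ?_, key _ x.im hx'.2 ?_⟩
  · have := hy.1; rwa [sub_re] at this
  · have := hy.2; rwa [sub_im] at this

lemma openMid_subset_openSq [OddBase p] : openMid p ⊆ openSq := by
  intro z hz
  have := mid_div_pos (p := p)
  have := mid_add_one_div_lt (p := p)
  exact ⟨⟨by linarith [hz.1.1], by linarith [hz.1.2]⟩, by linarith [hz.2.1], by linarith [hz.2.2]⟩

lemma disjoint_hole_carpet [OddBase p] (w : List (Digit p)) :
    Disjoint (wordMap w '' openMid p) (sierpinskiCarpet p) := by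
  rw [disjoint_left]
  rintro _ ⟨y, hy, rfl⟩ h
  exact notMem_carpet_of_mem_openMid hy
    (mem_carpet_of_wordMap_mem w (openMid_subset_openSq hy) h)

lemma isPreconnected_openMid : IsPreconnected (openMid p) := by
  have : Convex ℝ (openMid p) := by
    have h1 := (convex_Ioo ((mid p : ℝ) / p) (((mid p : ℝ) + 1) / p)).linear_preimage
      Complex.reLm
    have h2 := (convex_Ioo ((mid p : ℝ) / p) (((mid p : ℝ) + 1) / p)).linear_preimage
      Complex.imLm
    exact h1.inter h2
  exact this.isPreconnected

lemma middleSquare_subset_closure_openMid [OddBase p] :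
    middleSquare p ⊆ closure (openMid p) := by
  have hlt : (mid p : ℝ) / p < (mid p + 1 : ℝ) / p := by
    have := base_pos (p := p); gcongr; linarith
  have : openMid p = Ioo ((mid p : ℝ) / p) (((mid p : ℝ) + 1) / p) ×ℂ
    Ioo ((mid p : ℝ) / p) (((mid p : ℝ) + 1) / p) := rfl
  rw [this, Complex.closure_reProdIm, closure_Ioo hlt.ne]
  intro z hz
  obtain ⟨h1, h2, -⟩ := mem_middleSquare.1 hz
  exact ⟨h1, h2⟩

lemma outerSquare_subset_closure_compl : outerSquare ⊆ closure unitSqᶜ := by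
  rw [closure_compl, unitSq_eq, Complex.interior_reProdIm, interior_Icc, ← openSq_eq]
  exact fun z hz h => notMem_outerSquare h hz

/-- The functions `F` and `G` restrict to mutually inverse homeomorphisms of the carpet. -/
structure HomeoPair (p : ℕ) (F G : ℂ → ℂ) : Prop where
  mapsTo : MapsTo F (sierpinskiCarpet p) (sierpinskiCarpet p)
  mapsTo' : MapsTo G (sierpinskiCarpet p) (sierpinskiCarpet p)
  left_inv : ∀ z ∈ sierpinskiCarpet p, G (F z) = z
  right_inv : ∀ z ∈ sierpinskiCarpet p, F (G z) = z
  cont : ContinuousOn F (sierpinskiCarpet p)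
  cont' : ContinuousOn G (sierpinskiCarpet p)

lemma HomeoPair.symm {F G : ℂ → ℂ} (h : HomeoPair p F G) : HomeoPair p G F :=
  ⟨h.mapsTo', h.mapsTo, h.right_inv, h.left_inv, h.cont', h.cont⟩

lemma hasLog_of_notMem_unitSq {J : Set ℂ} (hJ : J ⊆ unitSq) {a : ℂ} (ha : a ∉ unitSq) :
    HasLog (fun z => z - a) J := by
  have haJ : a ∉ J := fun h => ha (hJ h)
  have h : a.re < 0 ∨ 1 < a.re ∨ a.im < 0 ∨ 1 < a.im := by
    by_contra h
    push Not at h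
    exact ha ⟨⟨h.1, h.2.1⟩, h.2.2.1, h.2.2.2⟩
  rcases h with h | h | h | h
  · refine hasLog_halfPlane one_ne_zero haJ fun z hz => ?_
    have := (hJ hz).1.1; simp; linarith
  · refine hasLog_halfPlane (neg_ne_zero.2 one_ne_zero) haJ fun z hz => ?_
    have := (hJ hz).1.2; simp; linarith
  · refine hasLog_halfPlane (neg_ne_zero.2 Complex.I_ne_zero) haJ fun z hz => ?_
    have := (hJ hz).2.1; simp; linarith
  · refine hasLog_halfPlane Complex.I_ne_zero haJ fun z hz => ?_
    have := (hJ hz).2.2; simp; linarith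

lemma HomeoPair.exists_circ_subset [OddBase p] {F G : ℂ → ℂ} (h : HomeoPair p F G)
    (i : Option (List (Digit p))) : ∃ j : Option (List (Digit p)), circ j ⊆ F '' circ i := by
  set J := F '' circ i with hJdef
  have hJS : J ⊆ sierpinskiCarpet p := by
    rintro _ ⟨z, hz, rfl⟩; exact h.mapsTo (circ_subset_carpet i hz)
  have hJU : J ⊆ unitSq := hJS.trans carpet_subset_unitSq
  have hJc : IsCompact J := (isCompact_circ i).image_of_continuousOn
    (h.cont.mono (circ_subset_carpet i))
  obtain ⟨b, hb, hlog⟩ := exists_not_hasLog_circ i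
  have hwind : ¬NoWinding J := by
    intro hJ
    obtain ⟨k, hk, hk'⟩ := hJ.hasLog hJc (g := fun z => G z - b)
      ((h.cont'.mono hJS).sub continuousOn_const) (by
        rintro _ ⟨z, hz, rfl⟩ h0
        rw [h.left_inv z (circ_subset_carpet i hz), sub_eq_zero] at h0
        exact hb (h0 ▸ hz))
    refine hlog ⟨k ∘ F, hk.comp (h.cont.mono (circ_subset_carpet i)) (mapsTo_image _ _),
      fun z hz => ?_⟩
    rw [Function.comp_apply, hk' _ ⟨z, hz, rfl⟩]
    simp only [h.left_inv z (circ_subset_carpet i hz)]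
  have hC : IsPreconnected (sierpinskiCarpet p \ J) := by
    have : sierpinskiCarpet p \ J = F '' (sierpinskiCarpet p \ circ i) := by
      ext z
      constructor
      · rintro ⟨hz, hzJ⟩
        exact ⟨G z, ⟨h.mapsTo' hz, fun hG => hzJ ⟨G z, hG, h.right_inv z hz⟩⟩, h.right_inv z hz⟩
      · rintro ⟨y, ⟨hy, hyi⟩, rfl⟩
        refine ⟨h.mapsTo hy, ?_⟩
        rintro ⟨x, hx, hxy⟩
        refine hyi ?_
        rw [← h.left_inv y hy, ← hxy, h.left_inv x (circ_subset_carpet i hx)]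
        exact hx
    rw [this]
    exact (isPreconnected_diff_circ i).image _ (h.cont.mono sdiff_subset)
  have hball : ∀ o ∉ J, ∀ A : Set ℂ, o ∈ closure A → ∃ a ∈ A, a ∉ J ∧
      (HasLog (fun z => z - a) J → HasLog (fun z => z - o) J) := by
    intro o ho A hA
    obtain ⟨r, hr, hr'⟩ := Metric.isOpen_iff.1 hJc.isClosed.isOpen_compl o ho
    obtain ⟨a, haA, ha⟩ := Metric.mem_closure_iff.1 hA r hr
    rw [dist_comm] at ha
    exact ⟨a, haA, hr' ha, fun hlog => hasLog_sub_of_isPreconnected hJc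
      (convex_ball o r).isPreconnected (disjoint_left.2 fun x hx => hr' hx) ha
      (mem_ball_self hr) hlog⟩
  have outer : ∀ a ∈ sierpinskiCarpet p, a ∉ J → ¬HasLog (fun z => z - a) J →
      ∃ j : Option (List (Digit p)), circ j ⊆ J := by
    intro a haS haJ ha
    refine ⟨none, fun o ho => ?_⟩
    by_contra hoJ
    obtain ⟨x, hx, -, hxo⟩ := hball o hoJ _ (outerSquare_subset_closure_compl ho)
    exact ha (hasLog_sub_of_isPreconnected hJc hC disjoint_sdiff_left
      ⟨outerSquare_subset_carpet ho, hoJ⟩ ⟨haS, haJ⟩ (hxo (hasLog_of_notMem_unitSq hJU hx)))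
  unfold NoWinding at hwind
  push Not at hwind
  obtain ⟨a, haJ, ha⟩ := hwind
  have haU : a ∈ unitSq := by
    by_contra haU
    exact ha (hasLog_of_notMem_unitSq hJU haU)
  by_cases haS : a ∈ sierpinskiCarpet p
  · exact outer a haS haJ ha
  obtain ⟨w, hw⟩ := exists_mem_hole haU haS
  by_cases hsub : circ (some w) ⊆ J
  · exact ⟨some w, hsub⟩
  obtain ⟨o, ho, hoJ⟩ := not_subset.1 hsub
  refine outer o (circ_subset_carpet _ ho) hoJ fun hlog => ha ?_
  have hocl : o ∈ closure (wordMap w '' openMid p) := by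
    obtain ⟨y, hy, rfl⟩ := ho
    exact image_closure_subset_closure_image (continuous_wordMap w)
      ⟨y, middleSquare_subset_closure_openMid hy, rfl⟩
  have hdisj : Disjoint (wordMap w '' openMid p) J := (disjoint_hole_carpet w).mono_right hJS
  have hins : IsPreconnected (insert o (wordMap w '' openMid p)) :=
    (isPreconnected_openMid.image _ (continuous_wordMap w).continuousOn).subset_closure
      (subset_insert _ _) (insert_subset hocl subset_closure)
  exact hasLog_sub_of_isPreconnected hJc hins (disjoint_insert_left.2 ⟨hoJ, hdisj⟩)
    (mem_insert _ _) (Or.inr hw) hlog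

lemma HomeoPair.exists_image_circ_eq [OddBase p] {F G : ℂ → ℂ} (h : HomeoPair p F G)
    (i : Option (List (Digit p))) : ∃ j : Option (List (Digit p)), F '' circ i = circ j := by
  obtain ⟨j, hj⟩ := h.exists_circ_subset i
  obtain ⟨k, hk⟩ := h.symm.exists_circ_subset j
  have hGj : G '' circ j ⊆ circ i := by
    rintro _ ⟨y, hy, rfl⟩
    obtain ⟨x, hx, rfl⟩ := hj hy
    rwa [h.left_inv x (circ_subset_carpet i hx)]
  have hki : k = i := eq_of_circ_subset (hk.trans hGj)
  subst hki
  refine ⟨j, subset_antisymm ?_ hj⟩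
  rintro _ ⟨x, hx, rfl⟩
  obtain ⟨y, hy, rfl⟩ := hk hx
  rwa [h.right_inv y (circ_subset_carpet j hy)]

/-- A homeomorphism of the carpet permutes the peripheral circles. -/
lemma HomeoPair.exists_perm [OddBase p] {F G : ℂ → ℂ} (h : HomeoPair p F G) :
    ∃ σ : Equiv.Perm (Option (List (Digit p))), ∀ i, F '' circ i = circ (σ i) := by
  choose s hs using h.exists_image_circ_eq
  choose t ht using h.symm.exists_image_circ_eq
  have key : ∀ {F G : ℂ → ℂ} (_ : HomeoPair p F G) {s t : Option (List (Digit p)) → _}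
      (_ : ∀ i, F '' circ i = circ (s i)) (_ : ∀ i, G '' circ i = circ (t i)) i,
      t (s i) = i := by
    intro F G h s t hs ht i
    refine (eq_of_circ_subset ?_).symm
    rw [← ht, ← hs]
    intro x hx
    exact ⟨F x, ⟨x, hx, rfl⟩, h.left_inv x (circ_subset_carpet i hx)⟩
  exact ⟨⟨s, t, key h hs ht, key h.symm ht hs⟩, hs⟩

/-! ### Oscillation, packing and energy -/

/-- The oscillation of a real function on a set. -/
def osc (u : ℂ → ℝ) (A : Set ℂ) : ℝ := diam (u '' A)

lemma osc_nonneg (u : ℂ → ℝ) (A : Set ℂ) : 0 ≤ osc u A := diam_nonneg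

lemma osc_le {u : ℂ → ℝ} {A : Set ℂ} {c : ℝ} (hc : 0 ≤ c)
    (h : ∀ z ∈ A, ∀ z' ∈ A, |u z - u z'| ≤ c) : osc u A ≤ c := by
  refine diam_le_of_forall_dist_le hc ?_
  rintro _ ⟨z, hz, rfl⟩ _ ⟨z', hz', rfl⟩
  exact h z hz z' hz'

lemma osc_comp (u : ℂ → ℝ) (F : ℂ → ℂ) (A : Set ℂ) : osc (fun z => u (F z)) A = osc u (F '' A) := by
  unfold osc
  rw [image_image]

/-- Functions with values in `[0, 1]` on the carpet. -/
def UnitValued (p : ℕ) (u : ℂ → ℝ) : Prop := ∀ z ∈ sierpinskiCarpet p, u z ∈ Icc (0 : ℝ) 1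

lemma UnitValued.isBounded {u : ℂ → ℝ} (hu : UnitValued p u) {A : Set ℂ}
    (hA : A ⊆ sierpinskiCarpet p) : Bornology.IsBounded (u '' A) :=
  (isBounded_Icc 0 1).subset (by rintro _ ⟨z, hz, rfl⟩; exact hu z (hA hz))

lemma UnitValued.abs_sub_le_osc {u : ℂ → ℝ} (hu : UnitValued p u) {A : Set ℂ}
    (hA : A ⊆ sierpinskiCarpet p) {z z' : ℂ} (hz : z ∈ A) (hz' : z' ∈ A) :
    |u z - u z'| ≤ osc u A :=
  dist_le_diam_of_mem (hu.isBounded hA) ⟨z, hz, rfl⟩ ⟨z', hz', rfl⟩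

lemma UnitValued.osc_mono {u : ℂ → ℝ} (hu : UnitValued p u) {A B : Set ℂ} (h : A ⊆ B)
    (hB : B ⊆ sierpinskiCarpet p) : osc u A ≤ osc u B :=
  diam_mono (image_mono h) (hu.isBounded hB)

/-- The open ball of the carpet. -/
def cball (p : ℕ) (x : ℂ) (r : ℝ) : Set ℂ := {z ∈ sierpinskiCarpet p | dist z x < r}

lemma cball_subset (x : ℂ) (r : ℝ) : cball p x r ⊆ sierpinskiCarpet p := fun _ hz => hz.1

/-- A finite family of pairwise disjoint carpet balls. -/
structure BallFamily (p : ℕ) {ι : Type} (s : Finset ι) (x : ι → ℂ) (r : ι → ℝ) : Prop where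
  mem : ∀ j ∈ s, x j ∈ sierpinskiCarpet p
  pos : ∀ j ∈ s, 0 < r j
  disjoint : ∀ i ∈ s, ∀ j ∈ s, i ≠ j → Disjoint (cball p (x i) (r i)) (cball p (x j) (r j))

/-- The squared oscillations of `u` on concentric enlargements of disjoint balls have
uniformly bounded sums. -/
def Packing (p : ℕ) (u : ℂ → ℝ) : Prop :=
  ∀ l : ℝ, ∃ K : ℝ, ∀ (ι : Type) (s : Finset ι) (x : ι → ℂ) (r : ι → ℝ), BallFamily p s x r →
    ∑ j ∈ s, osc u (cball p (x j) (l * r j)) ^ 2 ≤ K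

/-- Admissible functions on the carpet. -/
structure Adm (p : ℕ) (u : ℂ → ℝ) : Prop where
  unit : UnitValued p u
  packing : Packing p u
  summable : Summable fun i : Option (List (Digit p)) => osc u (circ i) ^ 2

/-- The total squared oscillation over the peripheral circles. -/
def energy (p : ℕ) (u : ℂ → ℝ) : ℝ := ∑' i : Option (List (Digit p)), osc u (circ i) ^ 2

lemma energy_nonneg (u : ℂ → ℝ) : 0 ≤ energy p u := tsum_nonneg fun _ => sq_nonneg _

lemma UnitValued.osc_le_of_comb {u v W : ℂ → ℝ} {c : ℝ} (hu : UnitValued p u)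
    (hv : UnitValued p v) (hc : 0 ≤ c)
    (h : ∀ z ∈ sierpinskiCarpet p, ∀ z' ∈ sierpinskiCarpet p,
      |W z - W z'| ≤ c * (|u z - u z'| + |v z - v z'|)) {A : Set ℂ}
    (hA : A ⊆ sierpinskiCarpet p) : osc W A ^ 2 ≤ 2 * c ^ 2 * (osc u A ^ 2 + osc v A ^ 2) := by
  have h1 : osc W A ≤ c * (osc u A + osc v A) := by
    refine osc_le (mul_nonneg hc (add_nonneg (osc_nonneg _ _) (osc_nonneg _ _))) ?_
    intro z hz z' hz'
    refine (h z (hA hz) z' (hA hz')).trans (mul_le_mul_of_nonneg_left ?_ hc)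
    exact add_le_add (hu.abs_sub_le_osc hA hz hz') (hv.abs_sub_le_osc hA hz hz')
  calc osc W A ^ 2 ≤ (c * (osc u A + osc v A)) ^ 2 := pow_le_pow_left₀ (osc_nonneg _ _) h1 2
    _ = c ^ 2 * (osc u A + osc v A) ^ 2 := by ring
    _ ≤ c ^ 2 * (2 * (osc u A ^ 2 + osc v A ^ 2)) :=
        mul_le_mul_of_nonneg_left (by nlinarith [sq_nonneg (osc u A - osc v A)]) (sq_nonneg c)
    _ = _ := by ring

lemma packing_of_comb {u v W : ℂ → ℝ} {c : ℝ} (hu : UnitValued p u) (hv : UnitValued p v)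
    (hpu : Packing p u) (hpv : Packing p v) (hc : 0 ≤ c)
    (h : ∀ z ∈ sierpinskiCarpet p, ∀ z' ∈ sierpinskiCarpet p,
      |W z - W z'| ≤ c * (|u z - u z'| + |v z - v z'|)) : Packing p W := by
  intro l
  obtain ⟨K, hK⟩ := hpu l
  obtain ⟨K', hK'⟩ := hpv l
  refine ⟨2 * c ^ 2 * (K + K'), fun ι s x r hs => ?_⟩
  refine (Finset.sum_le_sum fun j _ =>
    hu.osc_le_of_comb hv hc h (cball_subset (x j) (l * r j))).trans ?_
  rw [← Finset.mul_sum, Finset.sum_add_distrib]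
  exact mul_le_mul_of_nonneg_left (add_le_add (hK ι s x r hs) (hK' ι s x r hs)) (by positivity)

/-- Functions controlled by two admissible functions are admissible. -/
lemma Adm.comb [OddBase p] {u v W : ℂ → ℝ} {c : ℝ} (hu : Adm p u) (hv : Adm p v)
    (hW : UnitValued p W) (hc : 0 ≤ c)
    (h : ∀ z ∈ sierpinskiCarpet p, ∀ z' ∈ sierpinskiCarpet p,
      |W z - W z'| ≤ c * (|u z - u z'| + |v z - v z'|)) : Adm p W where
  unit := hW
  packing := packing_of_comb hu.unit hv.unit hu.packing hv.packing hc h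
  summable := Summable.of_nonneg_of_le (fun _ => sq_nonneg _)
    (fun i => hu.unit.osc_le_of_comb hv.unit hc h (circ_subset_carpet i))
    ((hu.summable.add hv.summable).mul_left _)

/-! ### Quasisymmetric invariance -/

/-- A quasisymmetric homeomorphism of the carpet. -/
structure QSPair (p : ℕ) (F G : ℂ → ℂ) : Prop extends HomeoPair p F G where
  qs : ∃ η : ℝ → ℝ, MonotoneOn η (Ici 0) ∧ ∀ x ∈ sierpinskiCarpet p, ∀ z ∈ sierpinskiCarpet p,
    ∀ w ∈ sierpinskiCarpet p, x ≠ w →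
      dist (F x) (F z) ≤ η (dist x z / dist x w) * dist (F x) (F w)

lemma QSPair.exists_radius {F G : ℂ → ℂ} (h : QSPair p F G) (l : ℝ) :
    ∃ l' : ℝ, ∀ x ∈ sierpinskiCarpet p, ∀ r > 0, ∃ r' > 0,
      MapsTo G (cball p (F x) r') (cball p x r) ∧
      MapsTo F (cball p x (l * r)) (cball p (F x) (l' * r')) := by
  obtain ⟨η, hη, hqs⟩ := h.qs
  refine ⟨|η l| + 1, fun x hx r hr => ?_⟩
  have hl' : 1 ≤ |η l| + 1 := by linarith [abs_nonneg (η l)]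
  set B : Set ℂ := {w ∈ sierpinskiCarpet p | r ≤ dist w x}
  have hB : IsCompact B := isCompact_carpet.inter_right
    (isClosed_le continuous_const (continuous_id.dist continuous_const))
  rcases B.eq_empty_or_nonempty with hBe | hBn
  · refine ⟨3, by norm_num, fun z hz => ⟨h.mapsTo' hz.1, ?_⟩, fun z hz => ⟨h.mapsTo hz.1, ?_⟩⟩
    · by_contra hcon
      have : G z ∈ B := ⟨h.mapsTo' hz.1, not_lt.1 hcon⟩
      simp [hBe] at this
    · have := dist_le_two (carpet_subset_unitSq (h.mapsTo hz.1)) (carpet_subset_unitSq (h.mapsTo hx))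
      nlinarith
  · obtain ⟨w, hw, hmin⟩ := hB.exists_isMinOn hBn
      (f := fun w => dist (F w) (F x))
      (fun w hw => (h.cont w hw.1 |>.mono fun _ hw => hw.1).dist continuousWithinAt_const)
    have hwx : x ≠ w := by
      rintro rfl
      have := hw.2
      rw [dist_self] at this
      linarith
    have hpos : 0 < dist (F w) (F x) := dist_pos.2 fun he => hwx (by
      rw [← h.left_inv x hx, ← he, h.left_inv w hw.1])
    refine ⟨dist (F w) (F x), hpos, fun z hz => ⟨h.mapsTo' hz.1, ?_⟩,
      fun z hz => ⟨h.mapsTo hz.1, ?_⟩⟩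
    · by_contra hcon
      have h1 : dist (F w) (F x) ≤ dist (F (G z)) (F x) :=
        hmin (show G z ∈ B from ⟨h.mapsTo' hz.1, not_lt.1 hcon⟩)
      rw [h.right_inv z hz.1] at h1
      exact absurd hz.2 (not_lt.2 h1)
    · have hxw : 0 < dist x w := dist_pos.2 hwx
      have hle : dist x z / dist x w ≤ l := by
        rw [div_le_iff₀ hxw]
        have h1 : r ≤ dist x w := by rw [dist_comm]; exact hw.2
        have h2 := hz.2
        rw [dist_comm] at h2
        have h3 : 0 < l := by
          by_contra hcon
          have := @dist_nonneg _ _ x z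
          nlinarith
        nlinarith
      have h0 : 0 ≤ dist x z / dist x w := by positivity
      have h1 := hqs x hx z hz.1 w hw.1 hwx
      have h2 := hη h0 (h0.trans hle : (0 : ℝ) ≤ l) hle
      rw [dist_comm (F z), dist_comm (F w)]
      rw [dist_comm (F w)] at hpos
      have h3 := le_abs_self (η l)
      nlinarith

lemma QSPair.packing {F G : ℂ → ℂ} (h : QSPair p F G) {u : ℂ → ℝ} (hu : UnitValued p u)
    (hp : Packing p u) : Packing p (fun z => u (F z)) := by
  intro l
  obtain ⟨l', hl'⟩ := h.exists_radius l
  obtain ⟨K, hK⟩ := hp l'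
  refine ⟨K, fun ι s x r hs => ?_⟩
  choose! R hRpos hRG hRF using hl'
  refine le_trans (Finset.sum_le_sum fun j hj => ?_)
    (hK ι s (fun j => F (x j)) (fun j => R (x j) (r j)) ⟨?_, ?_, ?_⟩)
  · refine pow_le_pow_left₀ (osc_nonneg _ _) ?_ 2
    rw [osc_comp]
    exact hu.osc_mono (hRF _ (hs.mem j hj) _ (hs.pos j hj)).image_subset (cball_subset _ _)
  · exact fun j hj => h.mapsTo (hs.mem j hj)
  · exact fun j hj => hRpos _ (hs.mem j hj) _ (hs.pos j hj)
  · refine fun i hi j hj hij => disjoint_left.2 fun z hz hz' => ?_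
    exact disjoint_left.1 (hs.disjoint i hi j hj hij) (hRG _ (hs.mem i hi) _ (hs.pos i hi) hz)
      (hRG _ (hs.mem j hj) _ (hs.pos j hj) hz')

lemma QSPair.adm [OddBase p] {F G : ℂ → ℂ} (h : QSPair p F G) {u : ℂ → ℝ} (hu : Adm p u) :
    Adm p (fun z => u (F z)) ∧ energy p (fun z => u (F z)) = energy p u := by
  obtain ⟨σ, hσ⟩ := h.exists_perm
  have key : ∀ i, osc (fun z => u (F z)) (circ i) ^ 2 = osc u (circ (σ i)) ^ 2 := fun i => by
    rw [osc_comp, hσ]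
  refine ⟨⟨fun z hz => hu.unit _ (h.mapsTo hz), h.packing hu.unit hu.packing, ?_⟩, ?_⟩
  · simp_rw [key]
    exact (σ.summable_iff (f := fun i => osc u (circ i) ^ 2)).2 hu.summable
  · unfold energy
    simp_rw [key]
    exact σ.tsum_eq (fun i => osc u (circ i) ^ 2)

/-! ### Lipschitz functions -/

lemma card_digit_lt [OddBase p] : Fintype.card (Digit p) < p ^ 2 := by
  have hm : mid p < p := by have := two_mid_add_one (p := p); omega
  have := Fintype.card_subtype_lt (x := ((⟨mid p, hm⟩, ⟨mid p, hm⟩) : Fin p × Fin p))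
    (p := fun d => ¬((d.1 : ℕ) = mid p ∧ (d.2 : ℕ) = mid p)) (by simp)
  rwa [Fintype.card_prod, Fintype.card_fin, ← sq] at this

lemma summable_words [OddBase p] :
    Summable fun v : List (Digit p) => (1 / (p : ℝ) ^ v.length) ^ 2 := by
  rw [← (List.equivSigmaTuple (α := Digit p)).symm.summable_iff]
  have hp : (0 : ℝ) < p := base_pos
  rw [summable_sigma_of_nonneg (fun _ => by simp only [Function.comp]; positivity)]
  refine ⟨fun n => Summable.of_finite, ?_⟩
  have hr : (Fintype.card (Digit p) : ℝ) / p ^ 2 < 1 := by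
    rw [div_lt_one (by positivity)]
    exact_mod_cast card_digit_lt
  convert summable_geometric_of_lt_one (by positivity) hr using 2 with n
  rw [tsum_fintype]
  simp only [List.equivSigmaTuple, Equiv.coe_fn_symm_mk, Function.comp, List.length_ofFn]
  rw [Finset.sum_const, Finset.card_univ, Fintype.card_fun, Fintype.card_fin, nsmul_eq_mul]
  push_cast
  rw [div_pow, div_pow, one_pow, mul_one_div, ← pow_mul, ← pow_mul, mul_comm n]

lemma sum_radius_sq_le {ι : Type} {s : Finset ι} {x : ι → ℂ} {r : ι → ℝ}
    (hs : BallFamily p s x r) : ∑ j ∈ s, (min (r j) 2) ^ 2 ≤ 64 := by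
  set R : ι → ℝ := fun j => min (r j) 2 / 2 with hR
  have hRpos : ∀ j ∈ s, 0 < R j := fun j hj => half_pos (lt_min (hs.pos j hj) two_pos)
  have hdisj : (s : Set ι).PairwiseDisjoint fun j => ball (x j) (R j) := by
    have key : ∀ i ∈ s, ∀ j ∈ s, i ≠ j → R j ≤ R i → Disjoint (ball (x i) (R i)) (ball (x j) (R j)) := by
      intro i hi j hj hij hle
      refine disjoint_left.2 fun z hz hz' => ?_
      rw [mem_ball] at hz hz'
      have h1 : dist (x j) (x i) < r i := by
        have := dist_triangle_left (x j) (x i) z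
        have h2 : 2 * R i ≤ r i := by simp only [hR]; linarith [min_le_left (r i) 2]
        linarith
      exact disjoint_left.1 (hs.disjoint i hi j hj hij) ⟨hs.mem j hj, h1⟩
        ⟨hs.mem j hj, by rw [dist_self]; exact hs.pos j hj⟩
    intro i hi j hj hij
    rcases le_total (R j) (R i) with h | h
    · exact key i hi j hj hij h
    · exact (key j hj i hi hij.symm h).symm
  have hsub : (⋃ j ∈ s, ball (x j) (R j)) ⊆ ball (0 : ℂ) 4 := by
    refine iUnion₂_subset fun j hj => ball_subset_ball' ?_
    have h1 := dist_le_two (carpet_subset_unitSq (hs.mem j hj))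
      (show (0 : ℂ) ∈ unitSq by simp [unitSq])
    have h2 : R j ≤ 1 := by simp only [hR]; linarith [min_le_right (r j) 2]
    linarith
  have hvol := MeasureTheory.measure_mono (μ := MeasureTheory.volume) hsub
  rw [MeasureTheory.measure_biUnion_finset hdisj fun _ _ => measurableSet_ball] at hvol
  simp only [Complex.volume_ball] at hvol
  rw [← Finset.sum_mul] at hvol
  have hpi : (NNReal.pi : ENNReal) ≠ 0 := by simpa using NNReal.pi_ne_zero
  rw [ENNReal.mul_le_mul_iff_left hpi ENNReal.coe_ne_top] at hvol
  simp_rw [← ENNReal.ofReal_pow (show (0 : ℝ) ≤ 4 by norm_num)] at hvol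
  rw [Finset.sum_congr rfl fun j hj => (ENNReal.ofReal_pow (hRpos j hj).le 2).symm,
    ← ENNReal.ofReal_sum_of_nonneg fun j _ => sq_nonneg _,
    ENNReal.ofReal_le_ofReal_iff (by norm_num)] at hvol
  have : ∑ j ∈ s, (min (r j) 2) ^ 2 = 4 * ∑ j ∈ s, R j ^ 2 := by
    rw [Finset.mul_sum]
    exact Finset.sum_congr rfl fun j _ => by simp only [hR]; ring
  rw [this]
  linarith

lemma diam_circ_some_le [OddBase p] (v : List (Digit p)) {z z' : ℂ} (hz : z ∈ circ (some v))
    (hz' : z' ∈ circ (some v)) : dist z z' ≤ 2 * (1 / (p : ℝ) ^ v.length) := by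
  obtain ⟨y, hy, rfl⟩ := hz
  obtain ⟨y', hy', rfl⟩ := hz'
  rw [dist_wordMap, mul_one_div]
  have := base_pos (p := p)
  gcongr
  exact dist_le_two (middleSquare_subset_unitSq hy) (middleSquare_subset_unitSq hy')

lemma summable_option {α : Type*} {f : Option α → ℝ} (h : Summable fun a => f (some a)) :
    Summable f := by
  refine ((Equiv.optionEquivSumPUnit.{0} α).symm.summable_iff).1 ?_
  have h2 : Summable fun a : PUnit.{1} => f ((Equiv.optionEquivSumPUnit α).symm (Sum.inr a)) :=
    Summable.of_finite
  exact (HasSum.sum (f := f ∘ (Equiv.optionEquivSumPUnit.{0} α).symm) (a := ∑' a, f (some a))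
    (by simpa [Function.comp_def] using h.hasSum) h2.hasSum).summable

lemma adm_of_lipschitz [OddBase p] {φ : ℂ → ℝ} {L : ℝ} (hφ : UnitValued p φ) (hL : 0 ≤ L)
    (h : ∀ z z', |φ z - φ z'| ≤ L * dist z z') : Adm p φ where
  unit := hφ
  packing := by
    intro l
    refine ⟨(2 * L * (|l| + 1)) ^ 2 * 64, fun ι s x r hs => ?_⟩
    refine le_trans ?_ (mul_le_mul_of_nonneg_left (sum_radius_sq_le hs) (sq_nonneg _))
    rw [Finset.mul_sum]
    refine Finset.sum_le_sum fun j hj => ?_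
    rw [← mul_pow]
    have hr := hs.pos j hj
    have hm : 0 < min (r j) 2 := lt_min hr two_pos
    refine pow_le_pow_left₀ (osc_nonneg _ _) (osc_le (by positivity) fun z hz z' hz' => ?_) 2
    refine (h z z').trans ?_
    have hl := abs_nonneg l
    have hd : dist z z' ≤ 2 * (|l| + 1) * min (r j) 2 := by
      rcases le_total (r j) 2 with hc | hc
      · rw [min_eq_left hc]
        have h1 := dist_triangle_right z z' (x j)
        have h2 := hz.2
        have h3 := hz'.2
        have h4 := le_abs_self l
        nlinarith
      · rw [min_eq_right hc]
        have := dist_le_two (carpet_subset_unitSq hz.1) (carpet_subset_unitSq hz'.1)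
        linarith
    nlinarith
  summable := by
    have hsome : Summable fun v : List (Digit p) => osc φ (circ (some v)) ^ 2 := by
      refine Summable.of_nonneg_of_le (fun _ => sq_nonneg _) (fun v => ?_)
        (summable_words.mul_left ((2 * L) ^ 2))
      have := base_pos (p := p)
      rw [← mul_pow]
      refine pow_le_pow_left₀ (osc_nonneg _ _) (osc_le (by positivity) fun z hz z' hz' => ?_) 2
      refine (h z z').trans ?_
      have := diam_circ_some_le v hz hz'
      nlinarith
    exact summable_option hsome

/-! ### Words of a given length -/

/-- The words of length `n`. -/
def words (p : ℕ) : ℕ → Finset (List (Digit p))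
  | 0 => {[]}
  | n + 1 => (Finset.univ ×ˢ words p n).map
      ⟨fun x : Digit p × List (Digit p) => x.1 :: x.2, fun x y h => by
        rw [List.cons.injEq] at h
        exact Prod.ext h.1 h.2⟩

lemma mem_words {n : ℕ} {w : List (Digit p)} : w ∈ words p n ↔ w.length = n := by
  induction n generalizing w with
  | zero => simp [words]
  | succ n ih =>
    cases w with
    | nil => simp [words]
    | cons d w =>
      rw [words, Finset.mem_map, List.length_cons, Nat.succ_inj, ← ih]
      constructor
      · rintro ⟨⟨d', w'⟩, hx, h⟩
        obtain ⟨rfl, rfl⟩ := List.cons.inj h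
        exact (Finset.mem_product.1 hx).2
      · exact fun hw => ⟨(d, w), Finset.mem_product.2 ⟨Finset.mem_univ _, hw⟩, rfl⟩

lemma sum_words_succ (n : ℕ) (f : List (Digit p) → ℝ) :
    ∑ w ∈ words p (n + 1), f w = ∑ d : Digit p, ∑ w ∈ words p n, f (d :: w) := by
  rw [words, Finset.sum_map, Finset.sum_product]
  rfl

lemma card_words (n : ℕ) : (words p n).card = Fintype.card (Digit p) ^ n := by
  induction n with
  | zero => simp [words]
  | succ n ih =>
    rw [words, Finset.card_map, Finset.card_product, ih, pow_succ', Finset.card_univ]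

lemma sum_words_le_tsum {f : List (Digit p) → ℝ} (hf : ∀ w, 0 ≤ f w) (hs : Summable f) (n : ℕ) :
    ∑ k ∈ Finset.range n, ∑ w ∈ words p k, f w ≤ ∑' w, f w := by
  rw [← Finset.sum_biUnion]
  · exact hs.sum_le_tsum _ fun w _ => hf w
  · intro k _ l _ hkl
    refine Finset.disjoint_left.2 fun w hw hw' => hkl ?_
    rw [← mem_words.1 hw, mem_words.1 hw']

/-! ### Row sums -/

/-- The sum of `h` over the `n`-th level heights `k / p ^ n`. -/
def rowSum (p : ℕ) : ℕ → (ℝ → ℝ) → ℝ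
  | 0, h => h 0
  | n + 1, h => ∑ j : Fin p, rowSum p n fun t => h ((t + (j : ℕ)) / p)

lemma height_mem [OddBase p] {t : ℝ} (ht : t ∈ Icc (0 : ℝ) 1) (j : Fin p) :
    (t + (j : ℕ)) / p ∈ Icc (0 : ℝ) 1 := by
  have hp : (0 : ℝ) < p := base_pos
  have hj : ((j : ℕ) : ℝ) + 1 ≤ p := by exact_mod_cast j.2
  exact ⟨div_nonneg (add_nonneg ht.1 (Nat.cast_nonneg _)) hp.le,
    (div_le_one hp).2 (by linarith [ht.2])⟩

lemma rowSum_mono [OddBase p] (n : ℕ) {h g : ℝ → ℝ} (hg : ∀ t ∈ Icc (0 : ℝ) 1, h t ≤ g t) :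
    rowSum p n h ≤ rowSum p n g := by
  induction n generalizing h g with
  | zero => exact hg 0 (by simp)
  | succ n ih => exact Finset.sum_le_sum fun j _ => ih fun t ht => hg _ (height_mem ht j)

lemma rowSum_const (n : ℕ) (c : ℝ) : rowSum p n (fun _ => c) = p ^ n * c := by
  induction n with
  | zero => simp [rowSum]
  | succ n ih => simp [rowSum, ih, pow_succ']; ring

lemma rowSum_sum {α : Type*} (n : ℕ) (s : Finset α) (f : α → ℝ → ℝ) :
    rowSum p n (fun t => ∑ a ∈ s, f a t) = ∑ a ∈ s, rowSum p n (f a) := by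
  induction n generalizing f with
  | zero => rfl
  | succ n ih =>
    simp only [rowSum]
    rw [Finset.sum_comm]
    exact Finset.sum_congr rfl fun j _ => ih _

/-- The increment of `v` along the horizontal segment at height `t`. -/
def incr (v : ℂ → ℝ) (t : ℝ) : ℝ := |v ⟨1, t⟩ - v ⟨0, t⟩|

/-- The increment of `v` over the position `d`, bounded by the oscillation over the middle
square when `d` is the middle position. -/
def cellIncr (p : ℕ) (v : ℂ → ℝ) (d : Fin p × Fin p) (t : ℝ) : ℝ :=
  if h : (d.1 : ℕ) = mid p ∧ (d.2 : ℕ) = mid p then osc v (middleSquare p)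
  else incr (fun z => v (sub ⟨d, h⟩ z)) t

lemma cellIncr_nonneg (v : ℂ → ℝ) (d : Fin p × Fin p) (t : ℝ) : 0 ≤ cellIncr p v d t := by
  unfold cellIncr incr
  split_ifs
  exacts [osc_nonneg _ _, abs_nonneg _]

lemma abs_sub_le_cellIncr [OddBase p] {v : ℂ → ℝ} (hv : UnitValued p v) (i j : Fin p) {t : ℝ}
    (ht : t ∈ Icc (0 : ℝ) 1) :
    |v ⟨((i : ℕ) + 1) / p, (t + (j : ℕ)) / p⟩ - v ⟨(i : ℕ) / p, (t + (j : ℕ)) / p⟩| ≤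
      cellIncr p v (i, j) t := by
  have hp : (0 : ℝ) < p := base_pos
  unfold cellIncr
  split_ifs with h
  · obtain ⟨hi, hj⟩ := h
    simp only at hi hj
    rw [hi, hj]
    have h1 : (mid p : ℝ) / p ≤ (mid p + 1 : ℝ) / p := by gcongr; linarith
    have h2 : (mid p : ℝ) / p ≤ (t + mid p) / p := by gcongr; linarith [ht.1]
    have h3 : (t + mid p) / p ≤ (mid p + 1 : ℝ) / p := by
      rw [div_le_div_iff_of_pos_right hp]; linarith [ht.2]
    exact hv.abs_sub_le_osc middleSquare_subset_carpet
      (mem_middleSquare.2 ⟨⟨h1, le_rfl⟩, ⟨h2, h3⟩, Or.inr (Or.inl rfl)⟩)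
      (mem_middleSquare.2 ⟨⟨le_rfl, h1⟩, ⟨h2, h3⟩, Or.inl rfl⟩)
  · unfold incr
    apply le_of_eq
    congr 3
    · apply Complex.ext <;> simp [add_comm]
    · apply Complex.ext <;> simp

lemma incr_le_sum_cellIncr [OddBase p] {v : ℂ → ℝ} (hv : UnitValued p v) (j : Fin p) {t : ℝ}
    (ht : t ∈ Icc (0 : ℝ) 1) : incr v ((t + (j : ℕ)) / p) ≤ ∑ i : Fin p, cellIncr p v (i, j) t := by
  have hp : (0 : ℝ) < p := base_pos
  refine le_trans ?_ (Finset.sum_le_sum fun i _ => abs_sub_le_cellIncr hv i j ht)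
  have := dist_le_range_sum_dist (fun i : ℕ => v ⟨(i : ℝ) / p, (t + (j : ℕ)) / p⟩) p
  simp only [Nat.cast_zero, zero_div, div_self hp.ne', Real.dist_eq] at this
  rw [Finset.sum_range] at this
  unfold incr
  rw [abs_sub_comm]
  refine this.trans_eq (Finset.sum_congr rfl fun i _ => ?_)
  rw [abs_sub_comm]
  push_cast
  rfl

lemma sum_rowSum_cellIncr [OddBase p] (n : ℕ) (v : ℂ → ℝ) :
    ∑ d, rowSum p n (cellIncr p v d) =
      p ^ n * osc v (middleSquare p) + ∑ d : Digit p, rowSum p n (incr fun z => v (sub d z)) := by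
  have hm : mid p < p := by have := two_mid_add_one (p := p); omega
  rw [← Fintype.sum_subtype_add_sum_subtype
    (fun d : Fin p × Fin p => (d.1 : ℕ) = mid p ∧ (d.2 : ℕ) = mid p)]
  congr 1
  · rw [Fintype.sum_eq_single ⟨(⟨mid p, hm⟩, ⟨mid p, hm⟩), rfl, rfl⟩]
    · rw [← rowSum_const]
      congr 1
      funext t
      simp [cellIncr]
    · rintro ⟨⟨i, j⟩, hi, hj⟩ h
      exact absurd (Subtype.ext (Prod.ext (Fin.ext hi) (Fin.ext hj))) h
  · refine Finset.sum_congr rfl fun d _ => ?_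
    congr 1
    funext t
    simp only [cellIncr]
    rw [dif_neg d.2]

lemma UnitValued.comp_sub [OddBase p] {v : ℂ → ℝ} (hv : UnitValued p v) (d : Digit p) :
    UnitValued p fun z => v (sub d z) := fun _ hz => hv _ (sub_mem_carpet d hz)

lemma rowSum_incr_le [OddBase p] (n : ℕ) {v : ℂ → ℝ} (hv : UnitValued p v) :
    rowSum p n (incr v) ≤
      ∑ k ∈ Finset.range n, ∑ w ∈ words p k, (p : ℝ) ^ n / p ^ (k + 1) * osc v (circ (some w)) +
        ∑ w ∈ words p n, osc v (wordMap w '' sierpinskiCarpet p) := by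
  have hp : (0 : ℝ) < p := base_pos
  induction n generalizing v with
  | zero =>
    have h0 : (⟨0, 0⟩ : ℂ) ∈ outerSquare := mem_outerSquare.2 ⟨by simp [unitSq], by simp⟩
    have h1 : (⟨1, 0⟩ : ℂ) ∈ outerSquare := mem_outerSquare.2 ⟨by simp [unitSq], by simp⟩
    simp only [rowSum, incr, words, Finset.range_zero, Finset.sum_empty, Finset.sum_singleton,
      zero_add]
    refine hv.abs_sub_le_osc (image_subset_iff.2 fun z hz => hz) ?_ ?_
    · exact ⟨_, outerSquare_subset_carpet h1, rfl⟩
    · exact ⟨_, outerSquare_subset_carpet h0, rfl⟩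
  | succ n ih =>
    have step : rowSum p (n + 1) (incr v) ≤ ∑ d, rowSum p n (cellIncr p v d) := by
      rw [Fintype.sum_prod_type_right]
      refine Finset.sum_le_sum fun j _ => ?_
      rw [← rowSum_sum]
      exact rowSum_mono n fun t ht => incr_le_sum_cellIncr hv j ht
    rw [sum_rowSum_cellIncr] at step
    refine step.trans ?_
    rw [Finset.sum_range_succ', sum_words_succ]
    have hd : ∑ d : Digit p, rowSum p n (incr fun z => v (sub d z)) ≤ _ :=
      Finset.sum_le_sum fun d _ => ih (hv.comp_sub d)
    rw [Finset.sum_add_distrib, Finset.sum_comm] at hd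
    have e0 : ∑ w ∈ words p 0, (p : ℝ) ^ (n + 1) / p ^ (0 + 1) * osc v (circ (some w)) =
        p ^ n * osc v (middleSquare p) := by
      have : circ (some ([] : List (Digit p))) = middleSquare p := by simp [circ, wordMap]
      simp only [words, Finset.sum_singleton, this]
      rw [pow_succ, zero_add, pow_one, mul_div_cancel_right₀ _ hp.ne']
    have e1 : ∀ k, ∑ w ∈ words p (k + 1), (p : ℝ) ^ (n + 1) / p ^ (k + 1 + 1) *
        osc v (circ (some w)) = ∑ d : Digit p, ∑ w ∈ words p k,
          (p : ℝ) ^ n / p ^ (k + 1) * osc (fun z => v (sub d z)) (circ (some w)) := fun k => by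
      rw [sum_words_succ]
      refine Finset.sum_congr rfl fun d _ => Finset.sum_congr rfl fun w _ => ?_
      rw [osc_comp v (sub d), circ, circ, ← wordMap_cons_image, pow_succ (p : ℝ) n,
        pow_succ (p : ℝ) (k + 1), mul_div_mul_right _ _ hp.ne']
    have e2 : ∀ d : Digit p, ∑ w ∈ words p n, osc v (wordMap (d :: w) '' sierpinskiCarpet p) =
        ∑ w ∈ words p n, osc (fun z => v (sub d z)) (wordMap w '' sierpinskiCarpet p) := fun d =>
      Finset.sum_congr rfl fun w _ => by rw [osc_comp v (sub d), wordMap_cons_image]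
    rw [e0]
    simp_rw [e1, e2]
    linarith

/-! ### Uniform bounds for cells -/

lemma abs_re_sub_le_dist (z a : ℂ) : |z.re - a.re| ≤ dist z a := by
  rw [Complex.dist_eq]
  exact Complex.abs_re_le_norm (z - a)

lemma abs_im_sub_le_dist (z a : ℂ) : |z.im - a.im| ≤ dist z a := by
  rw [Complex.dist_eq]
  exact Complex.abs_im_le_norm (z - a)

lemma midCorner_mem_openSq [OddBase p] : midCorner p ∈ openSq :=
  middleSquare_subset_openSq midCorner_mem

lemma mem_openSq_of_dist_midCorner [OddBase p] {y : ℂ} (hy : dist y (midCorner p) < 1 / p) :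
    y ∈ openSq := by
  have hp : (0 : ℝ) < p := base_pos
  have h1 : |y.re - mid p / p| < 1 / p := (abs_re_sub_le_dist y (midCorner p)).trans_lt hy
  have h2 : |y.im - mid p / p| < 1 / p := (abs_im_sub_le_dist y (midCorner p)).trans_lt hy
  have h3 : (1 : ℝ) / p ≤ mid p / p := by gcongr; exact one_le_mid_real
  have h4 : (mid p : ℝ) / p + 1 / p < 1 := by rw [← add_div]; exact mid_add_one_div_lt
  rw [abs_lt] at h1 h2
  exact ⟨⟨by linarith, by linarith⟩, ⟨by linarith, by linarith⟩⟩

lemma exists_wordMap_eq_of_dist [OddBase p] (w : List (Digit p)) (z : ℂ) :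
    ∃ y, wordMap w y = z := by
  have hp : ((p : ℂ) ^ w.length) ≠ 0 := pow_ne_zero _ (by exact_mod_cast (base_pos (p := p)).ne')
  exact ⟨(z - corner w) * p ^ w.length, by rw [wordMap_eq]; field_simp; ring⟩

lemma ballFamily_cells [OddBase p] (n : ℕ) :
    BallFamily p (words p n) (fun w => wordMap w (midCorner p)) (fun _ => 1 / p / (p : ℝ) ^ n) where
  mem w _ := wordMap_mem_carpet w (middleSquare_subset_carpet midCorner_mem)
  pos _ _ := by have := base_pos (p := p); positivity
  disjoint w hw v hv hne := by
    have hp : (0 : ℝ) < p := base_pos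
    have key : ∀ u ∈ words p n, ∀ z ∈ cball p (wordMap u (midCorner p)) (1 / p / (p : ℝ) ^ n),
        ∃ y ∈ openSq, wordMap u y = z := by
      rintro u hu z ⟨-, hz⟩
      obtain ⟨y, rfl⟩ := exists_wordMap_eq_of_dist u z
      rw [dist_wordMap, mem_words.1 hu, div_lt_div_iff_of_pos_right (by positivity)] at hz
      exact ⟨y, mem_openSq_of_dist_midCorner hz, rfl⟩
    refine disjoint_left.2 fun z hz hz' => ?_
    obtain ⟨y, hy, rfl⟩ := key w hw z hz
    obtain ⟨y', hy', h⟩ := key v hv _ hz'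
    exact (separated_cells ((mem_words.1 hw).trans (mem_words.1 hv).symm) hne).notMem_openSq hy
      ⟨y', openSq_subset_unitSq hy', h⟩

lemma Packing.sum_cells_le [OddBase p] {u : ℂ → ℝ} (hu : UnitValued p u) (h : Packing p u) :
    ∃ K, 0 ≤ K ∧ ∀ n, ∑ w ∈ words p n, osc u (wordMap w '' sierpinskiCarpet p) ^ 2 ≤ K := by
  have hp : (0 : ℝ) < p := base_pos
  obtain ⟨K, hK⟩ := h (3 * p)
  refine ⟨K, ?_, fun n => ?_⟩
  · exact (Finset.sum_nonneg fun _ _ => sq_nonneg _).trans (hK _ _ _ _ (ballFamily_cells 0))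
  · refine le_trans (Finset.sum_le_sum fun w hw => ?_) (hK _ _ _ _ (ballFamily_cells n))
    refine pow_le_pow_left₀ (osc_nonneg _ _) (hu.osc_mono ?_ (cball_subset _ _)) 2
    rintro _ ⟨y, hy, rfl⟩
    refine ⟨wordMap_mem_carpet w hy, ?_⟩
    rw [dist_wordMap, mem_words.1 hw]
    have h1 := dist_le_two (carpet_subset_unitSq hy)
      (openSq_subset_unitSq (midCorner_mem_openSq (p := p)))
    have h2 : 3 * (p : ℝ) * (1 / p / p ^ n) = 3 / p ^ n := by field_simp
    rw [h2]
    gcongr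
    linarith

/-! ### The minimal energy -/

/-- Admissible functions vanishing on `A` and equal to one on `B`. -/
structure Joins (p : ℕ) (A B : Set ℂ) (u : ℂ → ℝ) : Prop extends Adm p u where
  zero : ∀ z ∈ A, u z = 0
  one : ∀ z ∈ B, u z = 1

lemma Joins.one_sub [OddBase p] {A B : Set ℂ} {u : ℂ → ℝ} (h : Joins p A B u) :
    Joins p B A (fun z => 1 - u z) ∧ energy p (fun z => 1 - u z) = energy p u := by
  have hadm : Adm p fun z => 1 - u z := h.toAdm.comb h.toAdm (c := 1)
    (fun z hz => ⟨by linarith [(h.unit z hz).2], by linarith [(h.unit z hz).1]⟩) zero_le_one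
    (fun z _ z' _ => by
      rw [show 1 - u z - (1 - u z') = -(u z - u z') by ring, abs_neg]
      linarith [abs_nonneg (u z - u z')])
  have hosc : ∀ A, osc (fun z => 1 - u z) A = osc u A := fun A => by
    unfold osc
    rw [← image_image (fun x => 1 - x) u A]
    exact (IsometryEquiv.subLeft (1 : ℝ)).isometry.diam_image _
  refine ⟨⟨hadm, fun z hz => by rw [h.one z hz, sub_self], fun z hz => by
    rw [h.zero z hz, sub_zero]⟩, ?_⟩
  simp only [energy, hosc]

/-- The least energy of an admissible function joining the middle square to the outer square. -/
def minEnergy (p : ℕ) : ℝ := sInf (energy p '' {u | Joins p (middleSquare p) outerSquare u})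

lemma minEnergy_le {u : ℂ → ℝ} (hu : Joins p (middleSquare p) outerSquare u) :
    minEnergy p ≤ energy p u :=
  csInf_le ⟨0, by rintro _ ⟨v, -, rfl⟩; exact energy_nonneg v⟩ ⟨u, hu, rfl⟩

/-- The truncated rescaled distance to a set. -/
def bump (L : ℝ) (A : Set ℂ) (z : ℂ) : ℝ := min 1 (L * infDist z A)

lemma adm_bump [OddBase p] {L : ℝ} (hL : 0 ≤ L) (A : Set ℂ) : Adm p (bump L A) := by
  refine adm_of_lipschitz (L := L) (fun z _ => ⟨le_min zero_le_one
    (mul_nonneg hL infDist_nonneg), min_le_left _ _⟩) hL fun z z' => ?_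
  unfold bump
  refine (abs_min_sub_min_le_max _ _ _ _).trans ?_
  rw [sub_self, abs_zero, ← mul_sub, abs_mul, abs_of_nonneg hL]
  refine max_le (mul_nonneg hL dist_nonneg) (mul_le_mul_of_nonneg_left ?_ hL)
  exact (lipschitz_infDist_pt A).dist_le_mul z z' |>.trans (by simp)

lemma bump_of_mem {L : ℝ} {A : Set ℂ} {z : ℂ} (hz : z ∈ A) : bump L A z = 0 := by
  simp [bump, infDist_zero_of_mem hz]

lemma bump_eq_one {L : ℝ} {A : Set ℂ} (hL : 0 < L) (hA : A.Nonempty) {z : ℂ}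
    (h : ∀ a ∈ A, 1 / L ≤ dist z a) : bump L A z = 1 := by
  refine min_eq_left ?_
  have := (le_infDist hA (x := z)).2 fun {a} ha => h a ha
  rw [div_le_iff₀ hL] at this
  linarith

lemma exists_joins [OddBase p] : ∃ u, Joins p (middleSquare p) outerSquare u := by
  have hp : (0 : ℝ) < p := base_pos
  refine ⟨bump p (middleSquare p), adm_bump hp.le _, fun z hz => bump_of_mem hz, fun z hz => ?_⟩
  refine bump_eq_one hp ⟨_, midCorner_mem⟩ fun a ha => ?_
  have h1 := mem_middleSquare.1 ha
  have h3 : (1 : ℝ) / p ≤ mid p / p := by gcongr; exact one_le_mid_real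
  have h4 : (mid p + 1 : ℝ) / p + 1 / p ≤ 1 := by
    rw [← add_div, div_le_one hp, base_eq (p := p)]
    linarith [one_le_mid_real (p := p)]
  have hre := abs_re_sub_le_dist z a
  have him := abs_im_sub_le_dist z a
  rw [abs_le] at hre him
  obtain ⟨⟨h5, h6⟩, ⟨h7, h8⟩, -⟩ := h1
  rcases (mem_outerSquare.1 hz).2 with h | h | h | h <;> linarith

lemma exists_energy_lt [OddBase p] {ε : ℝ} (hε : 0 < ε) :
    ∃ u, Joins p (middleSquare p) outerSquare u ∧ energy p u < minEnergy p + ε := by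
  obtain ⟨u, hu⟩ := exists_joins (p := p)
  obtain ⟨_, ⟨v, hv, rfl⟩, h⟩ := Real.lt_sInf_add_pos (s := energy p ''
    {u | Joins p (middleSquare p) outerSquare u}) ⟨_, u, hu, rfl⟩ hε
  exact ⟨v, hv, h⟩

lemma Joins.pow_le_sum [OddBase p] {u : ℂ → ℝ} (hu : Joins p (middleSquare p) outerSquare u)
    (n : ℕ) : (p : ℝ) ^ n ≤ ∑ d : Digit p, rowSum p n (incr fun z => u (sub d z)) := by
  have hp : (0 : ℝ) < p := base_pos
  have hm : mid p < p := by have := two_mid_add_one (p := p); omega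
  have h0 : osc u (middleSquare p) = 0 := le_antisymm (osc_le le_rfl fun z hz z' hz' => by
    rw [hu.zero z hz, hu.zero z' hz', sub_self, abs_zero]) (osc_nonneg _ _)
  have h1 := sum_rowSum_cellIncr (p := p) n u
  rw [h0, mul_zero, zero_add] at h1
  rw [← h1, ← mul_one ((p : ℝ) ^ n), ← rowSum_const, ← rowSum_sum]
  refine rowSum_mono n fun t ht => ?_
  set j : Fin p := ⟨mid p, hm⟩ with hj
  have h2 : (1 : ℝ) ≤ ∑ i : Fin p, cellIncr p u (i, j) t := by
    refine le_trans ?_ (Finset.sum_le_sum fun i _ => abs_sub_le_cellIncr hu.unit i j ht)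
    have h3 := dist_le_Ico_sum_dist (fun i : ℕ => u ⟨(i : ℝ) / p, (t + (j : ℕ)) / p⟩)
      (Nat.succ_le_of_lt hm)
    have h4 : u ⟨(p : ℝ) / p, (t + (j : ℕ)) / p⟩ = 1 := by
      rw [div_self hp.ne']
      exact hu.one _ (mem_outerSquare.2 ⟨⟨by simp, height_mem ht j⟩, by simp⟩)
    have h5 : u ⟨((mid p + 1 : ℕ) : ℝ) / p, (t + (j : ℕ)) / p⟩ = 0 := by
      refine hu.zero _ (mem_middleSquare.2 ?_)
      push_cast
      simp only [hj]
      exact ⟨⟨by gcongr; linarith, le_rfl⟩, ⟨by gcongr; linarith [ht.1],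
        by rw [div_le_div_iff_of_pos_right hp]; linarith [ht.2]⟩, Or.inr (Or.inl trivial)⟩
    simp only [Nat.succ_eq_add_one, h4, h5, Real.dist_eq] at h3
    rw [zero_sub, abs_neg, abs_one] at h3
    refine h3.trans ?_
    rw [Finset.sum_fin_eq_sum_range]
    refine (Finset.sum_le_sum_of_subset_of_nonneg (t := Finset.range p) (fun i hi => by
      rw [Finset.mem_Ico] at hi; rw [Finset.mem_range]; exact hi.2)
      fun _ _ _ => abs_nonneg _).trans_eq (Finset.sum_congr rfl fun i hi => ?_)
    rw [dif_pos (Finset.mem_range.1 hi), abs_sub_comm]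
    push_cast
    rfl
  refine h2.trans ?_
  rw [Fintype.sum_prod_type_right]
  exact Finset.single_le_sum (f := fun j => ∑ i : Fin p, cellIncr p u (i, j) t)
    (fun j _ => Finset.sum_nonneg fun i _ => cellIncr_nonneg _ _ _) (Finset.mem_univ j)

lemma Joins.one_le_sum [OddBase p] {u : ℂ → ℝ} (hu : Joins p (middleSquare p) outerSquare u)
    (n : ℕ) : 1 ≤ ∑ k ∈ Finset.range (n + 1), ∑ w ∈ words p k,
        1 / (p : ℝ) ^ k * osc u (circ (some w)) +
      ∑ w ∈ words p (n + 1), 1 / (p : ℝ) ^ n * osc u (wordMap w '' sierpinskiCarpet p) := by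
  have hp : (0 : ℝ) < p := base_pos
  have h := (hu.pow_le_sum n).trans
    (Finset.sum_le_sum fun d _ => rowSum_incr_le n (hu.unit.comp_sub d))
  have h0 : osc u (middleSquare p) = 0 := le_antisymm (osc_le le_rfl fun z hz z' hz' => by
    rw [hu.zero z hz, hu.zero z' hz', sub_self, abs_zero]) (osc_nonneg _ _)
  rw [Finset.sum_add_distrib, Finset.sum_comm] at h
  rw [Finset.sum_range_succ', sum_words_succ]
  have e0 : ∑ w ∈ words p 0, 1 / (p : ℝ) ^ 0 * osc u (circ (some w)) = 0 := by
    have : circ (some ([] : List (Digit p))) = middleSquare p := by simp [circ, wordMap]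
    simp only [words, Finset.sum_singleton, this, h0, mul_zero]
  have e1 : ∀ k, ∑ d : Digit p, ∑ w ∈ words p k,
      (p : ℝ) ^ n / p ^ (k + 1) * osc (fun z => u (sub d z)) (circ (some w)) =
      p ^ n * ∑ w ∈ words p (k + 1), 1 / (p : ℝ) ^ (k + 1) * osc u (circ (some w)) := fun k => by
    rw [sum_words_succ, Finset.mul_sum]
    refine Finset.sum_congr rfl fun d _ => ?_
    rw [Finset.mul_sum]
    refine Finset.sum_congr rfl fun w _ => ?_
    rw [osc_comp u (sub d), circ, circ, ← wordMap_cons_image]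
    field_simp
  have e2 : ∀ d : Digit p, ∑ w ∈ words p n,
      osc (fun z => u (sub d z)) (wordMap w '' sierpinskiCarpet p) =
      p ^ n * ∑ w ∈ words p n, 1 / (p : ℝ) ^ n * osc u (wordMap (d :: w) '' sierpinskiCarpet p) :=
    fun d => by
      rw [Finset.mul_sum]
      refine Finset.sum_congr rfl fun w _ => ?_
      rw [osc_comp u (sub d), ← wordMap_cons_image]
      field_simp
  rw [e0, add_zero]
  simp_rw [e1, e2, ← Finset.mul_sum, ← mul_add] at h
  simp_rw [← Finset.mul_sum]
  exact le_of_mul_le_mul_left (by simpa using h) (by positivity : (0 : ℝ) < p ^ n)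

lemma mul_le_weighted {a b c : ℝ} (hc : 0 < c) : a * b ≤ 1 / (4 * c) * a ^ 2 + c * b ^ 2 := by
  have h : 1 / (4 * c) * a ^ 2 + c * b ^ 2 - a * b = 1 / (4 * c) * (a - 2 * c * b) ^ 2 := by
    field_simp; ring
  have : 0 ≤ 1 / (4 * c) * (a - 2 * c * b) ^ 2 := by positivity
  linarith

lemma tsum_some_le_energy {u : ℂ → ℝ} (hu : Adm p u) :
    ∑' w : List (Digit p), osc u (circ (some w)) ^ 2 ≤ energy p u :=
  tsum_comp_le_tsum_of_inj hu.summable (fun _ => sq_nonneg _) (Option.some_injective _)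

lemma Joins.energy_ge [OddBase p] {u : ℂ → ℝ} (hu : Joins p (middleSquare p) outerSquare u) :
    1 / (4 * ∑' v : List (Digit p), (1 / (p : ℝ) ^ v.length) ^ 2) ≤ energy p u := by
  have hp : (0 : ℝ) < p := base_pos
  set Z := ∑' v : List (Digit p), (1 / (p : ℝ) ^ v.length) ^ 2 with hZ
  have hZpos : 0 < Z := summable_words.tsum_pos (fun _ => sq_nonneg _) [] (by simp)
  obtain ⟨K, hK0, hK⟩ := hu.packing.sum_cells_le hu.unit
  set c : ℝ := 1 / (4 * (K + 1)) with hc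
  have hcpos : 0 < c := by positivity
  have hsome : Summable fun w : List (Digit p) => osc u (circ (some w)) ^ 2 :=
    hu.summable.comp_injective (Option.some_injective _)
  have hlim : Filter.Tendsto (fun n : ℕ => (Fintype.card (Digit p) * (1 / (4 * c))) *
      ((Fintype.card (Digit p) : ℝ) / p ^ 2) ^ n) Filter.atTop (nhds 0) := by
    have := (tendsto_pow_atTop_nhds_zero_of_lt_one
      (r := (Fintype.card (Digit p) : ℝ) / p ^ 2) (by positivity) (by
        rw [div_lt_one (by positivity)]; exact_mod_cast card_digit_lt)).const_mul
      (Fintype.card (Digit p) * (1 / (4 * c)))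
    simpa using this
  obtain ⟨n, hn⟩ := (hlim.eventually (gt_mem_nhds (show (0 : ℝ) < 1 / 4 by norm_num))).exists
  have h1 : ∑ k ∈ Finset.range (n + 1), ∑ w ∈ words p k,
      1 / (p : ℝ) ^ k * osc u (circ (some w)) ≤ 1 / 4 + Z * energy p u := by
    have hs : Summable fun w : List (Digit p) => 1 / (4 * Z) * (1 / (p : ℝ) ^ w.length) ^ 2 +
        Z * osc u (circ (some w)) ^ 2 := (summable_words.mul_left _).add (hsome.mul_left _)
    refine le_trans (Finset.sum_le_sum fun k _ => Finset.sum_le_sum fun w hw => ?_)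
      ((sum_words_le_tsum (fun w => by positivity) hs (n + 1)).trans ?_)
    · rw [← mem_words.1 hw]
      exact mul_le_weighted hZpos
    · rw [(summable_words.mul_left _).tsum_add (hsome.mul_left _), tsum_mul_left, tsum_mul_left]
      refine add_le_add (le_of_eq ?_) (mul_le_mul_of_nonneg_left
        (tsum_some_le_energy hu.toAdm) hZpos.le)
      rw [← hZ]
      field_simp
  have h2 : ∑ w ∈ words p (n + 1), 1 / (p : ℝ) ^ n * osc u (wordMap w '' sierpinskiCarpet p) ≤
      1 / 4 + 1 / 4 := by
    refine le_trans (Finset.sum_le_sum fun w _ => mul_le_weighted hcpos) ?_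
    rw [Finset.sum_add_distrib, Finset.sum_const, card_words, ← Finset.mul_sum, nsmul_eq_mul]
    refine add_le_add ?_ ?_
    · refine le_trans (le_of_eq ?_) hn.le
      push_cast
      rw [div_pow, div_pow, one_pow, pow_succ, ← pow_mul, ← pow_mul, mul_comm 2 n]
      ring
    · refine (mul_le_mul_of_nonneg_left (hK (n + 1)) hcpos.le).trans ?_
      rw [hc, div_mul_eq_mul_div, one_mul, div_le_div_iff₀ (by positivity) (by norm_num)]
      linarith
  have h3 := hu.one_le_sum n
  rw [div_le_iff₀ (by positivity)]
  linarith

lemma minEnergy_pos [OddBase p] : 0 < minEnergy p := by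
  have hZpos : 0 < ∑' v : List (Digit p), (1 / (p : ℝ) ^ v.length) ^ 2 :=
    summable_words.tsum_pos (fun _ => sq_nonneg _) [] (by simp)
  obtain ⟨u, hu⟩ := exists_joins (p := p)
  refine lt_of_lt_of_le (one_div_pos.2 (mul_pos four_pos hZpos)) (le_csInf ⟨_, u, hu, rfl⟩ ?_)
  rintro _ ⟨v, hv, rfl⟩
  exact Joins.energy_ge hv

/-! ### Reflections -/

/-- Reflection of the unit interval when `b` is true. -/
def flip (b : Bool) (s : ℝ) : ℝ := if b then 1 - s else s

lemma flip_flip (b c : Bool) (s : ℝ) : flip b (flip c s) = flip (b ^^ c) s := by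
  cases b <;> cases c <;> simp [flip]

lemma flip_sub_sq (b : Bool) (s s' : ℝ) : (flip b s - flip b s') ^ 2 = (s - s') ^ 2 := by
  cases b <;> simp [flip]; ring

lemma flip_mem_Icc {b : Bool} {s : ℝ} (hs : s ∈ Icc (0 : ℝ) 1) : flip b s ∈ Icc (0 : ℝ) 1 := by
  cases b
  · simpa [flip] using hs
  · exact ⟨by simp [flip, hs.2], by simp [flip, hs.1]⟩

/-- The reflections of the unit square in its axes of symmetry parallel to the sides. -/
def refl (g : Bool × Bool) (z : ℂ) : ℂ := ⟨flip g.1 z.re, flip g.2 z.im⟩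

lemma refl_refl (g h : Bool × Bool) (z : ℂ) : refl g (refl h z) = refl (g.1 ^^ h.1, g.2 ^^ h.2) z := by
  simp [refl, flip_flip]

lemma refl_self (g : Bool × Bool) (z : ℂ) : refl g (refl g z) = z := by
  obtain ⟨a, b⟩ := g
  cases a <;> cases b <;> simp [refl, flip]

lemma dist_refl (g : Bool × Bool) (z z' : ℂ) : dist (refl g z) (refl g z') = dist z z' := by
  rw [Complex.dist_eq_re_im, Complex.dist_eq_re_im]
  simp only [refl, flip_sub_sq]

lemma refl_mem_unitSq {g : Bool × Bool} {z : ℂ} (hz : z ∈ unitSq) : refl g z ∈ unitSq :=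
  ⟨flip_mem_Icc hz.1, flip_mem_Icc hz.2⟩

lemma exists_flip_digit [OddBase p] (b : Bool) (i : Fin p) :
    ∃ i' : Fin p, ((i' : ℕ) = mid p ↔ (i : ℕ) = mid p) ∧
      ∀ s : ℝ, flip b ((s + (i : ℕ)) / p) = (flip b s + (i' : ℕ)) / p := by
  have hp : (0 : ℝ) < p := base_pos
  cases b
  · exact ⟨i, Iff.rfl, fun s => by simp [flip]⟩
  · refine ⟨i.rev, ?_, fun s => ?_⟩
    · have := two_mid_add_one (p := p)
      rw [Fin.val_rev]
      omega
    · have h : ((i.rev : ℕ) : ℝ) = p - ((i : ℕ) + 1) := by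
        rw [Fin.val_rev, Nat.cast_sub i.2]
        push_cast
        ring
      simp only [flip, if_true]
      rw [h]
      field_simp
      ring

lemma exists_refl_sub [OddBase p] (g : Bool × Bool) (d : Digit p) :
    ∃ d' : Digit p, ∀ z, refl g (sub d z) = sub d' (refl g z) := by
  obtain ⟨i, hi, hi'⟩ := exists_flip_digit g.1 d.1.1
  obtain ⟨j, hj, hj'⟩ := exists_flip_digit g.2 d.1.2
  refine ⟨⟨(i, j), fun h => d.2 ⟨hi.1 h.1, hj.1 h.2⟩⟩, fun z => ?_⟩
  apply Complex.ext
  · simp [refl, hi']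
  · simp [refl, hj']

lemma refl_mem_carpet [OddBase p] (g : Bool × Bool) {z : ℂ} (hz : z ∈ sierpinskiCarpet p) :
    refl g z ∈ sierpinskiCarpet p := by
  refine mem_carpet.2 fun n => ?_
  have key : ∀ n, ∀ z ∈ carpetApprox p n, refl g z ∈ carpetApprox p n := by
    intro n
    induction n with
    | zero => exact fun z hz => refl_mem_unitSq hz
    | succ n ih =>
      intro z hz
      obtain ⟨d, y, hy, rfl⟩ := mem_carpetApprox_succ.1 hz
      obtain ⟨d', hd'⟩ := exists_refl_sub g d
      exact mem_carpetApprox_succ.2 ⟨d', refl g y, ih y hy, (hd' y).symm⟩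
  exact key n z (mem_carpet.1 hz n)

lemma qsPair_refl [OddBase p] (g : Bool × Bool) : QSPair p (refl g) (refl g) where
  mapsTo _ hz := refl_mem_carpet g hz
  mapsTo' _ hz := refl_mem_carpet g hz
  left_inv z _ := refl_self g z
  right_inv z _ := refl_self g z
  cont := (Isometry.of_dist_eq (dist_refl g)).continuous.continuousOn
  cont' := (Isometry.of_dist_eq (dist_refl g)).continuous.continuousOn
  qs := ⟨id, monotoneOn_id, fun x _ z _ w _ hxw => by
    rw [dist_refl, dist_refl, id, div_mul_cancel₀ _ (dist_pos.2 hxw).ne']⟩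

lemma refl_mem_outerSquare (g : Bool × Bool) {z : ℂ} (hz : z ∈ outerSquare) :
    refl g z ∈ outerSquare := by
  obtain ⟨h1, h2⟩ := mem_outerSquare.1 hz
  refine mem_outerSquare.2 ⟨refl_mem_unitSq h1, ?_⟩
  obtain ⟨a, b⟩ := g
  rcases h2 with h | h | h | h <;> cases a <;> cases b <;> simp [refl, flip, h]

lemma flip_mid [OddBase p] (b : Bool) {s : ℝ} (h1 : (mid p : ℝ) / p ≤ s)
    (h2 : s ≤ (mid p + 1 : ℝ) / p) : (mid p : ℝ) / p ≤ flip b s ∧ flip b s ≤ (mid p + 1 : ℝ) / p ∧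
      ((s = (mid p : ℝ) / p ∨ s = (mid p + 1 : ℝ) / p) →
        flip b s = (mid p : ℝ) / p ∨ flip b s = (mid p + 1 : ℝ) / p) := by
  have hp : (0 : ℝ) < p := base_pos
  have h3 : (mid p + 1 : ℝ) / p = 1 - mid p / p := by
    rw [eq_sub_iff_add_eq, ← add_div, div_eq_one_iff_eq hp.ne', base_eq (p := p)]
    ring
  cases b
  · simpa [flip] using ⟨h1, h2⟩
  · rw [h3] at h2 ⊢
    simp only [flip, if_true]
    exact ⟨by linarith, by linarith, fun h => h.symm.imp (fun h => by linarith)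
      fun h => by linarith⟩

lemma refl_mem_middleSquare [OddBase p] (g : Bool × Bool) {z : ℂ} (hz : z ∈ middleSquare p) :
    refl g z ∈ middleSquare p := by
  obtain ⟨⟨h1, h2⟩, ⟨h3, h4⟩, h5⟩ := mem_middleSquare.1 hz
  obtain ⟨a1, a2, a3⟩ := flip_mid g.1 h1 h2
  obtain ⟨b1, b2, b3⟩ := flip_mid g.2 h3 h4
  refine mem_middleSquare.2 ⟨⟨a1, a2⟩, ⟨b1, b2⟩, ?_⟩
  simp only [refl]
  tauto

/-! ### Symmetrization -/

lemma Joins.avg [OddBase p] {A B : Set ℂ} {u v : ℂ → ℝ} (hu : Joins p A B u)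
    (hv : Joins p A B v) : Joins p A B (fun z => (u z + v z) / 2) ∧
      energy p (fun z => (u z + v z) / 2) ≤ (energy p u + energy p v) / 2 := by
  have hadm : Adm p fun z => (u z + v z) / 2 := hu.toAdm.comb hv.toAdm (c := 1)
    (fun z hz => ⟨by linarith [(hu.unit z hz).1, (hv.unit z hz).1],
      by linarith [(hu.unit z hz).2, (hv.unit z hz).2]⟩) zero_le_one fun z _ z' _ => by
      have h1 := abs_le.1 (le_refl |u z - u z'|)
      have h2 := abs_le.1 (le_refl |v z - v z'|)
      rw [one_mul]
      exact abs_le.2 ⟨by linarith, by linarith⟩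
  refine ⟨⟨hadm, fun z hz => by rw [hu.zero z hz, hv.zero z hz]; norm_num,
    fun z hz => by rw [hu.one z hz, hv.one z hz]; norm_num⟩, ?_⟩
  unfold energy
  rw [← hu.summable.tsum_add hv.summable, ← tsum_div_const]
  refine hadm.summable.tsum_le_tsum (fun i => ?_) ((hu.summable.add hv.summable).div_const 2)
  have h1 : osc (fun z => (u z + v z) / 2) (circ i) ≤ (osc u (circ i) + osc v (circ i)) / 2 := by
    refine osc_le (by linarith [osc_nonneg u (circ i), osc_nonneg v (circ i)])
      fun z hz z' hz' => ?_
    have h1 := abs_le.1 (hu.unit.abs_sub_le_osc (circ_subset_carpet i) hz hz')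
    have h2 := abs_le.1 (hv.unit.abs_sub_le_osc (circ_subset_carpet i) hz hz')
    exact abs_le.2 ⟨by linarith, by linarith⟩
  refine (pow_le_pow_left₀ (osc_nonneg _ _) h1 2).trans ?_
  nlinarith [sq_nonneg (osc u (circ i) - osc v (circ i))]

lemma Joins.comp_refl [OddBase p] {u : ℂ → ℝ} (hu : Joins p (middleSquare p) outerSquare u)
    (g : Bool × Bool) : Joins p (middleSquare p) outerSquare (fun z => u (refl g z)) ∧
      energy p (fun z => u (refl g z)) = energy p u :=
  ⟨⟨((qsPair_refl g).adm hu.toAdm).1, fun _ hz => hu.zero _ (refl_mem_middleSquare g hz),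
    fun _ hz => hu.one _ (refl_mem_outerSquare g hz)⟩, ((qsPair_refl g).adm hu.toAdm).2⟩

/-- Invariance under the reflections. -/
def Symm (u : ℂ → ℝ) : Prop := ∀ g z, u (refl g z) = u z

lemma Joins.exists_symm [OddBase p] {u : ℂ → ℝ} (hu : Joins p (middleSquare p) outerSquare u) :
    ∃ v, Joins p (middleSquare p) outerSquare v ∧ energy p v ≤ energy p u ∧ Symm v := by
  have h1 := hu.avg (hu.comp_refl (true, false)).1
  rw [(hu.comp_refl (true, false)).2] at h1
  have h2 := h1.1.avg (h1.1.comp_refl (false, true)).1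
  rw [(h1.1.comp_refl (false, true)).2] at h2
  refine ⟨_, h2.1, by linarith [h1.2, h2.2], ?_⟩
  rintro ⟨a, b⟩ z
  have h0 : ∀ z, refl (false, false) z = z := fun z => by simp [refl, flip]
  simp only [refl_refl]
  cases a <;> cases b <;> simp [h0] <;> ring

/-! ### Truncated oscillation -/

/-- The oscillation of `(u - a)⁺` on `D`. -/
def kap (a : ℝ) (u : ℂ → ℝ) (D : Set ℂ) : ℝ :=
  max (sSup (u '' D) - a) 0 - max (sInf (u '' D) - a) 0

lemma kap_comp (a : ℝ) (u : ℂ → ℝ) (F : ℂ → ℂ) (D : Set ℂ) :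
    kap a (fun z => u (F z)) D = kap a u (F '' D) := by
  unfold kap
  rw [image_image]

lemma UnitValued.osc_eq {u : ℂ → ℝ} (hu : UnitValued p u) {D : Set ℂ}
    (hD : D ⊆ sierpinskiCarpet p) : osc u D = sSup (u '' D) - sInf (u '' D) :=
  Real.diam_eq (hu.isBounded hD)

lemma UnitValued.le_sup {u : ℂ → ℝ} (hu : UnitValued p u) {D : Set ℂ}
    (hD : D ⊆ sierpinskiCarpet p) {z : ℂ} (hz : z ∈ D) : u z ≤ sSup (u '' D) :=
  le_csSup (hu.isBounded hD).bddAbove ⟨z, hz, rfl⟩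

lemma UnitValued.inf_le {u : ℂ → ℝ} (hu : UnitValued p u) {D : Set ℂ}
    (hD : D ⊆ sierpinskiCarpet p) {z : ℂ} (hz : z ∈ D) : sInf (u '' D) ≤ u z :=
  csInf_le (hu.isBounded hD).bddBelow ⟨z, hz, rfl⟩

lemma UnitValued.inf_le_sup {u : ℂ → ℝ} (hu : UnitValued p u) {D : Set ℂ}
    (hD : D ⊆ sierpinskiCarpet p) : sInf (u '' D) ≤ sSup (u '' D) := by
  have h1 := hu.osc_eq hD
  have h2 := osc_nonneg u D
  linarith

lemma UnitValued.kap_nonneg {u : ℂ → ℝ} (hu : UnitValued p u) {D : Set ℂ}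
    (hD : D ⊆ sierpinskiCarpet p) (a : ℝ) : 0 ≤ kap a u D :=
  sub_nonneg.2 (max_le_max_right 0 (sub_le_sub_right (hu.inf_le_sup hD) a))

lemma UnitValued.kap_le_osc {u : ℂ → ℝ} (hu : UnitValued p u) {D : Set ℂ}
    (hD : D ⊆ sierpinskiCarpet p) (a : ℝ) : kap a u D ≤ osc u D := by
  rw [hu.osc_eq hD]
  unfold kap
  have := hu.inf_le_sup hD
  rcases max_cases (sSup (u '' D) - a) 0 with h | h <;>
    rcases max_cases (sInf (u '' D) - a) 0 with h' | h' <;> linarith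

/-- The product weight entering the first variation of the energy. -/
def weight (a : ℝ) (u : ℂ → ℝ) (D : Set ℂ) : ℝ := osc u D * kap a u D

lemma UnitValued.weight_nonneg {u : ℂ → ℝ} (hu : UnitValued p u) {D : Set ℂ}
    (hD : D ⊆ sierpinskiCarpet p) (a : ℝ) : 0 ≤ weight a u D :=
  mul_nonneg (osc_nonneg _ _) (hu.kap_nonneg hD a)

lemma UnitValued.weight_le {u : ℂ → ℝ} (hu : UnitValued p u) {D : Set ℂ}
    (hD : D ⊆ sierpinskiCarpet p) (a : ℝ) : weight a u D ≤ osc u D ^ 2 := by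
  rw [sq]
  exact mul_le_mul_of_nonneg_left (hu.kap_le_osc hD a) (osc_nonneg _ _)

lemma Adm.summable_weight [OddBase p] {u : ℂ → ℝ} (hu : Adm p u) (a : ℝ) :
    Summable fun i : Option (List (Digit p)) => weight a u (circ i) :=
  Summable.of_nonneg_of_le (fun i => hu.unit.weight_nonneg (circ_subset_carpet i) a)
    (fun i => hu.unit.weight_le (circ_subset_carpet i) a) hu.summable

/-- The upper right part of the plane. -/
def farSq : Set ℂ := {z | 1 / 3 ≤ z.re ∧ 1 / 3 ≤ z.im}

lemma exists_flip_digit_ge [OddBase p] (i : Fin p) :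
    ∃ b, ∀ s ∈ Icc (0 : ℝ) 1, 1 / 3 ≤ flip b ((s + (i : ℕ)) / p) := by
  have hp : (0 : ℝ) < p := base_pos
  by_cases h : p ≤ 3 * (i : ℕ)
  · have h' : (p : ℝ) ≤ 3 * (i : ℕ) := by exact_mod_cast h
    refine ⟨false, fun s hs => ?_⟩
    simp only [flip]
    rw [if_neg (by simp), le_div_iff₀ hp]
    linarith [hs.1]
  · have h3 := OddBase.three_le (p := p)
    have h' : 3 * ((i : ℕ) : ℝ) + 3 ≤ 2 * p := by
      have : 3 * (i : ℕ) + 3 ≤ 2 * p := by omega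
      exact_mod_cast this
    refine ⟨true, fun s hs => ?_⟩
    have : (s + (i : ℕ)) / p ≤ 2 / 3 := by
      rw [div_le_iff₀ hp]
      linarith [hs.2]
    simp only [flip, if_true]
    linarith

lemma exists_circ_subset_farSq [OddBase p] {v : List (Digit p)} (hv : v ≠ []) :
    ∃ g, MapsTo (refl g) (circ (some v)) farSq := by
  obtain ⟨d, v, rfl⟩ := List.exists_cons_of_ne_nil hv
  obtain ⟨a, ha⟩ := exists_flip_digit_ge d.1.1
  obtain ⟨b, hb⟩ := exists_flip_digit_ge d.1.2
  refine ⟨(a, b), ?_⟩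
  rintro _ ⟨y, hy, rfl⟩
  have h := wordMap_mem_unitSq v (middleSquare_subset_unitSq hy)
  refine ⟨?_, ?_⟩
  · simpa [refl, wordMap] using ha _ h.1
  · simpa [refl, wordMap] using hb _ h.2

open Classical in
/-- The indicator of the circles contained in a reflected copy of `farSq`. -/
def farInd (g : Bool × Bool) (i : Option (List (Digit p))) : ℝ :=
  if MapsTo (refl g) (circ i) farSq then 1 else 0

lemma farInd_nonneg (g : Bool × Bool) (i : Option (List (Digit p))) : 0 ≤ farInd g i := by
  unfold farInd; split_ifs <;> simp

lemma farInd_le_one (g : Bool × Bool) (i : Option (List (Digit p))) : farInd g i ≤ 1 := by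
  unfold farInd; split_ifs <;> simp

lemma Joins.osc_middle {u : ℂ → ℝ} {A B : Set ℂ} (hu : Joins p A B u) : osc u A = 0 :=
  le_antisymm (osc_le le_rfl fun z hz z' hz' => by
    rw [hu.zero z hz, hu.zero z' hz', sub_self, abs_zero]) (osc_nonneg _ _)

lemma Joins.osc_outer {u : ℂ → ℝ} {A B : Set ℂ} (hu : Joins p A B u) : osc u B = 0 :=
  le_antisymm (osc_le le_rfl fun z hz z' hz' => by
    rw [hu.one z hz, hu.one z' hz', sub_self, abs_zero]) (osc_nonneg _ _)

lemma Adm.summable_farInd [OddBase p] {u : ℂ → ℝ} (hu : Adm p u) (a : ℝ) (g : Bool × Bool) :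
    Summable fun i : Option (List (Digit p)) => farInd g i * weight a u (circ i) := by
  have hw : ∀ i : Option (List (Digit p)), 0 ≤ weight a u (circ i) := fun i =>
    hu.unit.weight_nonneg (circ_subset_carpet i) a
  exact Summable.of_nonneg_of_le (fun i => mul_nonneg (farInd_nonneg g i) (hw i))
    (fun i => mul_le_of_le_one_left (hw i) (farInd_le_one g i)) (hu.summable_weight a)

lemma Symm.tsum_farInd_eq [OddBase p] {u : ℂ → ℝ} (hs : Symm u) (a : ℝ) (g h : Bool × Bool) :
    ∑' i : Option (List (Digit p)), farInd g i * weight a u (circ i) =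
      ∑' i : Option (List (Digit p)), farInd h i * weight a u (circ i) := by
  set k : Bool × Bool := (g.1 ^^ h.1, g.2 ^^ h.2)
  obtain ⟨σ, hσ⟩ := (qsPair_refl (p := p) k).exists_perm
  rw [← σ.tsum_eq (fun i => farInd g i * weight a u (circ i))]
  refine tsum_congr fun i => ?_
  have h1 : weight a u (circ (σ i)) = weight a u (circ i) := by
    rw [← hσ]
    unfold weight
    rw [← osc_comp, ← kap_comp]
    have : (fun z => u (refl k z)) = u := funext fun z => hs k z
    rw [this]
  have h2 : farInd g (σ i) = farInd h i := by
    unfold farInd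
    congr 1
    rw [← hσ, mapsTo_image_iff]
    have : refl g ∘ refl k = refl h := funext fun z => by
      simp [k, refl_refl]
    rw [this]
  rw [h1, h2]

lemma Joins.tsum_weight_le [OddBase p] {u : ℂ → ℝ}
    (hu : Joins p (middleSquare p) outerSquare u) (hs : Symm u) (a : ℝ) (g : Bool × Bool) :
    ∑' i : Option (List (Digit p)), weight a u (circ i) ≤
      4 * ∑' i : Option (List (Digit p)), farInd g i * weight a u (circ i) := by
  have h4 : 4 * ∑' i : Option (List (Digit p)), farInd g i * weight a u (circ i) =
      ∑' i : Option (List (Digit p)), ∑ h : Bool × Bool, farInd h i * weight a u (circ i) := by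
    rw [Summable.tsum_finsetSum fun h _ => hu.summable_farInd a h]
    simp only [hs.tsum_farInd_eq a _ g]
    simp
  rw [h4]
  refine (hu.summable_weight a).tsum_le_tsum (fun i => ?_)
    (summable_sum fun h _ => hu.summable_farInd a h)
  have hw : 0 ≤ weight a u (circ i) := hu.unit.weight_nonneg (circ_subset_carpet i) a
  have hnn : ∀ h ∈ (Finset.univ : Finset (Bool × Bool)),
      0 ≤ farInd h i * weight a u (circ i) := fun h _ => mul_nonneg (farInd_nonneg h i) hw
  by_cases hi : ∃ h, MapsTo (refl h) (circ i) farSq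
  · obtain ⟨h, hh⟩ := hi
    refine le_trans (le_of_eq ?_) (Finset.single_le_sum hnn (Finset.mem_univ h))
    rw [farInd, if_pos hh, one_mul]
  · have h0 : osc u (circ i) = 0 := by
      cases i with
      | none => exact hu.osc_outer
      | some v =>
        by_cases hv : v = []
        · subst hv
          have : circ (some ([] : List (Digit p))) = middleSquare p := by simp [circ, wordMap]
          rw [this]
          exact hu.osc_middle
        · exact absurd (exists_circ_subset_farSq hv) hi
    rw [weight, h0, zero_mul]
    simp

/-! ### Folding the carpet onto a cell -/

/-- The distance to the even integers. -/
def tent (s : ℝ) : ℝ := infDist s (range fun k : ℤ => (2 * k : ℝ))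

lemma abs_tent_sub_le (s s' : ℝ) : |tent s - tent s'| ≤ |s - s'| := by
  have h1 := infDist_le_infDist_add_dist (s := range fun k : ℤ => (2 * k : ℝ)) (x := s) (y := s')
  have h2 := infDist_le_infDist_add_dist (s := range fun k : ℤ => (2 * k : ℝ)) (x := s') (y := s)
  rw [dist_comm] at h2
  rw [Real.dist_eq] at h1 h2
  unfold tent
  exact abs_sub_le_iff.2 ⟨by linarith, by linarith⟩

lemma tent_eq {s c : ℝ} (m : ℤ) (h : |s - 2 * m| = c) (h' : ∀ k : ℤ, c ≤ |s - 2 * k|) :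
    tent s = c := by
  refine le_antisymm ?_ ((le_infDist ⟨_, mem_range_self 0⟩).2 ?_)
  · rw [← h]
    exact infDist_le_dist_of_mem (mem_range_self m)
  · rintro _ ⟨k, rfl⟩
    exact h' k

lemma exists_tent_add (k : ℤ) : ∃ b, ∀ t ∈ Icc (0 : ℝ) 1, tent (k + t) = flip b t := by
  obtain ⟨m, hm | hm⟩ := Int.even_or_odd' k
  · refine ⟨false, fun t ht => tent_eq m ?_ fun j => ?_⟩
    · simp [hm, flip, abs_of_nonneg ht.1]
    · simp only [hm, flip, Bool.false_eq_true, if_false]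
      push_cast
      rcases le_or_gt j m with h | h
      · have : (j : ℝ) ≤ m := by exact_mod_cast h
        exact le_trans (by linarith) (le_abs_self _)
      · have : (m : ℝ) + 1 ≤ j := by exact_mod_cast h
        exact le_trans (by linarith [ht.2]) (neg_le_abs _)
  · refine ⟨true, fun t ht => tent_eq (m + 1) ?_ fun j => ?_⟩
    · simp only [hm, flip, if_true]
      push_cast
      rw [abs_of_nonpos (by linarith [ht.2])]
      ring
    · simp only [hm, flip, if_true]
      push_cast
      rcases le_or_gt j m with h | h
      · have : (j : ℝ) ≤ m := by exact_mod_cast h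
        exact le_trans (by linarith [ht.1]) (le_abs_self _)
      · have : (m : ℝ) + 1 ≤ j := by exact_mod_cast h
        exact le_trans (by linarith) (neg_le_abs _)

/-- The folding map that unfolds each cell of generation `n` to the unit square. -/
def fold (p n : ℕ) (z : ℂ) : ℂ := ⟨tent ((p : ℝ) ^ n * z.re), tent ((p : ℝ) ^ n * z.im)⟩

lemma dist_fold_le (n : ℕ) (z z' : ℂ) : dist (fold p n z) (fold p n z') ≤ (p : ℝ) ^ n * dist z z' := by
  have hq : (0 : ℝ) ≤ (p : ℝ) ^ n := by positivity
  rw [Complex.dist_eq_re_im, Complex.dist_eq_re_im]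
  refine Real.sqrt_le_iff.2 ⟨by positivity, ?_⟩
  rw [mul_pow, Real.sq_sqrt (by positivity)]
  have key : ∀ s s' : ℝ, (tent ((p : ℝ) ^ n * s) - tent ((p : ℝ) ^ n * s')) ^ 2 ≤
      ((p : ℝ) ^ n) ^ 2 * (s - s') ^ 2 := fun s s' => by
    rw [← mul_pow, mul_sub]
    exact sq_le_sq.2 (abs_tent_sub_le _ _)
  simp only [fold]
  linarith [key z.re z'.re, key z.im z'.im]

lemma exists_corner_int [OddBase p] (w : List (Digit p)) : ∃ k l : ℤ,
    (p : ℝ) ^ w.length * (corner w).re = k ∧ (p : ℝ) ^ w.length * (corner w).im = l := by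
  have hp : (0 : ℝ) < p := base_pos
  induction w with
  | nil => exact ⟨0, 0, by simp [corner, wordMap]⟩
  | cons d w ih =>
    obtain ⟨k, l, hk, hl⟩ := ih
    refine ⟨k + p ^ w.length * (d.1.1 : ℕ), l + p ^ w.length * (d.1.2 : ℕ), ?_, ?_⟩
    · rw [corner, wordMap, sub_re, List.length_cons, pow_succ]
      push_cast
      rw [← hk, corner]
      field_simp
    · rw [corner, wordMap, sub_im, List.length_cons, pow_succ]
      push_cast
      rw [← hl, corner]
      field_simp

lemma exists_fold_eq_refl [OddBase p] (w : List (Digit p)) :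
    ∃ g, ∀ y ∈ unitSq, fold p w.length (wordMap w y) = refl g y := by
  obtain ⟨k, l, hk, hl⟩ := exists_corner_int w
  obtain ⟨a, ha⟩ := exists_tent_add k
  obtain ⟨b, hb⟩ := exists_tent_add l
  have hq : (0 : ℝ) < (p : ℝ) ^ w.length := pow_pos base_pos _
  refine ⟨(a, b), fun y hy => ?_⟩
  unfold fold refl
  rw [wordMap_re, wordMap_im, mul_add, mul_add, hk, hl, mul_div_cancel₀ _ hq.ne',
    mul_div_cancel₀ _ hq.ne', ha _ hy.1, hb _ hy.2]

lemma fold_mem_carpet [OddBase p] (n : ℕ) {z : ℂ} (hz : z ∈ sierpinskiCarpet p) :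
    fold p n z ∈ sierpinskiCarpet p := by
  obtain ⟨w, rfl, y, hy, rfl⟩ := exists_wordMap_eq n hz
  obtain ⟨g, hg⟩ := exists_fold_eq_refl w
  rw [hg y (carpet_subset_unitSq hy)]
  exact refl_mem_carpet g hy

lemma BallFamily.fold [OddBase p] {ι : Type} {s : Finset ι} {x : ι → ℂ} {r : ι → ℝ}
    (hs : BallFamily p s x r) {w : List (Digit p)}
    (hw : ∀ j ∈ s, x j ∈ wordMap w '' sierpinskiCarpet p) :
    BallFamily p s (fun j => fold p w.length (x j)) (fun j => (p : ℝ) ^ w.length * r j) := by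
  have hq : (0 : ℝ) < (p : ℝ) ^ w.length := pow_pos base_pos _
  obtain ⟨g, hg⟩ := exists_fold_eq_refl w
  have key : ∀ j ∈ s, ∀ ζ ∈ cball p (Carpet.fold p w.length (x j)) ((p : ℝ) ^ w.length * r j),
      wordMap w (refl g ζ) ∈ cball p (x j) (r j) := by
    intro j hj ζ hζ
    refine ⟨wordMap_mem_carpet w (refl_mem_carpet g hζ.1), ?_⟩
    obtain ⟨y, hy, hyx⟩ := hw j hj
    have h1 := hζ.2
    rw [← hyx, hg y (carpet_subset_unitSq hy)] at h1
    rw [← hyx, dist_wordMap, div_lt_iff₀ hq]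
    rw [← dist_refl g, refl_self] at h1
    linarith
  exact ⟨fun j hj => fold_mem_carpet _ (hs.mem j hj), fun j hj => mul_pos hq (hs.pos j hj),
    fun i hi j hj hij => disjoint_left.2 fun ζ hζ hζ' =>
      disjoint_left.1 (hs.disjoint i hi j hj hij) (key i hi ζ hζ) (key j hj ζ hζ')⟩

lemma Packing.comp_fold [OddBase p] {u : ℂ → ℝ} (hu : UnitValued p u) (h : Packing p u) (n : ℕ) :
    Packing p fun z => u (fold p n z) := by
  classical
  intro l
  have hq : (0 : ℝ) < (p : ℝ) ^ n := pow_pos base_pos _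
  obtain ⟨K, hK⟩ := h l
  refine ⟨(words p n).card * K, fun ι s x r hs => ?_⟩
  have hc : ∀ j, ∃ w : List (Digit p), w.length = n ∧
      (j ∈ s → x j ∈ wordMap w '' sierpinskiCarpet p) := fun j => by
    by_cases hj : j ∈ s
    · obtain ⟨w, hw, y, hy, hyx⟩ := exists_wordMap_eq n (hs.mem j hj)
      exact ⟨w, hw, fun _ => ⟨y, hy, hyx⟩⟩
    · obtain ⟨w, hw, -⟩ := exists_wordMap_eq n (outerSquare_subset_carpet (p := p)
        (mem_outerSquare.2 ⟨by simp [unitSq], by simp⟩ : (0 : ℂ) ∈ outerSquare))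
      exact ⟨w, hw, fun h => absurd h hj⟩
  choose c hcn hc using hc
  rw [← Finset.sum_fiberwise_of_maps_to (t := words p n) (g := c)
    fun j _ => mem_words.2 (hcn j), ← nsmul_eq_mul]
  refine Finset.sum_le_card_nsmul _ _ _ fun w hw => ?_
  have hwn := mem_words.1 hw
  subst hwn
  have hs' : BallFamily p (s.filter fun j => c j = w) x r :=
    ⟨fun j hj => hs.mem j (Finset.mem_filter.1 hj).1, fun j hj => hs.pos j (Finset.mem_filter.1 hj).1,
      fun i hi j hj => hs.disjoint i (Finset.mem_filter.1 hi).1 j (Finset.mem_filter.1 hj).1⟩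
  refine le_trans (Finset.sum_le_sum fun j hj => ?_) (hK ι _ _ _ (hs'.fold (w := w) fun j hj => ?_))
  · refine pow_le_pow_left₀ (osc_nonneg _ _) ?_ 2
    rw [osc_comp]
    refine hu.osc_mono ?_ (cball_subset _ _)
    rintro _ ⟨z, hz, rfl⟩
    refine ⟨fold_mem_carpet _ hz.1, (dist_fold_le _ _ _).trans_lt ?_⟩
    have := mul_lt_mul_of_pos_left hz.2 hq
    linarith
  · have h2 := hc j (Finset.mem_filter.1 hj).1
    rwa [(Finset.mem_filter.1 hj).2] at h2

/-! ### Transfer of functions to a cell -/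

/-- The inverse of `wordMap w`. -/
def cellInv (w : List (Digit p)) (z : ℂ) : ℂ := (z - corner w) * (p : ℂ) ^ w.length

lemma cellInv_wordMap [OddBase p] (w : List (Digit p)) (z : ℂ) : cellInv w (wordMap w z) = z := by
  have hp : ((p : ℂ) ^ w.length) ≠ 0 := pow_ne_zero _ (by exact_mod_cast (base_pos (p := p)).ne')
  rw [cellInv, wordMap_eq]
  field_simp
  ring

lemma wordMap_cellInv [OddBase p] (w : List (Digit p)) (z : ℂ) : wordMap w (cellInv w z) = z := by
  obtain ⟨y, rfl⟩ := exists_wordMap_eq_of_dist w z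
  rw [cellInv_wordMap]

lemma mem_carpet_of_wordMap_mem_of_mem_unitSq [OddBase p] (w : List (Digit p)) {y : ℂ}
    (hy : y ∈ unitSq) (h : wordMap w y ∈ sierpinskiCarpet p) : y ∈ sierpinskiCarpet p := by
  rcases mem_openSq_or_outerSquare hy with h1 | h1
  · exact mem_carpet_of_wordMap_mem w h1 h
  · exact outerSquare_subset_carpet h1

/-- A segment leaving the closed unit square crosses its boundary. -/
lemma exists_mem_outerSquare_of_path {γ : ℝ → ℂ} (hγ : Continuous γ) (h0 : γ 0 ∈ unitSq)
    (h1 : γ 1 ∉ unitSq) : ∃ s ∈ Icc (0 : ℝ) 1, γ s ∈ outerSquare := by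
  set m : ℂ → ℝ := fun z => max |z.re - 1 / 2| |z.im - 1 / 2| with hm
  have hmem : ∀ z, z ∈ unitSq ↔ m z ≤ 1 / 2 := fun z => by
    simp only [hm, unitSq, mem_ofPred_eq, mem_Icc, max_le_iff, abs_le]
    constructor
    · rintro ⟨⟨a, b⟩, c, d⟩
      exact ⟨⟨by linarith, by linarith⟩, by linarith, by linarith⟩
    · rintro ⟨⟨a, b⟩, c, d⟩
      exact ⟨⟨by linarith, by linarith⟩, by linarith, by linarith⟩
  have hmc : Continuous fun s => m (γ s) := by
    simp only [hm]
    fun_prop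
  obtain ⟨s, hs, he⟩ := intermediate_value_Icc zero_le_one hmc.continuousOn
    ⟨(hmem _).1 h0, (not_le.1 (mt (hmem _).2 h1)).le⟩
  refine ⟨s, hs, ?_⟩
  simpa [hm, outerSquare, squareBoundary] using he

open Classical in
/-- The copy of `u` on the cell of `w`, extended by the constant `1`. -/
def transfer (w : List (Digit p)) (u : ℂ → ℝ) (z : ℂ) : ℝ :=
  if cellInv w z ∈ unitSq then u (cellInv w z) else 1

lemma transfer_wordMap [OddBase p] (w : List (Digit p)) (u : ℂ → ℝ) {y : ℂ} (hy : y ∈ unitSq) :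
    transfer w u (wordMap w y) = u y := by
  rw [transfer, cellInv_wordMap, if_pos hy]

lemma transfer_of_notMem [OddBase p] {w : List (Digit p)} {u : ℂ → ℝ}
    (hu : ∀ z ∈ outerSquare, u z = 1) {z : ℂ} (hz : z ∉ wordMap w '' openSq) :
    transfer w u z = 1 := by
  unfold transfer
  split_ifs with h
  · rcases mem_openSq_or_outerSquare h with h1 | h1
    · exact absurd ⟨_, h1, wordMap_cellInv w z⟩ hz
    · exact hu _ h1
  · rfl

lemma unitValued_transfer [OddBase p] (w : List (Digit p)) {u : ℂ → ℝ} (hu : UnitValued p u) :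
    UnitValued p (transfer w u) := by
  intro z hz
  unfold transfer
  split_ifs with h
  · refine hu _ (mem_carpet_of_wordMap_mem_of_mem_unitSq w h ?_)
    rwa [wordMap_cellInv]
  · exact ⟨zero_le_one, le_rfl⟩

lemma transfer_eq_fold [OddBase p] {w : List (Digit p)} {u : ℂ → ℝ} (hs : Symm u) {z : ℂ}
    (hz : cellInv w z ∈ unitSq) : transfer w u z = u (fold p w.length z) := by
  obtain ⟨g, hg⟩ := exists_fold_eq_refl w
  have := hg _ hz
  rw [wordMap_cellInv] at this
  rw [transfer, if_pos hz, this, hs]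

lemma exists_transfer_eq [OddBase p] {w : List (Digit p)} {u : ℂ → ℝ} (hs : Symm u)
    (hu : ∀ z ∈ outerSquare, u z = 1) {x : ℂ} {r : ℝ} {z z' : ℂ} (hz : z ∈ cball p x r)
    (hz' : z' ∈ cball p x r) (h : cellInv w z ∈ unitSq) :
    ∃ e ∈ cball p x r, transfer w u z' = u (fold p w.length e) := by
  by_cases h' : cellInv w z' ∈ unitSq
  · exact ⟨z', hz', transfer_eq_fold hs h'⟩
  · obtain ⟨s, hs01, he⟩ := exists_mem_outerSquare_of_path
      (γ := fun s : ℝ => cellInv w (AffineMap.lineMap z z' s))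
      (by unfold cellInv; have := AffineMap.lineMap_continuous (R := ℝ) (p := z) (q := z'); fun_prop)
      (by simpa using h) (by simpa using h')
    set e := AffineMap.lineMap (k := ℝ) z z' s with hedef
    have heS : e ∈ sierpinskiCarpet p := by
      rw [← wordMap_cellInv w e]
      exact wordMap_mem_carpet w (outerSquare_subset_carpet he)
    refine ⟨e, ⟨heS, ?_⟩, ?_⟩
    · exact (convex_ball x r).lineMap_mem hz.2 hz'.2 hs01
    · rw [transfer, if_neg h', ← transfer_eq_fold hs (mem_outerSquare.1 he).1, transfer,
        if_pos (mem_outerSquare.1 he).1, hu _ he]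

lemma packing_transfer [OddBase p] (w : List (Digit p)) {u : ℂ → ℝ} (hs : Symm u)
    (hu : UnitValued p u) (h : Packing p u) (h1 : ∀ z ∈ outerSquare, u z = 1) :
    Packing p (transfer w u) := by
  intro l
  obtain ⟨K, hK⟩ := h.comp_fold hu w.length l
  refine ⟨K, fun ι s x r hf => (Finset.sum_le_sum fun j _ => ?_).trans (hK ι s x r hf)⟩
  refine pow_le_pow_left₀ (osc_nonneg _ _) (osc_le (osc_nonneg _ _) fun z hz z' hz' => ?_) 2
  have hV : UnitValued p fun z => u (fold p w.length z) := fun z hz => hu _ (fold_mem_carpet _ hz)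
  by_cases hc : cellInv w z ∈ unitSq ∨ cellInv w z' ∈ unitSq
  · have key : ∀ z'' ∈ cball p (x j) (l * r j), ∃ e ∈ cball p (x j) (l * r j),
        transfer w u z'' = u (fold p w.length e) := fun z'' hz'' => by
      rcases hc with hc | hc
      · exact exists_transfer_eq hs h1 hz hz'' hc
      · exact exists_transfer_eq hs h1 hz' hz'' hc
    obtain ⟨e, he, h2⟩ := key z hz
    obtain ⟨e', he', h3⟩ := key z' hz'
    rw [h2, h3]
    exact hV.abs_sub_le_osc (cball_subset _ _) he he'
  · push Not at hc
    rw [transfer, transfer, if_neg hc.1, if_neg hc.2, sub_self, abs_zero]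
    exact osc_nonneg _ _

lemma transfer_image_circ [OddBase p] (w v : List (Digit p)) (u : ℂ → ℝ) :
    transfer w u '' circ (some (w ++ v)) = u '' circ (some v) := by
  have : circ (some (w ++ v)) = wordMap w '' circ (some v) := by
    simp only [circ, image_image, wordMap_append]
  rw [this, image_image]
  exact image_congr fun y hy => transfer_wordMap w u
    (openSq_subset_unitSq (circ_some_subset_openSq v hy))

lemma transfer_circ_of_notPrefix [OddBase p] {w : List (Digit p)} {u : ℂ → ℝ}
    (h1 : ∀ z ∈ outerSquare, u z = 1) {i : Option (List (Digit p))}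
    (hi : ∀ v, i ≠ some (w ++ v)) {z : ℂ} (hz : z ∈ circ i) : transfer w u z = 1 := by
  refine transfer_of_notMem h1 ?_
  rintro ⟨y, hy, rfl⟩
  cases i with
  | none => exact notMem_outerSquare (wordMap_mem_openSq w hy) hz
  | some v =>
    refine (separated_cell_hole ?_).notMem_openSq hy hz
    rintro ⟨v', rfl⟩
    exact hi v' rfl

lemma osc_transfer_circ_of_notPrefix [OddBase p] {w : List (Digit p)} {u : ℂ → ℝ}
    (h1 : ∀ z ∈ outerSquare, u z = 1) {i : Option (List (Digit p))}
    (hi : ∀ v, i ≠ some (w ++ v)) : osc (transfer w u) (circ i) = 0 :=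
  le_antisymm (osc_le le_rfl fun z hz z' hz' => by
    rw [transfer_circ_of_notPrefix h1 hi hz, transfer_circ_of_notPrefix h1 hi hz', sub_self,
      abs_zero]) (osc_nonneg _ _)

lemma osc_transfer_circ [OddBase p] (w v : List (Digit p)) (u : ℂ → ℝ) :
    osc (transfer w u) (circ (some (w ++ v))) = osc u (circ (some v)) := by
  rw [osc, transfer_image_circ, osc]

lemma kap_transfer_circ [OddBase p] (a : ℝ) (w v : List (Digit p)) (u : ℂ → ℝ) :
    kap a (transfer w u) (circ (some (w ++ v))) = kap a u (circ (some v)) := by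
  rw [kap, transfer_image_circ, kap]

lemma append_some_injective (w : List (Digit p)) :
    Function.Injective fun v => some (w ++ v) := fun _ _ h =>
  List.append_cancel_left (Option.some_injective _ h)

lemma adm_transfer [OddBase p] (w : List (Digit p)) {u : ℂ → ℝ} (hs : Symm u) (hu : Adm p u)
    (h1 : ∀ z ∈ outerSquare, u z = 1) : Adm p (transfer w u) where
  unit := unitValued_transfer w hu.unit
  packing := packing_transfer w hs hu.unit hu.packing h1
  summable := by
    refine ((append_some_injective w).summable_iff fun i hi => ?_).1 ?_
    · rw [osc_transfer_circ_of_notPrefix h1 fun v hv => hi ⟨v, hv.symm⟩]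
      norm_num
    · simp only [Function.comp_def, osc_transfer_circ]
      exact hu.summable.comp_injective (Option.some_injective _)

/-! ### Truncations -/

lemma abs_max_sub_le (a s s' : ℝ) : |max (s - a) 0 - max (s' - a) 0| ≤ |s - s'| := by
  refine (abs_max_sub_max_le_max _ _ _ _).trans ?_
  simp

/-- Raising the part of `u` above the level `1 - t` gives a lower bound for the weights. -/
lemma Joins.le_energy_add_weight [OddBase p] {u : ℂ → ℝ}
    (hu : Joins p (middleSquare p) outerSquare u) {t y : ℝ} (ht0 : 0 < t) (ht1 : t ≤ 1)
    (hy : 0 < y) : (1 + y * t) ^ 2 * minEnergy p ≤ energy p u +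
      2 * y * ∑' i : Option (List (Digit p)), weight (1 - t) u (circ i) + y ^ 2 * energy p u := by
  set a : ℝ := 1 - t with ha
  have hc : 0 < 1 + y * t := by positivity
  set v : ℂ → ℝ := fun z => (u z + y * max (u z - a) 0) / (1 + y * t) with hv
  have hinc : ∀ z z', |v z - v z'| ≤ (1 + y) * (|u z - u z'| + |u z - u z'|) := fun z z' => by
    have h1 := abs_le.1 (abs_max_sub_le a (u z) (u z'))
    have h2 := abs_le.1 (le_refl |u z - u z'|)
    have h3 : v z - v z' =
        ((u z - u z') + y * (max (u z - a) 0 - max (u z' - a) 0)) / (1 + y * t) := by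
      simp only [hv]
      ring
    rw [h3, abs_div, abs_of_pos hc, div_le_iff₀ hc]
    have h4 : |u z - u z' + y * (max (u z - a) 0 - max (u z' - a) 0)| ≤
        (1 + y) * |u z - u z'| := abs_le.2 ⟨by nlinarith, by nlinarith⟩
    have h5 : 0 ≤ (1 + y) * |u z - u z'| := by positivity
    have h6 : 0 ≤ (1 + y) * |u z - u z'| * (y * t) := by positivity
    nlinarith
  have hunit : UnitValued p v := fun z hz => by
    obtain ⟨h0, h1⟩ := hu.unit z hz
    have h2 : max (u z - a) 0 ≤ t := max_le (by linarith) ht0.le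
    have h3 : 0 ≤ max (u z - a) 0 := le_max_right _ _
    exact ⟨by positivity, (div_le_one hc).2 (by nlinarith)⟩
  have hadm : Adm p v := hu.toAdm.comb hu.toAdm hunit (by linarith) fun z _ z' _ => hinc z z'
  have hjoin : Joins p (middleSquare p) outerSquare v := ⟨hadm, fun z hz => by
      simp only [hv]
      rw [hu.zero z hz, max_eq_right (by linarith)]
      simp, fun z hz => by
      simp only [hv]
      rw [hu.one z hz, max_eq_left (by linarith), div_eq_one_iff_eq hc.ne', ha]
      ring⟩
  have hterm : ∀ i : Option (List (Digit p)), (1 + y * t) ^ 2 * osc v (circ i) ^ 2 ≤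
      osc u (circ i) ^ 2 + 2 * y * weight a u (circ i) + y ^ 2 * osc u (circ i) ^ 2 := fun i => by
    have hS := circ_subset_carpet i
    have hκ0 := hu.unit.kap_nonneg hS a
    have hκ1 := hu.unit.kap_le_osc hS a
    have hρ0 := osc_nonneg u (circ i)
    have hb : ∀ z ∈ circ i, (sInf (u '' circ i) + y * max (sInf (u '' circ i) - a) 0 ≤
        u z + y * max (u z - a) 0) ∧ u z + y * max (u z - a) 0 ≤
        sSup (u '' circ i) + y * max (sSup (u '' circ i) - a) 0 := fun z hz => by
      have h1 := hu.unit.le_sup hS hz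
      have h2 := hu.unit.inf_le hS hz
      exact ⟨by gcongr, by gcongr⟩
    have h1 : osc v (circ i) ≤ (osc u (circ i) + y * kap a u (circ i)) / (1 + y * t) := by
      refine osc_le (by positivity) fun z hz z' hz' => ?_
      have e : v z - v z' = ((u z + y * max (u z - a) 0) - (u z' + y * max (u z' - a) 0)) /
          (1 + y * t) := by
        simp only [hv]
        ring
      rw [e, abs_div, abs_of_pos hc]
      gcongr
      rw [hu.unit.osc_eq hS, kap]
      obtain ⟨b1, b2⟩ := hb z hz
      obtain ⟨b3, b4⟩ := hb z' hz'
      exact abs_sub_le_iff.2 ⟨by linarith, by linarith⟩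
    rw [le_div_iff₀ hc] at h1
    calc (1 + y * t) ^ 2 * osc v (circ i) ^ 2 = (osc v (circ i) * (1 + y * t)) ^ 2 := by ring
      _ ≤ (osc u (circ i) + y * kap a u (circ i)) ^ 2 :=
          pow_le_pow_left₀ (mul_nonneg (osc_nonneg _ _) hc.le) h1 2
      _ = osc u (circ i) ^ 2 + 2 * y * weight a u (circ i) + y ^ 2 * kap a u (circ i) ^ 2 := by
          rw [weight]
          ring
      _ ≤ _ := by gcongr
  have hsum := (hadm.summable.mul_left ((1 + y * t) ^ 2)).tsum_le_tsum hterm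
    ((hu.summable.add ((hu.summable_weight a).mul_left (2 * y))).add
      (hu.summable.mul_left (y ^ 2)))
  rw [(hu.summable.add ((hu.summable_weight a).mul_left (2 * y))).tsum_add
      (hu.summable.mul_left (y ^ 2)), hu.summable.tsum_add
      ((hu.summable_weight a).mul_left (2 * y)), tsum_mul_left, tsum_mul_left, tsum_mul_left] at hsum
  exact (mul_le_mul_of_nonneg_left (minEnergy_le hjoin) (sq_nonneg _)).trans hsum

/-- Lowering the part of `U` above the level `a`, cut off by `φ`. -/
def lower (x a : ℝ) (U φ : ℂ → ℝ) (z : ℂ) : ℝ := U z - x * φ z * max (U z - a) 0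

section Lower

variable {U φ : ℂ → ℝ} {x t : ℝ}

lemma lower_mem_Icc {a s f : ℝ} (hx : x ∈ Icc (0 : ℝ) 1) (hf : f ∈ Icc (0 : ℝ) 1) :
    s - x * f * max (s - a) 0 ∈ Icc (min s a) s := by
  have h0 : 0 ≤ x * f := mul_nonneg hx.1 hf.1
  have h1 : x * f ≤ 1 := mul_le_one₀ hx.2 hf.1 hf.2
  rcases le_total s a with h | h
  · rw [min_eq_left h, max_eq_right (by linarith)]
    exact ⟨by linarith, by linarith⟩
  · rw [min_eq_right h, max_eq_left (by linarith)]
    exact ⟨by nlinarith, by nlinarith⟩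

lemma Adm.lower [OddBase p] (hU : Adm p U) (hφ : Adm p φ) (hx : x ∈ Icc (0 : ℝ) 1)
    (ht : t ∈ Icc (0 : ℝ) 1) : Adm p (lower x (1 - t) U φ) := by
  refine hU.comb hφ (c := 2) (fun z hz => ?_) two_pos.le fun z hz z' hz' => ?_
  · have h1 := hU.unit z hz
    have h := lower_mem_Icc (a := 1 - t) (s := U z) hx (hφ.unit z hz)
    exact ⟨(le_min h1.1 (by linarith [ht.2])).trans h.1, h.2.trans h1.2⟩
  · have f1 := hφ.unit z hz
    have h1 := hU.unit z' hz'
    set m := max (U z - (1 - t)) 0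
    set m' := max (U z' - (1 - t)) 0
    have hm0 : 0 ≤ m' := le_max_right _ _
    have hm1 : m' ≤ 1 := max_le (by linarith [h1.2, ht.2]) zero_le_one
    have e : Carpet.lower x (1 - t) U φ z - Carpet.lower x (1 - t) U φ z' =
        (U z - U z') - (x * φ z * (m - m') + x * m' * (φ z - φ z')) := by
      simp only [Carpet.lower, m, m']
      ring
    rw [e]
    refine (abs_sub _ _).trans ?_
    have k1 : |x * φ z * (m - m')| ≤ |U z - U z'| := by
      rw [abs_mul, abs_of_nonneg (mul_nonneg hx.1 f1.1)]
      exact (mul_le_of_le_one_left (abs_nonneg _) (mul_le_one₀ hx.2 f1.1 f1.2)).trans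
        (abs_max_sub_le _ _ _)
    have k2 : |x * m' * (φ z - φ z')| ≤ |φ z - φ z'| := by
      rw [abs_mul, abs_of_nonneg (mul_nonneg hx.1 hm0)]
      exact mul_le_of_le_one_left (abs_nonneg _) (mul_le_one₀ hx.2 hm0 hm1)
    have k3 := abs_add_le (x * φ z * (m - m')) (x * m' * (φ z - φ z'))
    linarith [abs_nonneg (φ z - φ z')]

open Classical in
/-- The indicator of `φ = 1` on `D`. -/
def fullInd (φ : ℂ → ℝ) (D : Set ℂ) : ℝ := if ∀ z ∈ D, φ z = 1 then 1 else 0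

lemma fullInd_nonneg (φ : ℂ → ℝ) (D : Set ℂ) : 0 ≤ fullInd φ D := by
  unfold fullInd; split_ifs <;> simp

lemma fullInd_le_one (φ : ℂ → ℝ) (D : Set ℂ) : fullInd φ D ≤ 1 := by
  unfold fullInd; split_ifs <;> simp

lemma UnitValued.osc_lower_sq_le (hU : UnitValued p U) (hφ : UnitValued p φ)
    (hx : x ∈ Icc (0 : ℝ) 1) (ht : t ∈ Icc (0 : ℝ) 1) {D : Set ℂ} (hD : D ⊆ sierpinskiCarpet p) :
    osc (lower x (1 - t) U φ) D ^ 2 ≤ osc U D ^ 2 - 2 * x * (fullInd φ D * weight (1 - t) U D) +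
      x / 8 * weight (1 - t) U D + 8 * x * t ^ 2 * osc φ D ^ 2 +
      x ^ 2 * (osc U D ^ 2 + osc φ D ^ 2) := by
  obtain ⟨hx0, hx1⟩ := hx
  obtain ⟨ht0, ht1⟩ := ht
  set a := 1 - t with ha
  have hκ0 := hU.kap_nonneg hD a
  have hκ1 := hU.kap_le_osc hD a
  have hw := hU.weight_nonneg hD a
  have hρ0 := osc_nonneg U D
  have hσ0 := osc_nonneg φ D
  have hρ := hU.osc_eq hD
  set ρ := osc U D
  set σ := osc φ D
  have hxw : 0 ≤ x * weight a U D := mul_nonneg hx0 hw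
  have hxt : 0 ≤ x * t ^ 2 * σ ^ 2 := by positivity
  by_cases hf : ∀ z ∈ D, φ z = 1
  · rw [fullInd, if_pos hf]
    have mono : ∀ s s', s ≤ s' → s - x * max (s - a) 0 ≤ s' - x * max (s' - a) 0 := by
      intro s s' hs
      have h1 := (le_abs_self _).trans (abs_max_sub_le a s' s)
      rw [abs_of_nonneg (by linarith)] at h1
      have h2 : 0 ≤ max (s' - a) 0 - max (s - a) 0 :=
        sub_nonneg.2 (max_le_max_right _ (by linarith))
      nlinarith
    have h1 : osc (lower x a U φ) D ≤ ρ - x * kap a U D := by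
      refine osc_le (by nlinarith) fun z hz z' hz' => ?_
      simp only [lower]
      rw [hf z hz, hf z' hz', mul_one, hρ, kap]
      have a1 := mono _ _ (hU.le_sup hD hz)
      have a2 := mono _ _ (hU.le_sup hD hz')
      have a3 := mono _ _ (hU.inf_le hD hz)
      have a4 := mono _ _ (hU.inf_le hD hz')
      exact abs_sub_le_iff.2 ⟨by linarith, by linarith⟩
    have h2 := pow_le_pow_left₀ (osc_nonneg _ _) h1 2
    have h3 : (ρ - x * kap a U D) ^ 2 = ρ ^ 2 - 2 * x * weight a U D + x ^ 2 * kap a U D ^ 2 := by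
      rw [weight]
      ring
    have h4 : x ^ 2 * kap a U D ^ 2 ≤ x ^ 2 * ρ ^ 2 := by gcongr
    have h5 : 0 ≤ x ^ 2 * σ ^ 2 := by positivity
    linarith
  · rw [fullInd, if_neg hf]
    have hx2 : 0 ≤ x ^ 2 * (ρ ^ 2 + σ ^ 2) := by positivity
    rcases lt_or_ge (sInf (U '' D)) a with hlo | hlo
    · have h1 : osc (lower x a U φ) D ≤ ρ := by
        have key : ∀ z ∈ D, sInf (U '' D) ≤ lower x a U φ z ∧ lower x a U φ z ≤ sSup (U '' D) :=
          fun z hz => by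
            have h := lower_mem_Icc (a := a) (s := U z) ⟨hx0, hx1⟩ (hφ z (hD hz))
            exact ⟨(le_min (hU.inf_le hD hz) hlo.le).trans h.1, h.2.trans (hU.le_sup hD hz)⟩
        refine osc_le hρ0 fun z hz z' hz' => ?_
        have a1 := key z hz
        have a2 := key z' hz'
        rw [hρ]
        exact abs_sub_le_iff.2 ⟨by linarith, by linarith⟩
      have h2 := pow_le_pow_left₀ (osc_nonneg _ _) h1 2
      linarith
    · have hκ : weight a U D = ρ ^ 2 := by
        have := hU.inf_le_sup hD
        rw [weight, kap, max_eq_left (by linarith), max_eq_left (by linarith), sq]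
        congr 1
        rw [hρ]
        ring
      have h1 : osc (lower x a U φ) D ≤ ρ + x * t * σ := by
        refine osc_le (by positivity) fun z hz z' hz' => ?_
        have b1 : a ≤ U z := hlo.trans (hU.inf_le hD hz)
        have b2 : a ≤ U z' := hlo.trans (hU.inf_le hD hz')
        have b3 := (hU z' (hD hz')).2
        have f1 := hφ z (hD hz)
        have e : lower x a U φ z - lower x a U φ z' =
            (1 - x * φ z) * (U z - U z') - x * (U z' - a) * (φ z - φ z') := by
          simp only [lower]
          rw [max_eq_left (by linarith), max_eq_left (by linarith)]
          ring
        rw [e]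
        refine (abs_sub _ _).trans (add_le_add ?_ ?_)
        · have c0 : 0 ≤ x * φ z := mul_nonneg hx0 f1.1
          have c1 : x * φ z ≤ 1 := mul_le_one₀ hx1 f1.1 f1.2
          rw [abs_mul, abs_of_nonneg (by linarith)]
          exact (mul_le_of_le_one_left (abs_nonneg _) (by linarith)).trans
            (hU.abs_sub_le_osc hD hz hz')
        · have c0 : 0 ≤ U z' - a := by linarith
          have c1 : U z' - a ≤ t := by linarith
          rw [abs_mul, abs_of_nonneg (by positivity)]
          gcongr
          exact hφ.abs_sub_le_osc hD hz hz'
      have h2 := pow_le_pow_left₀ (osc_nonneg _ _) h1 2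
      rw [hκ]
      have h3 : 0 ≤ x * (ρ - 8 * t * σ) ^ 2 := by positivity
      have h4 : x ^ 2 * t ^ 2 * σ ^ 2 ≤ x ^ 2 * σ ^ 2 := by
        have : t ^ 2 ≤ 1 := pow_le_one₀ ht0 ht1
        have h5 : 0 ≤ x ^ 2 * σ ^ 2 := by positivity
        nlinarith
      have h5 : 0 ≤ x ^ 2 * ρ ^ 2 := by positivity
      nlinarith

lemma Adm.energy_lower_le [OddBase p] (hU : Adm p U) (hφ : Adm p φ) (hx : x ∈ Icc (0 : ℝ) 1)
    (ht : t ∈ Icc (0 : ℝ) 1) : energy p (Carpet.lower x (1 - t) U φ) ≤ energy p U -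
      2 * x * ∑' i : Option (List (Digit p)), fullInd φ (circ i) * weight (1 - t) U (circ i) +
      x / 8 * ∑' i : Option (List (Digit p)), weight (1 - t) U (circ i) +
      8 * x * t ^ 2 * energy p φ + x ^ 2 * (energy p U + energy p φ) := by
  have hw : ∀ i : Option (List (Digit p)), 0 ≤ weight (1 - t) U (circ i) := fun i =>
    hU.unit.weight_nonneg (circ_subset_carpet i) _
  have s1 := hU.summable
  have s2 := hφ.summable
  have s3 := hU.summable_weight (1 - t)
  have s4 : Summable fun i : Option (List (Digit p)) =>
      fullInd φ (circ i) * weight (1 - t) U (circ i) :=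
    Summable.of_nonneg_of_le (fun i => mul_nonneg (fullInd_nonneg _ _) (hw i))
      (fun i => mul_le_of_le_one_left (hw i) (fullInd_le_one _ _)) s3
  exact hasSum_le (fun i => hU.unit.osc_lower_sq_le hφ.unit hx ht (circ_subset_carpet i))
    (hU.lower hφ hx ht).summable.hasSum
    ((((s1.hasSum.sub (s4.hasSum.mul_left (2 * x))).add (s3.hasSum.mul_left (x / 8))).add
      (s2.hasSum.mul_left (8 * x * t ^ 2))).add ((s1.hasSum.add s2.hasSum).mul_left (x ^ 2)))

end Lower

/-! ### The choice of parameters -/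

lemma exists_params {m Φ : ℝ} (hm : 0 < m) (hΦ : 0 ≤ Φ) :
    ∃ t x y ε : ℝ, t ∈ Ioc (0 : ℝ) 1 ∧ x ∈ Icc (0 : ℝ) 1 ∧ 0 < y ∧ 0 < ε ∧ ∀ E R : ℝ,
      E ≤ m + ε → (1 + y * t) ^ 2 * m ≤ E + 2 * y * R + y ^ 2 * E →
      E - 3 / 8 * x * R + 8 * x * t ^ 2 * Φ + x ^ 2 * (E + Φ) < m := by
  obtain ⟨t, ht0, ht1, ht2⟩ : ∃ t : ℝ, 0 < t ∧ t ≤ 1 ∧ 128 * (t * (Φ + 1)) ≤ m := by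
    refine ⟨min 1 (m / (128 * (Φ + 1))), by positivity, min_le_left _ _, ?_⟩
    have h := min_le_right 1 (m / (128 * (Φ + 1)))
    rw [le_div_iff₀ (by positivity)] at h
    linarith
  obtain ⟨y, hy0, hy⟩ : ∃ y : ℝ, 0 < y ∧ 4 * (y * (m + 1)) = t * m :=
    ⟨t * m / (4 * (m + 1)), by positivity, by field_simp⟩
  obtain ⟨x, hx0, hx1, hx2⟩ : ∃ x : ℝ, 0 < x ∧ x ≤ 1 ∧ 16 * (x * (m + 1 + Φ)) ≤ t * m := by
    refine ⟨min 1 (t * m / (16 * (m + 1 + Φ))), by positivity, min_le_left _ _, ?_⟩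
    have h := min_le_right 1 (t * m / (16 * (m + 1 + Φ)))
    rw [le_div_iff₀ (by positivity)] at h
    linarith
  have hytm : 0 < y * (t * m) := by positivity
  have hxtm : 0 < x * (t * m) := by positivity
  obtain ⟨ε, hε0, hε1, hε2, hε3⟩ : ∃ ε : ℝ, 0 < ε ∧ ε ≤ 1 ∧ 4 * ε ≤ y * (t * m) ∧
      16 * ε ≤ x * (t * m) := by
    refine ⟨min 1 (min (y * (t * m) / 4) (x * (t * m) / 16)), by positivity, min_le_left _ _, ?_, ?_⟩
    · linarith [(min_le_right 1 (min (y * (t * m) / 4) (x * (t * m) / 16))).trans (min_le_left _ _)]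
    · linarith [(min_le_right 1 (min (y * (t * m) / 4) (x * (t * m) / 16))).trans (min_le_right _ _)]
  refine ⟨t, x, y, ε, ⟨ht0, ht1⟩, ⟨hx0.le, hx1⟩, hy0, hε0, fun E R hE h => ?_⟩
  have hE1 : E ≤ m + 1 := by linarith
  have h1 : y ^ 2 * E ≤ y * (t * m) / 4 := by
    have : y ^ 2 * E ≤ y ^ 2 * (m + 1) := by gcongr
    nlinarith
  have h2 : (1 + y * t) ^ 2 * m = m + 2 * (y * (t * m)) + (y * t) ^ 2 * m := by ring
  have h3 : 0 ≤ (y * t) ^ 2 * m := by positivity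
  have h4 : 0 ≤ y * (R - 3 / 4 * (t * m)) := by nlinarith
  have h5 : 3 / 4 * (t * m) ≤ R := by
    have := nonneg_of_mul_nonneg_right h4 hy0
    linarith
  have h6 : x * (3 / 4 * (t * m)) ≤ x * R := by gcongr
  have h7 : x * t * (128 * (t * (Φ + 1))) ≤ x * t * m := by gcongr
  have h8 : 0 ≤ x * t * t := by positivity
  have h9 : x * (16 * (x * (m + 1 + Φ))) ≤ x * (t * m) := by gcongr
  have h10 : x ^ 2 * (E + Φ) ≤ x ^ 2 * (m + 1 + Φ) := by gcongr
  nlinarith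

/-! ### Strictness -/

lemma exists_flip_far {q x0 : ℝ} (hq : q ≤ 1 / 3) (hq0 : 0 < q) (h0 : 0 ≤ x0) (h1 : x0 + q ≤ 1) :
    ∃ b, ∀ s ∈ Icc (0 : ℝ) 1, 1 / 3 ≤ flip b s → q / 3 ≤ x0 + s * q ∧ x0 + s * q ≤ 1 - q / 3 := by
  by_cases h : q / 3 ≤ x0
  · refine ⟨true, fun s hs hf => ?_⟩
    simp only [flip, if_true] at hf
    exact ⟨by nlinarith [hs.1], by nlinarith⟩
  · refine ⟨false, fun s hs hf => ?_⟩
    simp only [flip, Bool.false_eq_true, if_false] at hf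
    exact ⟨by nlinarith, by nlinarith [hs.2]⟩

lemma exists_far [OddBase p] {w : List (Digit p)} (hw : w ≠ []) {i : Option (List (Digit p))}
    (hi : ∀ v, i ≠ some (w ++ v)) : ∃ g, ∀ y ∈ unitSq, refl g y ∈ farSq → ∀ c ∈ circ i,
      1 / (3 * (p : ℝ) ^ w.length) ≤ dist (wordMap w y) c := by
  have hP : (0 : ℝ) < (p : ℝ) ^ w.length := pow_pos base_pos _
  set q : ℝ := 1 / (p : ℝ) ^ w.length with hq
  have hq0 : 0 < q := by positivity
  have hq3 : 1 / (3 * (p : ℝ) ^ w.length) = q / 3 := by rw [hq]; field_simp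
  have hre : ∀ z, (wordMap w z).re = (corner w).re + z.re * q := fun z => by
    rw [wordMap_re, hq]; ring
  have him : ∀ z, (wordMap w z).im = (corner w).im + z.im * q := fun z => by
    rw [wordMap_im, hq]; ring
  have h1mem : wordMap w ⟨1, 1⟩ ∈ wordMap w '' unitSq := ⟨_, by simp [unitSq], rfl⟩
  have h0mem : corner w ∈ wordMap w '' unitSq := ⟨0, by simp [unitSq], rfl⟩
  rw [hq3]
  cases i with
  | none =>
    have hqle : q ≤ 1 / 3 := by
      have h1 : (p : ℝ) ^ 1 ≤ (p : ℝ) ^ w.length :=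
        pow_le_pow_right₀ (by linarith [three_le_base (p := p)]) (List.length_pos_iff.2 hw)
      rw [pow_one] at h1
      exact one_div_le_one_div_of_le (by norm_num) (three_le_base.trans h1)
    have h0 := wordMap_image_subset_unitSq w le_rfl h0mem
    have h1 := wordMap_image_subset_unitSq w le_rfl h1mem
    have k1 := h1.1.2
    have k2 := h1.2.2
    rw [hre, one_mul] at k1
    rw [him, one_mul] at k2
    obtain ⟨a, ha⟩ := exists_flip_far hqle hq0 h0.1.1 k1
    obtain ⟨b, hb⟩ := exists_flip_far hqle hq0 h0.2.1 k2
    refine ⟨(a, b), fun y hy hf c hc => ?_⟩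
    have ha := ha _ hy.1 hf.1
    have hb := hb _ hy.2 hf.2
    have d1 := abs_le.1 (abs_re_sub_le_dist (wordMap w y) c)
    have d2 := abs_le.1 (abs_im_sub_le_dist (wordMap w y) c)
    rw [hre] at d1
    rw [him] at d2
    rcases (mem_outerSquare.1 hc).2 with h | h | h | h <;> linarith
  | some v =>
    have hwv : ¬w <+: v := by
      rintro ⟨v', rfl⟩
      exact hi v' rfl
    rcases separated_cell_hole hwv with ⟨c, hA, hB⟩ | ⟨c, hA, hB⟩ | ⟨c, hA, hB⟩ | ⟨c, hA, hB⟩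
    · refine ⟨(true, true), fun y hy hf z hz => ?_⟩
      have k1 := hf.1
      simp only [refl, flip, if_true] at k1
      have a1 := hA _ h1mem
      have a2 := hB z hz
      have d1 := abs_le.1 (abs_re_sub_le_dist (wordMap w y) z)
      rw [hre] at a1 d1
      nlinarith
    · refine ⟨(false, false), fun y hy hf z hz => ?_⟩
      have k1 := hf.1
      simp only [refl, flip, Bool.false_eq_true, if_false] at k1
      have a1 := hA _ h0mem
      have a2 := hB z hz
      have d1 := abs_le.1 (abs_re_sub_le_dist (wordMap w y) z)
      rw [hre] at d1
      nlinarith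
    · refine ⟨(true, true), fun y hy hf z hz => ?_⟩
      have k1 := hf.2
      simp only [refl, flip, if_true] at k1
      have a1 := hA _ h1mem
      have a2 := hB z hz
      have d1 := abs_le.1 (abs_im_sub_le_dist (wordMap w y) z)
      rw [him] at a1 d1
      nlinarith
    · refine ⟨(false, false), fun y hy hf z hz => ?_⟩
      have k1 := hf.2
      simp only [refl, flip, Bool.false_eq_true, if_false] at k1
      have a1 := hA _ h0mem
      have a2 := hB z hz
      have d1 := abs_le.1 (abs_im_sub_le_dist (wordMap w y) z)
      rw [him] at d1
      nlinarith

lemma tsum_some_eq {f : Option (List (Digit p)) → ℝ} (h : f none = 0) :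
    ∑' v, f (some v) = ∑' i, f i :=
  (Option.some_injective _).tsum_eq fun i hi => by
    cases i with
    | none => exact absurd h hi
    | some v => exact ⟨v, rfl⟩

lemma tsum_append_eq {w : List (Digit p)} {f : Option (List (Digit p)) → ℝ}
    (h : ∀ i, (∀ v, i ≠ some (w ++ v)) → f i = 0) : ∑' v, f (some (w ++ v)) = ∑' i, f i :=
  (append_some_injective w).tsum_eq fun i hi => by
    by_contra hc
    exact hi (h i fun v hv => hc ⟨v, hv.symm⟩)

/-- The minimal energy between two other peripheral circles is smaller than the one between the
middle square and the outer square. -/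
theorem exists_joins_energy_lt [OddBase p] {w : List (Digit p)} (hw : w ≠ [])
    {i : Option (List (Digit p))} (hi : ∀ v, i ≠ some (w ++ v)) :
    ∃ W, Joins p (circ (some w)) (circ i) W ∧ energy p W < minEnergy p := by
  have hP : (0 : ℝ) < (p : ℝ) ^ w.length := pow_pos base_pos _
  have hL : (0 : ℝ) < 3 * (p : ℝ) ^ w.length := by positivity
  set φ := bump (3 * (p : ℝ) ^ w.length) (circ i) with hφdef
  have hφ : Adm p φ := adm_bump hL.le _
  obtain ⟨g, hg⟩ := exists_far hw hi
  obtain ⟨t, x, y, ε, ⟨ht0, ht1⟩, hx, hy, hε, hpar⟩ :=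
    exists_params (minEnergy_pos (p := p)) (energy_nonneg (p := p) φ)
  obtain ⟨u₀, hu₀, hE₀⟩ := exists_energy_lt (p := p) hε
  obtain ⟨u, hu, hE, hs⟩ := hu₀.exists_symm
  have hU := adm_transfer w hs hu.toAdm hu.one
  have ht : t ∈ Icc (0 : ℝ) 1 := ⟨ht0.le, ht1⟩
  refine ⟨lower x (1 - t) (transfer w u) φ, ⟨hU.lower hφ hx ht, ?_, ?_⟩, ?_⟩
  · rintro _ ⟨z, hz, rfl⟩
    simp only [lower]
    rw [transfer_wordMap w u (middleSquare_subset_unitSq hz), hu.zero z hz,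
      max_eq_right (by linarith)]
    ring
  · intro z hz
    simp only [lower]
    rw [hφdef, bump_of_mem hz, transfer_circ_of_notPrefix hu.one hi hz]
    ring
  · refine (hU.energy_lower_le hφ hx ht).trans_lt ?_
    have hnone : weight (1 - t) u (circ (none : Option (List (Digit p)))) = 0 := by
      rw [weight, show osc u (circ none) = 0 from hu.osc_outer, zero_mul]
    have hweight : ∀ v, weight (1 - t) (transfer w u) (circ (some (w ++ v))) =
        weight (1 - t) u (circ (some v)) := fun v => by
      rw [weight, osc_transfer_circ, kap_transfer_circ, weight]
    have e1 : energy p (transfer w u) = energy p u := by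
      unfold energy
      rw [← tsum_append_eq (w := w) fun i hi => by
        rw [osc_transfer_circ_of_notPrefix hu.one hi]; norm_num]
      simp only [osc_transfer_circ]
      refine tsum_some_eq (f := fun i => osc u (circ i) ^ 2) ?_
      rw [show osc u (circ none) = 0 from hu.osc_outer]
      norm_num
    have e2 : ∑' i : Option (List (Digit p)), weight (1 - t) (transfer w u) (circ i) =
        ∑' i : Option (List (Digit p)), weight (1 - t) u (circ i) := by
      rw [← tsum_append_eq (w := w) fun i hi => by
        rw [weight, osc_transfer_circ_of_notPrefix hu.one hi, zero_mul]]
      simp only [hweight]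
      exact tsum_some_eq (f := fun i => weight (1 - t) u (circ i)) hnone
    have hsum : Summable fun v => fullInd φ (circ (some (w ++ v))) *
        weight (1 - t) u (circ (some v)) := by
      have hnn : ∀ v : List (Digit p), 0 ≤ weight (1 - t) u (circ (some v)) := fun v =>
        hu.unit.weight_nonneg (circ_subset_carpet _) _
      exact Summable.of_nonneg_of_le (fun v => mul_nonneg (fullInd_nonneg _ _) (hnn v))
        (fun v => mul_le_of_le_one_left (hnn v) (fullInd_le_one _ _))
        ((hu.summable_weight (1 - t)).comp_injective (Option.some_injective _))
    have e3 : ∑' i : Option (List (Digit p)), farInd g i * weight (1 - t) u (circ i) ≤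
        ∑' i : Option (List (Digit p)),
          fullInd φ (circ i) * weight (1 - t) (transfer w u) (circ i) := by
      rw [← tsum_append_eq (w := w) (f := fun i => fullInd φ (circ i) *
        weight (1 - t) (transfer w u) (circ i)) fun i hi => by
          rw [weight, osc_transfer_circ_of_notPrefix hu.one hi, zero_mul, mul_zero]]
      rw [← tsum_some_eq (f := fun i => farInd g i * weight (1 - t) u (circ i)) (by
        rw [hnone, mul_zero])]
      simp only [hweight]
      refine ((hu.summable_farInd (1 - t) g).comp_injective
        (Option.some_injective _)).tsum_le_tsum (fun v => ?_) hsum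
      refine mul_le_mul_of_nonneg_right ?_ (hu.unit.weight_nonneg (circ_subset_carpet _) _)
      by_cases hv : MapsTo (refl g) (circ (some v)) farSq
      · have h1 : ∀ z ∈ circ (some (w ++ v)), φ z = 1 := by
          rintro _ ⟨z, hz, rfl⟩
          rw [wordMap_append]
          have hzv : wordMap v z ∈ circ (some v) := ⟨z, hz, rfl⟩
          exact bump_eq_one hL (circ_nonempty i) (hg _
            (openSq_subset_unitSq (circ_some_subset_openSq v hzv)) (hv hzv))
        rw [fullInd, if_pos h1]
        exact farInd_le_one _ _
      · rw [farInd, if_neg hv]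
        exact fullInd_nonneg _ _
    have e4 := hu.tsum_weight_le hs (1 - t) g
    have e5 := hpar (energy p u) (∑' i : Option (List (Digit p)), weight (1 - t) u (circ i))
      (by linarith) (hu.le_energy_add_weight ht0 ht1 hy)
    rw [e1, e2]
    have hx0 := hx.1
    nlinarith

/-! ### The distinguished pair of peripheral circles -/

lemma exists_joins_circ_energy_lt [OddBase p] {i j : Option (List (Digit p))} (hij : i ≠ j)
    (h1 : ¬(i = none ∧ j = some [])) (h2 : ¬(i = some [] ∧ j = none)) :
    ∃ W, Joins p (circ i) (circ j) W ∧ energy p W < minEnergy p := by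
  have swap : (∃ W, Joins p (circ j) (circ i) W ∧ energy p W < minEnergy p) →
      ∃ W, Joins p (circ i) (circ j) W ∧ energy p W < minEnergy p := by
    rintro ⟨W, hW, hE⟩
    exact ⟨_, hW.one_sub.1, hW.one_sub.2.trans_lt hE⟩
  have long : ∀ {w w' : List (Digit p)}, w ≠ w' → w'.length ≤ w.length →
      ∃ W, Joins p (circ (some w)) (circ (some w')) W ∧ energy p W < minEnergy p := by
    intro w w' hww hl
    refine exists_joins_energy_lt ?_ fun v hv => ?_
    · rintro rfl
      exact hww (List.length_eq_zero_iff.1 (Nat.le_zero.1 hl)).symm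
    · obtain rfl := Option.some_injective _ hv
      rw [List.length_append] at hl
      have : v = [] := List.length_eq_zero_iff.1 (by omega)
      simp [this] at hww
  cases i with
  | none =>
    cases j with
    | none => exact absurd rfl hij
    | some w => exact swap (exists_joins_energy_lt (fun h => h1 ⟨rfl, by rw [h]⟩) (by simp))
  | some w =>
    cases j with
    | none => exact exists_joins_energy_lt (fun h => h2 ⟨by rw [h], rfl⟩) (by simp)
    | some w' =>
      have hww : w ≠ w' := fun h => hij (by rw [h])
      rcases le_total w'.length w.length with h | h
      · exact long hww h
      · exact swap (long hww.symm h)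

theorem QSPair.image_pair [OddBase p] {F G : ℂ → ℂ} (h : QSPair p F G) :
    (F '' outerSquare = outerSquare ∧ F '' middleSquare p = middleSquare p) ∨
      (F '' outerSquare = middleSquare p ∧ F '' middleSquare p = outerSquare) := by
  obtain ⟨σ, hσ⟩ := h.exists_perm
  have hO : F '' outerSquare = circ (σ none) := hσ none
  have hmid : circ (some ([] : List (Digit p))) = middleSquare p := by simp [circ, wordMap]
  have hM : F '' middleSquare p = circ (σ (some [])) := by rw [← hmid, hσ]
  by_cases h1 : σ none = none ∧ σ (some []) = some []
  · exact Or.inl ⟨by rw [hO, h1.1]; rfl, by rw [hM, h1.2, hmid]⟩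
  by_cases h2 : σ none = some [] ∧ σ (some []) = none
  · exact Or.inr ⟨by rw [hO, h2.1, hmid], by rw [hM, h2.2]; rfl⟩
  obtain ⟨W, hW, hE⟩ := exists_joins_circ_energy_lt (i := σ (some [])) (j := σ none)
    (σ.injective.ne (by simp)) (fun h => h2 h.symm) (fun h => h1 h.symm)
  have hadm := h.adm hW.toAdm
  have hjoin : Joins p (middleSquare p) outerSquare fun z => W (F z) :=
    ⟨hadm.1, fun z hz => hW.zero _ (hM ▸ mem_image_of_mem F hz),
      fun z hz => hW.one _ (hO ▸ mem_image_of_mem F hz)⟩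
  exact absurd (minEnergy_le hjoin) (not_le.2 (hadm.2.trans_lt hE))

open Classical in
/-- The extension of a self-map of the carpet to the plane. -/
def extendMap (f : sierpinskiCarpet p → sierpinskiCarpet p) (z : ℂ) : ℂ :=
  if h : z ∈ sierpinskiCarpet p then f ⟨z, h⟩ else 0

lemma extendMap_coe (f : sierpinskiCarpet p → sierpinskiCarpet p) (z : sierpinskiCarpet p) :
    extendMap f z = f z := by
  simp [extendMap]

lemma continuousOn_extendMap {f : sierpinskiCarpet p → sierpinskiCarpet p} (hf : Continuous f) :
    ContinuousOn (extendMap f) (sierpinskiCarpet p) := by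
  rw [continuousOn_iff_continuous_domRestrict]
  have : (sierpinskiCarpet p).domRestrict (extendMap f) = fun z => (f z : ℂ) :=
    funext fun z => extendMap_coe f z
  rw [this]
  exact continuous_subtype_val.comp hf

lemma qsPair_extendMap (f : sierpinskiCarpet p ≃ₜ sierpinskiCarpet p) (hf : IsQSMap f) :
    QSPair p (extendMap f) (extendMap f.symm) where
  mapsTo z hz := by
    rw [extendMap_coe f ⟨z, hz⟩]
    exact (f _).2
  mapsTo' z hz := by
    rw [extendMap_coe f.symm ⟨z, hz⟩]
    exact (f.symm _).2
  left_inv z hz := by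
    rw [extendMap_coe f ⟨z, hz⟩, extendMap_coe, f.symm_apply_apply]
  right_inv z hz := by
    rw [extendMap_coe f.symm ⟨z, hz⟩, extendMap_coe, f.apply_symm_apply]
  cont := continuousOn_extendMap f.continuous
  cont' := continuousOn_extendMap f.symm.continuous
  qs := by
    obtain ⟨η, hη, hqs⟩ := hf
    refine ⟨η, hη.2.1.monotoneOn, fun x hx z hz w hw hxw => ?_⟩
    rw [extendMap_coe f ⟨x, hx⟩, extendMap_coe f ⟨z, hz⟩, extendMap_coe f ⟨w, hw⟩]
    exact hqs ⟨x, hx⟩ ⟨z, hz⟩ ⟨w, hw⟩ fun h => hxw (congrArg Subtype.val h)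

lemma image_preimage_coe_eq (f : sierpinskiCarpet p → sierpinskiCarpet p) {A : Set ℂ}
    (hA : A ⊆ sierpinskiCarpet p) :
    (fun x : sierpinskiCarpet p => (f x : ℂ)) '' (Subtype.val ⁻¹' A) = extendMap f '' A := by
  ext z
  constructor
  · rintro ⟨x, hx, rfl⟩
    exact ⟨x, hx, extendMap_coe f x⟩
  · rintro ⟨x, hx, rfl⟩
    exact ⟨⟨x, hA hx⟩, hx, (extendMap_coe f ⟨x, hA hx⟩).symm⟩

end

end Carpet

/-- **Quasisymmetries preserve the pair consisting of the outer and the middle square**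
(Corollary 5.2).  Every quasisymmetric self-homeomorphism `f` of `S_p` (`p ≥ 3` odd)
satisfies `{f(O), f(M)} = {O, M}`, where images are taken as subsets of the plane. -/
theorem qs_preserves_outer_middle_pair (p : ℕ) (hp : 3 ≤ p) (hodd : Odd p)
    (f : ↥(sierpinskiCarpet p) ≃ₜ ↥(sierpinskiCarpet p)) (hf : IsQSMap f) :
    ((fun x : ↥(sierpinskiCarpet p) => (f x : ℂ)) '' (Subtype.val ⁻¹' outerSquare)
        = outerSquare ∧
      (fun x : ↥(sierpinskiCarpet p) => (f x : ℂ)) '' (Subtype.val ⁻¹' middleSquare p)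
        = middleSquare p) ∨
    ((fun x : ↥(sierpinskiCarpet p) => (f x : ℂ)) '' (Subtype.val ⁻¹' outerSquare)
        = middleSquare p ∧
      (fun x : ↥(sierpinskiCarpet p) => (f x : ℂ)) '' (Subtype.val ⁻¹' middleSquare p)
        = outerSquare) := by
  have : Carpet.OddBase p := ⟨hp, hodd⟩
  rw [Carpet.image_preimage_coe_eq f Carpet.outerSquare_subset_carpet,
    Carpet.image_preimage_coe_eq f Carpet.middleSquare_subset_carpet]
  exact (Carpet.qsPair_extendMap f hf).image_pair
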